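/- Let q be a prime power and n ≥ 1. The number of isomorphism classes of irreducible cuspidal complex representations of GL_n(𝔽_q) equals (1/n)·|{x ∈ 𝔽_{q^n}^× : x^{q^d} ≠ x for all 1 ≤ d < n}|, i.e. the number of orbits of size exactly n of the Frobenius map x ↦ x^q acting on 𝔽_{q^n}^× (equivalently, one n-th of the number of elements of 𝔽_{q^n}^× of degree exactly n over 𝔽_q). -/

import Mathlib

open Matrix

/-- A representation is irreducible if the space is nonzero and the only invariant
subspaces are `⊥` and `⊤`. -/
def IsIrred {G V : Type*} [Group G] [AddCommGroup V] [Module ℂ V]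
    (ρ : Representation ℂ G V) : Prop :=
  (∃ v : V, v ≠ 0) ∧
    ∀ W : Submodule ℂ V, (∀ (g : G), ∀ v ∈ W, ρ g v ∈ W) → W = ⊥ ∨ W = ⊤

/-- `M` lies in the block upper unitriangular group `U(n_1, …, n_m)` associated to the
composition encoded by the monotone surjection `b : Fin n → Fin m` (sending a position
to the index of its block): the entries on or below the block diagonal agree with the
identity matrix. -/
def IsBlockUnitri {n m : ℕ} {F : Type*} [Field F] (b : Fin n → Fin m)
    (M : Matrix (Fin n) (Fin n) F) : Prop :=
  ∀ i j : Fin n, b j ≤ b i → M i j = if i = j then 1 else 0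

/-- A representation `ρ` of `GL_n(F)` is cuspidal if for every composition of `n` with
at least two parts (encoded by a monotone surjection `b : Fin n → Fin m`, `m ≥ 2`),
the subspace of vectors fixed by the block unitriangular group `U(b)` is zero. -/
def IsCuspidal {n : ℕ} {F : Type*} [Field F] [Fintype F] {V : Type*}
    [AddCommGroup V] [Module ℂ V] (ρ : Representation ℂ (GL (Fin n) F) V) : Prop :=
  ∀ m : ℕ, 2 ≤ m → ∀ b : Fin n → Fin m, Monotone b → Function.Surjective b →
    ∀ v : V,
      (∀ u : GL (Fin n) F, IsBlockUnitri b (u : Matrix (Fin n) (Fin n) F) → ρ u v = v) →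
      v = 0

namespace GelfandGraev

open MonoidAlgebra

section GroupAlgebra

variable {G : Type*} [Group G]

/-- The complex group algebra. -/
abbrev GA (G : Type*) : Type _ := MonoidAlgebra ℂ G

/-- The basis element of the group algebra attached to a group element. -/
noncomputable def dl (g : G) : GA G := MonoidAlgebra.single g 1

lemma dl_mul (g h : G) : dl (g * h) = dl g * dl h := by
  simp [dl, MonoidAlgebra.single_mul_single]

lemma dl_one : dl (1 : G) = 1 := rfl

lemma dl_mul_inv_self (g : G) : dl g * dl g⁻¹ = 1 := by
  rw [← dl_mul, mul_inv_cancel, dl_one]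

lemma dl_inv_mul_self (g : G) : dl g⁻¹ * dl g = 1 := by
  rw [← dl_mul, inv_mul_cancel, dl_one]

lemma single_eq_smul_dl (g : G) (c : ℂ) : MonoidAlgebra.single g c = c • dl g := by
  simp [dl]

/-- Induction principle: additive predicates stable under scalars hold once they hold on
group elements. -/
lemma dl_induction {p : GA G → Prop} (h0 : p 0) (hd : ∀ g, p (dl g))
    (ha : ∀ x y, p x → p y → p (x + y)) (hs : ∀ (c : ℂ) x, p x → p (c • x)) (x : GA G) : p x := by
  induction x using MonoidAlgebra.induction_linear with
  | zero => exact h0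
  | add x y hx hy => exact ha x y hx hy
  | single g c => rw [single_eq_smul_dl]; exact hs c _ (hd g)

lemma lin_mem {M : Type*} [AddCommGroup M] [Module ℂ M] (f : GA G →ₗ[ℂ] M) (W : Submodule ℂ M)
    (h : ∀ g, f (dl g) ∈ W) (x : GA G) : f x ∈ W := by
  refine dl_induction (p := fun x => f x ∈ W) ?_ h ?_ ?_ x
  · simp
  · intro x y hx hy; rw [map_add]; exact W.add_mem hx hy
  · intro c x hx; rw [map_smul]; exact W.smul_mem c hx

lemma lin_ext {M : Type*} [AddCommGroup M] [Module ℂ M] {f f' : GA G →ₗ[ℂ] M}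
    (h : ∀ g, f (dl g) = f' (dl g)) (x : GA G) : f x = f' x := by
  have := lin_mem (f - f') ⊥ (fun g => by simp [h g]) x
  simpa [sub_eq_zero] using this

/-- Linear extension of a function on the group. -/
noncomputable def lin {M : Type*} [AddCommGroup M] [Module ℂ M] (f : G → M) : GA G →ₗ[ℂ] M :=
  (Finsupp.linearCombination ℂ f).comp (MonoidAlgebra.coeffLinearEquiv ℂ).toLinearMap

omit [Group G] in
@[simp] lemma lin_dl {M : Type*} [AddCommGroup M] [Module ℂ M] (f : G → M) (g : G) :
    lin f (dl g) = f g := by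
  simp [lin, dl]

/-- A sandwich identity `∀ g, p * g * r ∈ W` extends from group elements to the algebra. -/
lemma sandwich_mem (p r : GA G) (W : Submodule ℂ (GA G)) (h : ∀ g, p * dl g * r ∈ W) (x : GA G) :
    p * x * r ∈ W :=
  lin_mem ((LinearMap.mulRight ℂ r).comp (LinearMap.mulLeft ℂ p)) W (by simpa using h) x

lemma sandwich_eq_zero {p r : GA G} (h : ∀ g, p * dl g * r = 0) (x : GA G) :
    p * x * r = 0 := by
  have := sandwich_mem p r ⊥ (by simpa using h) x
  simpa using this

/-- The conjugate-linear anti-automorphism extending inversion. -/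
noncomputable def adj : GA G →+ GA G :=
  (lin (fun g => dl g⁻¹)).toAddMonoidHom.comp
    (MonoidAlgebra.mapRingHom G (starRingEnd ℂ)).toAddMonoidHom

lemma adj_smul (c : ℂ) (x : GA G) : adj (c • x) = (starRingEnd ℂ c) • adj x := by
  have : (MonoidAlgebra.mapRingHom G (starRingEnd ℂ)) (c • x) =
      (starRingEnd ℂ c) • (MonoidAlgebra.mapRingHom G (starRingEnd ℂ)) x := by
    induction x using MonoidAlgebra.induction_linear with
    | zero => simp
    | add x y hx hy => simp only [smul_add, map_add, hx, hy]
    | single g d => simp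
  simp [adj, this]

@[simp] lemma adj_dl (g : G) : adj (dl g) = dl g⁻¹ := by
  have : (MonoidAlgebra.mapRingHom G (starRingEnd ℂ)) (dl g) = dl g := by simp [dl]
  simp [adj, this]

lemma adj_mul (x y : GA G) : adj (x * y) = adj y * adj x := by
  refine dl_induction (p := fun x => adj (x * y) = adj y * adj x) ?_ ?_ ?_ ?_ x
  · simp
  · intro g
    refine dl_induction (p := fun y => adj (dl g * y) = adj y * adj (dl g)) ?_ ?_ ?_ ?_ y
    · simp
    · intro h; simp [← dl_mul]
    · intro a b ha hb; simp only [mul_add, map_add, ha, hb, add_mul]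
    · intro c a ha; simp only [mul_smul_comm, adj_smul, ha, smul_mul_assoc]
  · intro a b ha hb; simp only [add_mul, map_add, ha, hb, mul_add]
  · intro c a ha; simp only [smul_mul_assoc, adj_smul, ha, mul_smul_comm]

@[simp] lemma adj_adj (x : GA G) : adj (adj x) = x := by
  refine dl_induction (p := fun x => adj (adj x) = x) ?_ ?_ ?_ ?_ x
  · simp
  · simp
  · intro a b ha hb; simp only [map_add, ha, hb]
  · intro c a ha; simp only [adj_smul, ha, Complex.conj_conj]

lemma adj_ne_zero {x : GA G} (hx : x ≠ 0) : adj x ≠ 0 := by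
  intro h
  apply hx
  rw [← adj_adj x, h, map_zero]

lemma coeff_adj (x : GA G) (g : G) : (adj x).coeff g = starRingEnd ℂ (x.coeff g⁻¹) := by
  classical
  refine dl_induction (p := fun x => (adj x).coeff g = starRingEnd ℂ (x.coeff g⁻¹)) ?_ ?_ ?_ ?_ x
  · simp
  · intro h
    rw [adj_dl]
    simp only [dl, MonoidAlgebra.coeff_single, Finsupp.single_apply]
    by_cases hh : h⁻¹ = g
    · have : h = g⁻¹ := by rw [← hh, inv_inv]
      simp [this]
    · have : ¬ h = g⁻¹ := fun h' => hh (by rw [h', inv_inv])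
      simp [hh, this]
  · intro a b ha hb; simp [map_add, ha, hb]
  · intro c a ha; simp [adj_smul, ha]

lemma adj_mul_self_ne_zero {x : GA G} (hx : x ≠ 0) : adj x * x ≠ 0 := by
  classical
  intro h
  have h1 : (adj x * x).coeff 1 = ((∑ g ∈ x.coeff.support, ‖x.coeff g‖ ^ 2 : ℝ) : ℂ) := by
    have : ∀ y : GA G, (y * x).coeff 1 = ∑ g ∈ x.coeff.support, y.coeff g⁻¹ * x.coeff g := by
      intro y
      rw [MonoidAlgebra.coeff_mul_apply_right]
      simp [Finsupp.sum]
    rw [this]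
    push_cast
    refine Finset.sum_congr rfl fun g _ => ?_
    rw [coeff_adj, inv_inv, ← Complex.conj_mul']
  rw [h] at h1
  have h2 : (∑ g ∈ x.coeff.support, ‖x.coeff g‖ ^ 2 : ℝ) = 0 := by
    rw [← Complex.ofReal_inj, ← h1]; simp
  rw [Finset.sum_eq_zero_iff_of_nonneg (fun _ _ => by positivity)] at h2
  apply hx
  ext g
  by_cases hg : g ∈ x.coeff.support
  · simpa using h2 g hg
  · simpa using hg

lemma mul_adj_self_ne_zero {x : GA G} (hx : x ≠ 0) : x * adj x ≠ 0 := by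
  simpa using adj_mul_self_ne_zero (adj_ne_zero hx)

/-- The linear map extending a group anti-homomorphism is anti-multiplicative. -/
lemma lin_anti_mul {G' : Type*} [Group G'] (s : G → G') (hs : ∀ g h, s (g * h) = s h * s g)
    (x y : GA G) :
    lin (fun g => dl (s g)) (x * y) = lin (fun g => dl (s g)) y * lin (fun g => dl (s g)) x := by
  refine dl_induction (p := fun x => lin (fun g => dl (s g)) (x * y) =
    lin (fun g => dl (s g)) y * lin (fun g => dl (s g)) x) ?_ ?_ ?_ ?_ x
  · simp
  · intro g
    refine dl_induction (p := fun y => lin (fun g => dl (s g)) (dl g * y) =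
      lin (fun g => dl (s g)) y * lin (fun g => dl (s g)) (dl g)) ?_ ?_ ?_ ?_ y
    · simp
    · intro h; simp only [← dl_mul, lin_dl, hs]
    · intro a b ha hb; simp only [mul_add, map_add, ha, hb, add_mul]
    · intro c a ha; simp only [mul_smul_comm, map_smul, ha, smul_mul_assoc]
  · intro a b ha hb; simp only [add_mul, map_add, ha, hb, mul_add]
  · intro c a ha; simp only [smul_mul_assoc, map_smul, ha, mul_smul_comm]

/-- The algebra map extending a group homomorphism. -/
noncomputable abbrev gmap {G' : Type*} [Group G'] (f : G →* G') : GA G →ₐ[ℂ] GA G' :=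
  MonoidAlgebra.mapDomainAlgHom ℂ ℂ f

@[simp] lemma gmap_dl {G' : Type*} [Group G'] (f : G →* G') (g : G) :
    gmap f (dl g) = dl (f g) := by
  simp [gmap, dl]

lemma gmap_injective {G' : Type*} [Group G'] {f : G →* G'} (hf : Function.Injective f) :
    Function.Injective (gmap f) := by
  intro x y h
  exact MonoidAlgebra.mapDomain_injective hf h

lemma gmap_gmap {G' G'' : Type*} [Group G'] [Group G''] (f : G →* G') (f' : G' →* G'')
    (x : GA G) : gmap f' (gmap f x) = gmap (f'.comp f) x := by
  rw [gmap, gmap, gmap, MonoidAlgebra.mapDomainAlgHom_comp]; rfl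

lemma commute_gmap {G' G'' : Type*} [Group G'] [Group G''] {f : G →* G''} {f' : G' →* G''}
    (h : ∀ a b, f a * f' b = f' b * f a) (x : GA G) (y : GA G') :
    gmap f x * gmap f' y = gmap f' y * gmap f x := by
  refine dl_induction (p := fun x => gmap f x * gmap f' y = gmap f' y * gmap f x) ?_ ?_ ?_ ?_ x
  · simp
  · intro g
    refine dl_induction
      (p := fun y => gmap f (dl g) * gmap f' y = gmap f' y * gmap f (dl g)) ?_ ?_ ?_ ?_ y
    · simp
    · intro h'; simp only [gmap_dl, ← dl_mul, h]
    · intro a b ha hb; simp only [mul_add, map_add, ha, hb, add_mul]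
    · intro c a ha; simp only [mul_smul_comm, map_smul, ha, smul_mul_assoc]
  · intro a b ha hb; simp only [add_mul, map_add, ha, hb, mul_add]
  · intro c a ha; simp only [smul_mul_assoc, map_smul, ha, mul_smul_comm]

/-- An element commuting with the image of every group element commutes with the image of
the group algebra. -/
lemma commute_gmap_left {G' : Type*} [Group G'] {f : G →* G'} {y : GA G'}
    (h : ∀ a, dl (f a) * y = y * dl (f a)) (x : GA G) :
    gmap f x * y = y * gmap f x := by
  refine dl_induction (p := fun x => gmap f x * y = y * gmap f x) ?_ ?_ ?_ ?_ x
  · simp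
  · intro g; rw [gmap_dl, h]
  · intro a b ha hb; simp only [add_mul, map_add, ha, hb, mul_add]
  · intro c a ha; simp only [smul_mul_assoc, map_smul, ha, mul_smul_comm]

lemma adj_gmap {G' : Type*} [Group G'] (f : G →* G') (x : GA G) :
    adj (gmap f x) = gmap f (adj x) := by
  refine dl_induction (p := fun x => adj (gmap f x) = gmap f (adj x)) ?_ ?_ ?_ ?_ x
  · simp
  · intro g; simp only [gmap_dl, adj_dl, map_inv]
  · intro a b ha hb; simp only [map_add, ha, hb]
  · intro c a ha; simp only [map_smul, adj_smul, ha]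

/-- Restriction of the support to a subset. -/
noncomputable def pr (S : Set G) : GA G →ₗ[ℂ] GA G :=
  open Classical in lin (fun g => if g ∈ S then dl g else 0)

lemma pr_dl_of_mem {S : Set G} {g : G} (h : g ∈ S) : pr S (dl g) = dl g := by
  simp [pr, h]

lemma pr_dl_of_notMem {S : Set G} {g : G} (h : g ∉ S) : pr S (dl g) = 0 := by
  simp [pr, h]

lemma pr_dl_mul {S : Set G} {g : G} (h : ∀ x, g * x ∈ S ↔ x ∈ S) (x : GA G) :
    pr S (dl g * x) = dl g * pr S x := by
  refine lin_ext (f := (pr S).comp (LinearMap.mulLeft ℂ (dl g)))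
    (f' := (LinearMap.mulLeft ℂ (dl g)).comp (pr S)) (fun k => ?_) x
  simp only [LinearMap.comp_apply, LinearMap.mulLeft_apply, ← dl_mul]
  by_cases hk : k ∈ S
  · rw [pr_dl_of_mem hk, pr_dl_of_mem ((h k).2 hk), dl_mul]
  · rw [pr_dl_of_notMem hk, pr_dl_of_notMem (fun h' => hk ((h k).1 h')), mul_zero]

lemma pr_mul_dl {S : Set G} {g : G} (h : ∀ x, x * g ∈ S ↔ x ∈ S) (x : GA G) :
    pr S (x * dl g) = pr S x * dl g := by
  refine lin_ext (f := (pr S).comp (LinearMap.mulRight ℂ (dl g)))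
    (f' := (LinearMap.mulRight ℂ (dl g)).comp (pr S)) (fun k => ?_) x
  simp only [LinearMap.comp_apply, LinearMap.mulRight_apply, ← dl_mul]
  by_cases hk : k ∈ S
  · rw [pr_dl_of_mem hk, pr_dl_of_mem ((h k).2 hk), dl_mul]
  · rw [pr_dl_of_notMem hk, pr_dl_of_notMem (fun h' => hk ((h k).1 h')), zero_mul]

end GroupAlgebra

section Averages

variable {G : Type*} [Group G] [Finite G]

/-- The idempotent attached to a linear character of a subgroup. -/
noncomputable def avg (H : Subgroup G) (χ : H →* ℂ) : GA G :=
  (Nat.card H : ℂ)⁻¹ • ∑ᶠ h : H, χ h⁻¹ • dl (h : G)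

variable {H : Subgroup G} {χ : H →* ℂ}

lemma natCard_ne_zero_subgroup (H : Subgroup G) : (Nat.card H : ℂ) ≠ 0 := by
  exact_mod_cast Nat.card_pos.ne'

omit [Finite G] in
lemma char_mul_inv (χ : H →* ℂ) (h : H) : χ h * χ h⁻¹ = 1 := by
  rw [← map_mul, mul_inv_cancel, map_one]

lemma dl_mul_avg (h : H) : dl (h : G) * avg H χ = χ h • avg H χ := by
  have := Fintype.ofFinite H
  rw [avg, finsum_eq_sum_of_fintype, mul_smul_comm, smul_comm (χ h), Finset.mul_sum,
    Finset.smul_sum (r := χ h)]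
  refine congrArg ((Nat.card H : ℂ)⁻¹ • ·) ?_
  refine Fintype.sum_equiv (Equiv.mulLeft h) _ _ fun k => ?_
  simp only [Equiv.coe_mulLeft, mul_smul_comm, ← dl_mul, smul_smul, Subgroup.coe_mul,
    _root_.mul_inv_rev, map_mul]
  congr 1
  rw [mul_comm (χ k⁻¹), ← mul_assoc, char_mul_inv, one_mul]

lemma avg_mul_dl (h : H) : avg H χ * dl (h : G) = χ h • avg H χ := by
  have := Fintype.ofFinite H
  rw [avg, finsum_eq_sum_of_fintype, smul_mul_assoc, smul_comm (χ h), Finset.sum_mul,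
    Finset.smul_sum (r := χ h)]
  refine congrArg ((Nat.card H : ℂ)⁻¹ • ·) ?_
  refine Fintype.sum_equiv (Equiv.mulRight h) _ _ fun k => ?_
  simp only [Equiv.coe_mulRight, smul_mul_assoc, ← dl_mul, smul_smul, Subgroup.coe_mul,
    _root_.mul_inv_rev, map_mul]
  congr 1
  rw [← mul_assoc, char_mul_inv, one_mul]

/-- A linear map applied to an average. -/
lemma map_avg {M : Type*} [AddCommGroup M] [Module ℂ M] (f : GA G →ₗ[ℂ] M) {S : Set G} {v : M}
    (h1 : ∀ h : H, (h : G) ∈ S → f (dl (h : G)) = χ h • v)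
    (h2 : ∀ h : H, (h : G) ∉ S → f (dl (h : G)) = 0) :
    f (avg H χ) = ((Nat.card H : ℂ)⁻¹ * Nat.card {h : H // (h : G) ∈ S}) • v := by
  classical
  have := Fintype.ofFinite H
  rw [avg, finsum_eq_sum_of_fintype, map_smul, mul_smul, map_sum]
  congr 1
  rw [← Finset.sum_filter_add_sum_filter_not _ (fun h : H => (h : G) ∈ S),
    Finset.sum_congr rfl (g := fun _ => v), Finset.sum_eq_zero (s := Finset.filter (fun h : H => ¬ (h : G) ∈ S) _),
    add_zero,
    Finset.sum_const, ← Nat.cast_smul_eq_nsmul ℂ]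
  · congr 2
    rw [Nat.card_eq_fintype_card, Fintype.card_subtype]
  · intro h hh
    rw [map_smul, h2 h (by simpa using hh), smul_zero]
  · intro h hh
    rw [map_smul, h1 h (by simpa using hh), smul_smul, mul_comm, char_mul_inv, one_smul]

lemma map_avg_eq {M : Type*} [AddCommGroup M] [Module ℂ M] (f : GA G →ₗ[ℂ] M) {v : M}
    (h1 : ∀ h : H, f (dl (h : G)) = χ h • v) : f (avg H χ) = v := by
  rw [map_avg f (S := Set.univ) (fun h _ => h1 h) (fun h hh => absurd (Set.mem_univ _) hh)]
  have : Nat.card {h : H // (h : G) ∈ (Set.univ : Set G)} = Nat.card H :=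
    Nat.card_congr (Equiv.subtypeUnivEquiv (fun _ => Set.mem_univ _))
  rw [this, inv_mul_cancel₀ (natCard_ne_zero_subgroup H), one_smul]

lemma avg_mul_eq {x : GA G} (h : ∀ h : H, dl (h : G) * x = χ h • x) : avg H χ * x = x :=
  map_avg_eq (LinearMap.mulRight ℂ x) h

lemma mul_avg_eq {x : GA G} (h : ∀ h : H, x * dl (h : G) = χ h • x) : x * avg H χ = x :=
  map_avg_eq (LinearMap.mulLeft ℂ x) h

lemma avg_mul_avg : avg H χ * avg H χ = avg H χ := avg_mul_eq dl_mul_avg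

lemma conj_char (χ : H →* ℂ) (h : H) : starRingEnd ℂ (χ h) = χ h⁻¹ := by
  have h1 : ‖χ h‖ = 1 := by
    refine Complex.norm_eq_one_of_pow_eq_one (n := orderOf h) ?_ (orderOf_pos h).ne'
    rw [← map_pow, pow_orderOf_eq_one, map_one]
  have h2 := char_mul_inv χ h
  have h3 : χ h ≠ 0 := by
    intro h0; rw [h0] at h1; simp at h1
  have h4 : χ h * starRingEnd ℂ (χ h) = 1 := by
    rw [Complex.mul_conj', h1]; simp
  exact mul_left_cancel₀ h3 (h4.trans h2.symm)

lemma adj_avg : adj (avg H χ) = avg H χ := by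
  have := Fintype.ofFinite H
  rw [avg, finsum_eq_sum_of_fintype, adj_smul, map_sum]
  congr 1
  · simp
  · refine Fintype.sum_equiv (Equiv.inv H) _ _ fun k => ?_
    rw [adj_smul, adj_dl, conj_char]
    simp

lemma avg_ne_zero : avg H χ ≠ 0 := by
  intro h
  have h1 : pr {1} (avg H χ) = ((Nat.card H : ℂ)⁻¹ *
      Nat.card {h : H // (h : G) ∈ ({1} : Set G)}) • (1 : GA G) := by
    refine map_avg (pr {1}) ?_ ?_
    · intro h hh
      have : h = 1 := by ext; simpa using hh
      rw [pr_dl_of_mem hh, this]; simp [dl_one]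
    · intro h hh; exact pr_dl_of_notMem hh
  rw [h, map_zero] at h1
  have h2 := h1.symm
  rw [smul_eq_zero] at h2
  rcases h2 with h2 | h2
  · rw [mul_eq_zero, inv_eq_zero] at h2
    rcases h2 with h2 | h2
    · exact natCard_ne_zero_subgroup H h2
    · have : Nonempty {h : H // (h : G) ∈ ({1} : Set G)} := ⟨⟨1, by simp⟩⟩
      exact Nat.card_pos.ne' (Nat.cast_eq_zero.1 h2)
  · exact one_ne_zero h2

/-- Conjugation of an average by a group element permuting the equivariance conditions. -/
lemma dl_mul_avg_of_normalizes {H' : Subgroup G} {χ' : H' →* ℂ}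
    {g : G} (h1 : ∀ h : H, ∃ h' : H', (h' : G) = g * h * g⁻¹ ∧ χ' h' = χ h)
    (h2 : ∀ h' : H', ∃ h : H, (h' : G) = g * h * g⁻¹ ∧ χ' h' = χ h) :
    dl g * avg H χ = avg H' χ' * dl g := by
  have e1 : avg H' χ' * (dl g * avg H χ) = dl g * avg H χ := by
    refine avg_mul_eq fun h' => ?_
    obtain ⟨h, hh, hχ⟩ := h2 h'
    have : (h' : G) * g = g * h := by rw [hh]; group
    rw [← mul_assoc, ← dl_mul, this, dl_mul, mul_assoc, dl_mul_avg, hχ, mul_smul_comm]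
  have e2 : (avg H' χ' * dl g) * avg H χ = avg H' χ' * dl g := by
    refine mul_avg_eq fun h => ?_
    obtain ⟨h', hh, hχ⟩ := h1 h
    have : g * (h : G) = h' * g := by rw [hh]; group
    rw [mul_assoc, ← dl_mul, this, dl_mul, ← mul_assoc, avg_mul_dl, hχ, smul_mul_assoc]
  rw [← e1, ← mul_assoc, e2]

/-- If `y` is right equivariant under the part of `H` inside `S`, then restricting the average to
`S` only changes `y * avg` by a nonzero scalar. -/
lemma mul_pr_avg {S : Set G} (y : GA G) (h1 : (1 : G) ∈ S)
    (hy : ∀ h : H, (h : G) ∈ S → y * dl (h : G) = χ h • y) :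
    ∃ c : ℂ, c ≠ 0 ∧ y * pr S (avg H χ) = c • y := by
  refine ⟨_, ?_, map_avg (S := S) ((LinearMap.mulLeft ℂ y).comp (pr S)) ?_ ?_⟩
  · have : Nonempty {h : H // (h : G) ∈ S} := ⟨⟨1, by simpa using h1⟩⟩
    exact mul_ne_zero (inv_ne_zero (natCard_ne_zero_subgroup H))
      (Nat.cast_ne_zero.2 Nat.card_pos.ne')
  · intro h hh
    simp only [LinearMap.comp_apply, LinearMap.mulLeft_apply]
    rw [pr_dl_of_mem hh, hy h hh]
  · intro h hh
    simp only [LinearMap.comp_apply, LinearMap.mulLeft_apply]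
    rw [pr_dl_of_notMem hh, mul_zero]

lemma pr_avg_mul {S : Set G} (y : GA G) (h1 : (1 : G) ∈ S)
    (hy : ∀ h : H, (h : G) ∈ S → dl (h : G) * y = χ h • y) :
    ∃ c : ℂ, c ≠ 0 ∧ pr S (avg H χ) * y = c • y := by
  refine ⟨_, ?_, map_avg (S := S) ((LinearMap.mulRight ℂ y).comp (pr S)) ?_ ?_⟩
  · have : Nonempty {h : H // (h : G) ∈ S} := ⟨⟨1, by simpa using h1⟩⟩
    exact mul_ne_zero (inv_ne_zero (natCard_ne_zero_subgroup H))
      (Nat.cast_ne_zero.2 Nat.card_pos.ne')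
  · intro h hh
    simp only [LinearMap.comp_apply, LinearMap.mulRight_apply]
    rw [pr_dl_of_mem hh, hy h hh]
  · intro h hh
    simp only [LinearMap.comp_apply, LinearMap.mulRight_apply]
    rw [pr_dl_of_notMem hh, zero_mul]

lemma pr_avg_mul_comm {S : Set G} (h : ∀ h : H, ∀ x, (h : G) * x ∈ S ↔ x ∈ S) (x : GA G) :
    pr S (avg H χ * x) = avg H χ * pr S x := by
  have := Fintype.ofFinite H
  simp only [avg, finsum_eq_sum_of_fintype, smul_mul_assoc, Finset.sum_mul, map_smul, map_sum,
    pr_dl_mul (h _)]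

lemma pr_mul_avg_comm {S : Set G} (h : ∀ h : H, ∀ x, x * (h : G) ∈ S ↔ x ∈ S) (x : GA G) :
    pr S (x * avg H χ) = pr S x * avg H χ := by
  have := Fintype.ofFinite H
  simp only [avg, finsum_eq_sum_of_fintype, mul_smul_comm, Finset.mul_sum, map_smul, map_sum,
    pr_mul_dl (h _)]

end Averages

end GelfandGraev

namespace GelfandGraev

open MonoidAlgebra

section Corner

variable {G : Type*} [Group G]

/-- `z` is a minimal idempotent of the corner `e ℂ[G] e`. -/
def IsMin (e z : GA G) : Prop :=
  z ≠ 0 ∧ z * z = z ∧ e * z = z ∧ z * e = z ∧ ∀ x, ∃ c : ℂ, z * x * e = c • z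

/-- A self-adjoint idempotent with commutative corner. -/
structure IsGelfand (e : GA G) : Prop where
  idem : e * e = e
  adj_eq : adj e = e
  comm : ∀ x y, (e * x * e) * (e * y * e) = (e * y * e) * (e * x * e)

lemma eq_one_of_idem {A : Type*} [Ring A] [Algebra ℂ A] {z z' : A} (hz : z * z = z)
    (hz' : z' * z' = z') {c : ℂ} (hn : z ≠ 0) (h : z = c • z') : z = z' := by
  have h0 : z' ≠ 0 := by rintro rfl; exact hn (by simpa using h)
  have hc : c ≠ 0 := by rintro rfl; exact hn (by simpa using h)
  have h1 : (c * c) • z' = c • z' := by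
    rw [h, smul_mul_smul_comm, hz'] at hz; exact hz
  have h2 : c * c = c := smul_left_injective ℂ h0 h1
  have h3 : c = 1 := by
    have := mul_left_cancel₀ hc (h2.trans (mul_one c).symm); exact this
  rw [h, h3, one_smul]

variable {e : GA G}

namespace IsMin

variable {z z' : GA G}

lemma corner (hz : IsMin e z) : e * z * e = z := by rw [hz.2.2.1, hz.2.2.2.1]

lemma comm (he : IsGelfand e) (hz : IsMin e z) (x : GA G) :
    z * (e * x * e) = (e * x * e) * z := by
  have := he.comm z x
  rwa [hz.corner] at this

lemma left (he : IsGelfand e) (hz : IsMin e z) (x : GA G) : ∃ c : ℂ, e * x * z = c • z := by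
  obtain ⟨c, hc⟩ := hz.2.2.2.2 x
  refine ⟨c, ?_⟩
  have h := hz.comm he x
  have h1 : z * (e * x * e) = z * x * e := by
    rw [← mul_assoc, ← mul_assoc, hz.2.2.2.1]
  have h2 : (e * x * e) * z = e * x * z := by rw [mul_assoc, hz.2.2.1]
  rw [← h2, ← h, h1, hc]

lemma mul_mul_self (hz : IsMin e z) (x : GA G) : ∃ c : ℂ, z * x * z = c • z := by
  obtain ⟨c, hc⟩ := hz.2.2.2.2 (x * z)
  refine ⟨c, ?_⟩
  rw [← hc]
  simp only [mul_assoc, hz.2.2.2.1]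

lemma eq_of_mul_ne_zero (he : IsGelfand e) (hz : IsMin e z) (hz' : IsMin e z')
    (h : z * z' ≠ 0) : z = z' := by
  have hcomm : z * z' = z' * z := by
    have := hz.comm he z'
    rwa [hz'.corner] at this
  obtain ⟨c, hc⟩ := hz.2.2.2.2 z'
  obtain ⟨c', hc'⟩ := hz'.2.2.2.2 z
  rw [mul_assoc, hz'.2.2.2.1] at hc
  rw [mul_assoc, hz.2.2.2.1, ← hcomm] at hc'
  have hcz : c • z = c' • z' := hc.symm.trans hc'
  have hc0 : c ≠ 0 := by rintro rfl; exact h (by simpa using hc)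
  refine eq_one_of_idem (c := c⁻¹ * c') hz.2.1 hz'.2.1 hz.1 ?_
  rw [mul_smul, ← hcz, smul_smul, inv_mul_cancel₀ hc0, one_smul]

lemma eq_of_mul_mul_ne_zero (he : IsGelfand e) (hz : IsMin e z) (hz' : IsMin e z') {x : GA G}
    (h : z * x * z' ≠ 0) : z = z' := by
  obtain ⟨c, hc⟩ := hz.2.2.2.2 x
  apply hz.eq_of_mul_ne_zero he hz'
  intro h0
  apply h
  rw [← hz'.2.2.1, ← mul_assoc, hc, smul_mul_assoc, h0, smul_zero]

lemma adj_eq (he : IsGelfand e) (hz : IsMin e z) : adj z = z := by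
  obtain ⟨c, hc⟩ := hz.2.2.2.2 (adj z)
  have h1 : z * adj z = c • z := by
    rw [← hc, mul_assoc]
    congr 1
    conv_rhs => rw [← he.adj_eq]
    rw [← adj_mul, hz.2.2.1]
  have h0 : c ≠ 0 := by
    rintro rfl
    exact mul_adj_self_ne_zero hz.1 (by simpa using h1)
  have h2 : c • z = starRingEnd ℂ c • adj z := by
    rw [← adj_smul, ← h1, adj_mul, adj_adj]
  refine (eq_one_of_idem (c := c⁻¹ * starRingEnd ℂ c) hz.2.1 ?_ hz.1 ?_).symm
  · rw [← adj_mul, hz.2.1]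
  · rw [mul_smul, ← h2, smul_smul, inv_mul_cancel₀ h0, one_smul]

lemma mul_ne_zero' (he : IsGelfand e) (hz : IsMin e z) {P Q : GA G} (hP : P * z ≠ 0)
    (hQ : z * Q ≠ 0) : P * z * Q ≠ 0 := by
  intro h
  obtain ⟨c, hc⟩ := hz.mul_mul_self (Q * adj Q)
  have hadj := hz.adj_eq he
  have h1 : z * (Q * adj Q) * z = (z * Q) * adj (z * Q) := by
    rw [adj_mul, hadj]; simp only [mul_assoc]
  have h0 : c ≠ 0 := by
    rintro rfl
    apply mul_adj_self_ne_zero hQ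
    rw [← h1, hc, zero_smul]
  apply hP
  have h2 : P * (z * (Q * adj Q) * z) = 0 := by
    have : P * (z * (Q * adj Q) * z) = (P * z * Q) * (adj Q * z) := by simp only [mul_assoc]
    rw [this, h, zero_mul]
  rw [hc, mul_smul_comm] at h2
  exact (smul_eq_zero.1 h2).resolve_left h0

end IsMin

variable [Finite G]

instance : Module.Finite ℂ (GA G) :=
  Module.Finite.equiv (MonoidAlgebra.coeffLinearEquiv ℂ).symm

/-- The corner as a submodule. -/
noncomputable def cornerSubmodule (e : GA G) : Submodule ℂ (GA G) :=
  LinearMap.range ((LinearMap.mulRight ℂ e).comp (LinearMap.mulLeft ℂ e))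

omit [Finite G] in
lemma mem_cornerSubmodule {x : GA G} : x ∈ cornerSubmodule e ↔ ∃ y, e * y * e = x := by
  simp [cornerSubmodule]

/-- A finite-dimensional reduced commutative complex algebra is spanned by orthogonal minimal
idempotents. -/
lemma exists_minimal_idempotents {S : Type*} [CommRing S] [Algebra ℂ S] [Module.Finite ℂ S]
    [IsReduced S] : ∃ (k : ℕ) (v : Fin k → S), (∀ i, v i ≠ 0) ∧ (∀ i, v i * v i = v i) ∧
      (∑ i, v i = 1) ∧ ∀ i s, ∃ c : ℂ, v i * s = c • v i := by
  classical
  have : IsArtinianRing S := isArtinian_of_tower ℂ inferInstance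
  have hf : Finite (MaximalSpectrum S) := inferInstance
  have := Fintype.ofFinite (MaximalSpectrum S)
  let φ := IsArtinianRing.equivPi S
  let v (i : MaximalSpectrum S) : S := φ.symm (Pi.single i 1)
  have key : ∃ v : MaximalSpectrum S → S, (∀ i, v i ≠ 0) ∧ (∀ i, v i * v i = v i) ∧
      (∑ i, v i = 1) ∧ ∀ i s, ∃ c : ℂ, v i * s = c • v i := by
    refine ⟨v, ?_, ?_, ?_, ?_⟩
    · intro i h
      have h1 : (Pi.single i 1 : ∀ I : MaximalSpectrum S, S ⧸ I.asIdeal) = 0 :=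
        φ.symm.injective (by rw [map_zero]; exact h)
      have h2 := congrFun h1 i
      rw [Pi.single_eq_same] at h2
      exact i.isMaximal.ne_top ((Ideal.eq_top_iff_one _).2 (Ideal.Quotient.eq_zero_iff_mem.1 h2))
    · intro i
      simp only [v, ← map_mul, ← Pi.single_mul, one_mul]
    · simp only [v, ← map_sum]
      have h1 := Finset.univ_sum_single (1 : ∀ I : MaximalSpectrum S, S ⧸ I.asIdeal)
      simp only [Pi.one_apply] at h1
      rw [h1, map_one]
    · intro i s
      let _ : Field (S ⧸ i.asIdeal) := Ideal.Quotient.field i.asIdeal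
      obtain ⟨c, hc⟩ := (IsAlgClosed.algebraMap_bijective_of_isIntegral
        (k := ℂ) (K := S ⧸ i.asIdeal)).2 (Ideal.Quotient.mk i.asIdeal s)
      refine ⟨c, φ.injective ?_⟩
      funext I
      rw [map_mul, Algebra.smul_def, map_mul]
      simp only [Pi.mul_apply, v, AlgEquiv.apply_symm_apply]
      by_cases hI : I = i
      · subst hI
        rw [Pi.single_eq_same, one_mul, mul_one]
        exact hc.symm
      · rw [Pi.single_eq_of_ne hI, zero_mul, mul_zero]
  obtain ⟨v, h1, h2, h3, h4⟩ := key
  let E := Fintype.equivFin (MaximalSpectrum S)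
  refine ⟨_, v ∘ E.symm, fun i => h1 _, fun i => h2 _, ?_, fun i s => h4 _ s⟩
  rw [← h3]
  exact Equiv.sum_comp E.symm v

/-- Decomposition of the identity of a commutative corner. -/
lemma exists_corner_decomposition (he : IsGelfand e) :
    ∃ s : Finset (GA G), (∀ z, z ∈ s ↔ IsMin e z) ∧ ∑ z ∈ s, z = e := by
  classical
  let R : Set (GA G) := Set.range fun x => e * x * e
  have hR : ∀ a ∈ R, ∀ b ∈ R, a * b = b * a := by
    rintro _ ⟨x, rfl⟩ _ ⟨y, rfl⟩
    exact he.comm x y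
  let _ : CommRing (Algebra.adjoin ℂ R) :=
    { mul_comm := fun a b => (Algebra.isMulCommutative_adjoin ℂ hR).is_comm.comm a b }
  have memS : ∀ x, e * x * e ∈ Algebra.adjoin ℂ R := fun x =>
    Algebra.subset_adjoin ⟨x, rfl⟩
  have adjS : ∀ x ∈ Algebra.adjoin ℂ R, adj x ∈ Algebra.adjoin ℂ R := by
    intro x hx
    induction hx using Algebra.adjoin_induction with
    | mem x hx =>
      obtain ⟨y, rfl⟩ := hx
      have : adj (e * y * e) = e * adj y * e := by
        simp only [adj_mul, he.adj_eq, mul_assoc]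
      simp only [this, memS]
    | algebraMap r =>
      rw [Algebra.algebraMap_eq_smul_one, adj_smul, ← dl_one, adj_dl, inv_one, dl_one]
      exact Subalgebra.smul_mem _ (one_mem _) _
    | add x y _ _ hx hy => rw [map_add]; exact add_mem hx hy
    | mul x y _ _ hx hy => rw [adj_mul]; exact mul_mem hy hx
  have hred : IsReduced (Algebra.adjoin ℂ R) := by
    rw [isReduced_iff_pow_one_lt 2 one_lt_two]
    intro x hx
    by_contra hne
    have hx0 : (x : GA G) ≠ 0 := by simpa using hne
    let t : Algebra.adjoin ℂ R := ⟨adj x, adjS _ x.2⟩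
    have h1 : adj (adj (x : GA G) * (x : GA G)) * (adj (x : GA G) * (x : GA G)) = 0 := by
      have : (t * x) * (t * x) = 0 := by
        have : (t * x) * (t * x) = t * t * x ^ 2 := by ring
        rw [this, hx, mul_zero]
      have h2 := congrArg Subtype.val this
      rw [adj_mul, adj_adj]
      exact h2
    exact adj_mul_self_ne_zero (adj_mul_self_ne_zero hx0) h1
  obtain ⟨k, v, h1, h2, h3, h4⟩ := exists_minimal_idempotents (S := Algebra.adjoin ℂ R)
  have heS : e ∈ Algebra.adjoin ℂ R := by
    have := memS e
    rwa [he.idem, he.idem] at this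
  have hve : ∀ i, ∃ c : ℂ, (v i : GA G) * e = c • (v i : GA G) := fun i => by
    obtain ⟨c, hc⟩ := h4 i ⟨e, heS⟩
    exact ⟨c, congrArg Subtype.val hc⟩
  have hcommS : ∀ a b : Algebra.adjoin ℂ R, (a : GA G) * b = b * a := fun a b =>
    congrArg Subtype.val (mul_comm a b)
  have hsum : ∑ i, (v i : GA G) * e = e := by
    rw [← Finset.sum_mul]
    have := congrArg Subtype.val h3
    simp only [AddSubmonoidClass.coe_finsetSum, OneMemClass.coe_one] at this
    rw [this, one_mul]
  have hvmin : ∀ i, (v i : GA G) * e ≠ 0 → IsMin e (v i) ∧ (v i : GA G) * e = v i := by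
    intro i hi
    have hne : (v i : GA G) ≠ 0 := by simpa using h1 i
    have hid : (v i : GA G) * v i = v i := congrArg Subtype.val (h2 i)
    have hvei : (v i : GA G) * e = v i := by
      obtain ⟨c, hc⟩ := hve i
      refine eq_one_of_idem (c := c) ?_ hid hi hc
      have h5 : e * (v i : GA G) = v i * e := hcommS ⟨e, heS⟩ (v i)
      calc (v i : GA G) * e * (v i * e) = v i * (e * v i) * e := by simp only [mul_assoc]
        _ = (v i * v i) * (e * e) := by rw [h5]; simp only [mul_assoc]
        _ = v i * e := by rw [hid, he.idem]
    refine ⟨⟨hne, hid, ?_, hvei, fun x => ?_⟩, hvei⟩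
    · rw [show e * (v i : GA G) = v i * e from hcommS ⟨e, heS⟩ (v i), hvei]
    · obtain ⟨c, hc⟩ := h4 i ⟨e * x * e, memS x⟩
      refine ⟨c, ?_⟩
      have h6 : (v i : GA G) * (e * x * e) = c • (v i : GA G) := congrArg Subtype.val hc
      rw [← h6, ← mul_assoc, ← mul_assoc, hvei]
  have hzsum : ∀ z, IsMin e z → ∃ i, (v i : GA G) = z ∧ (v i : GA G) * e ≠ 0 := by
    intro z hz
    have h7 : ∑ i, (v i : GA G) * e * z = z := by
      rw [← Finset.sum_mul, hsum, hz.2.2.1]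
    obtain ⟨i, -, hi⟩ := Finset.exists_ne_zero_of_sum_ne_zero (h7.trans_ne hz.1)
    have hi0 : (v i : GA G) * e ≠ 0 := fun h0 => hi (by rw [h0, zero_mul])
    obtain ⟨hm, hv⟩ := hvmin i hi0
    rw [hv] at hi
    exact ⟨i, hm.eq_of_mul_ne_zero he hz hi, hi0⟩
  refine ⟨(Finset.univ.filter fun i => (v i : GA G) * e ≠ 0).image fun i => (v i : GA G), ?_, ?_⟩
  · intro z
    simp only [Finset.mem_image, Finset.mem_filter, Finset.mem_univ, true_and]
    constructor
    · rintro ⟨i, hi, rfl⟩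
      exact (hvmin i hi).1
    · intro hz
      obtain ⟨i, hi, hi0⟩ := hzsum z hz
      exact ⟨i, hi0, hi⟩
  · rw [Finset.sum_image]
    · conv_rhs => rw [← hsum]
      rw [Finset.sum_filter]
      refine Finset.sum_congr rfl fun i _ => ?_
      split_ifs with hi
      · exact (hvmin i hi).2.symm
      · exact (not_not.1 hi).symm
    · intro i hi j hj hij
      simp only [Finset.coe_filter, Finset.mem_univ, true_and, Set.mem_ofPred_eq] at hi hj
      have hvij : v i = v j := Subtype.ext hij
      by_contra hne
      have h8 : ∀ a, v i * v a = 0 ∨ v a = v i := by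
        intro a
        obtain ⟨c, hc⟩ := h4 i (v a)
        obtain ⟨c', hc'⟩ := h4 a (v i)
        by_cases h0 : v i * v a = 0
        · exact Or.inl h0
        · refine Or.inr ?_
          have hc0 : c' ≠ 0 := by
            rintro rfl; rw [mul_comm] at h0; exact h0 (by simpa using hc')
          refine eq_one_of_idem (c := c'⁻¹ * c) (h2 a) (h2 i) (h1 a) ?_
          rw [mul_smul, ← hc, mul_comm, hc', smul_smul, inv_mul_cancel₀ hc0, one_smul]
      have h9 : v i = ∑ a, v i * v a := by rw [← Finset.mul_sum, h3, mul_one]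
      have h10 : ∑ a, v i * v a = ((Finset.univ.filter fun a => v a = v i).card : ℂ) • v i := by
        rw [Finset.sum_congr rfl (g := fun a => if v a = v i then v i else 0), ← Finset.sum_filter,
          Finset.sum_const, ← Nat.cast_smul_eq_nsmul ℂ]
        intro a _
        split_ifs with h
        · rw [h, h2]
        · exact (h8 a).resolve_right h
      rw [h10] at h9
      have h11 : ((Finset.univ.filter fun a => v a = v i).card : ℂ) = 1 :=
        smul_left_injective ℂ (h1 i) (by simpa using h9.symm)
      have h12 : (Finset.univ.filter fun a => v a = v i).card = 1 := by exact_mod_cast h11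
      have h13 : 1 < (Finset.univ.filter fun a => v a = v i).card :=
        Finset.one_lt_card.2 ⟨i, by simp, j, by simp [hvij], hne⟩
      omega

/-- The minimal idempotents form a basis of the corner. -/
lemma card_isMin (he : IsGelfand e) :
    Nat.card {z // IsMin e z} = Module.finrank ℂ (cornerSubmodule e) := by
  classical
  obtain ⟨s, hs, hsum⟩ := exists_corner_decomposition he
  have hcard : Nat.card {z // IsMin e z} = Fintype.card s := by
    rw [← Nat.card_eq_fintype_card]
    exact Nat.card_congr (Equiv.subtypeEquivRight fun z => (hs z).symm)
  rw [hcard]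
  have hli : LinearIndependent ℂ (fun z : s => (z : GA G)) := by
    rw [Fintype.linearIndependent_iff]
    intro g hg i
    have hi := (hs i).1 i.2
    have h1 := congrArg (fun x => (i : GA G) * x) hg
    simp only [Finset.mul_sum, mul_smul_comm, mul_zero] at h1
    rw [Finset.sum_eq_single i] at h1
    · rw [hi.2.1] at h1
      exact (smul_eq_zero.1 h1).resolve_right hi.1
    · intro j _ hj
      by_cases h0 : (i : GA G) * j = 0
      · rw [h0, smul_zero]
      · exact absurd (Subtype.ext (hi.eq_of_mul_ne_zero he ((hs j).1 j.2) h0)).symm hj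
    · simp
  have hspan : Submodule.span ℂ (Set.range fun z : s => (z : GA G)) = cornerSubmodule e := by
    apply le_antisymm
    · rw [Submodule.span_le]
      rintro _ ⟨z, rfl⟩
      exact mem_cornerSubmodule.2 ⟨z, ((hs z).1 z.2).corner⟩
    · intro x hx
      obtain ⟨y, rfl⟩ := mem_cornerSubmodule.1 hx
      have : e * y * e = ∑ z ∈ s, z * y * e := by
        rw [← Finset.sum_mul, ← Finset.sum_mul, hsum]
      rw [this]
      refine Submodule.sum_mem _ fun z hz => ?_
      obtain ⟨c, hc⟩ := ((hs z).1 hz).2.2.2.2 y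
      rw [hc]
      exact Submodule.smul_mem _ _ (Submodule.subset_span ⟨⟨z, hz⟩, rfl⟩)
  rw [← hspan, finrank_span_eq_card hli]

lemma exists_mul_ne_zero (he : IsGelfand e) {x : GA G} (hx : x * e ≠ 0) :
    ∃ z, IsMin e z ∧ x * z ≠ 0 := by
  obtain ⟨s, hs, hsum⟩ := exists_corner_decomposition he
  rw [← hsum, Finset.mul_sum] at hx
  obtain ⟨z, hz, h⟩ := Finset.exists_ne_zero_of_sum_ne_zero hx
  exact ⟨z, (hs z).1 hz, h⟩

end Corner

end GelfandGraev

namespace GelfandGraev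

section Runs

open Equiv

variable {n : ℕ} {T : Type*}

/-- Labelled permutations whose ascents at consecutive positions are by exactly one and preserve
the label. -/
def Good (w : Perm (Fin n)) (t : Fin n → T) : Prop :=
  ∀ i j : Fin n, (j : ℕ) = i + 1 → w i < w j → (w j : ℕ) = w i + 1 ∧ t i = t j

variable {w w' : Perm (Fin n)} {t t' : Fin n → T}

namespace Good

lemma ascent_of_lt (h : Good w t) {i j : Fin n} (hij : i < j) (hw : w i < w j) {k : Fin n}
    (hk : (k : ℕ) = i + 1) : w i < w k := by
  classical
  have hex : ∃ m : ℕ, ∃ hm : m < n, (i : ℕ) < m ∧ w i < w ⟨m, hm⟩ := ⟨j, j.2, hij, hw⟩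
  obtain ⟨m, ⟨hm, him, hwm⟩, hmin⟩ : ∃ m : ℕ, (∃ hm : m < n, (i : ℕ) < m ∧ w i < w ⟨m, hm⟩) ∧
      ∀ m' < m, ¬ ∃ hm : m' < n, (i : ℕ) < m' ∧ w i < w ⟨m', hm⟩ :=
    ⟨Nat.find hex, Nat.find_spec hex, fun m' => Nat.find_min hex⟩
  by_cases hmi : m = i + 1
  · have : k = ⟨m, hm⟩ := by ext; simp [hk, hmi]
    rw [this]; exact hwm
  · exfalso
    have hlt : m - 1 < m := by omega
    have hnot := hmin _ hlt
    push Not at hnot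
    have h1 : w ⟨m - 1, by omega⟩ ≤ w i := hnot (by omega) (by omega)
    have h2 := (h ⟨m - 1, by omega⟩ ⟨m, hm⟩ (by simp; omega) (lt_of_le_of_lt h1 hwm)).1
    have h3 : w ⟨m - 1, by omega⟩ = w i := by
      ext
      have := Fin.le_def.1 h1
      have := Fin.lt_def.1 hwm
      omega
    have h4 := congrArg Fin.val (w.injective h3)
    simp at h4
    omega

lemma ascent_of_lt_of_between (h : Good w t) {i j : Fin n} (hij : i < j) (hw : w i < w j) :
    ∀ k l : Fin n, i ≤ k → (l : ℕ) = k + 1 → l ≤ j → w k < w l := by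
  have key : ∀ d : ℕ, ∀ i : Fin n, (j : ℕ) = i + d → i < j → w i < w j →
      ∀ k l : Fin n, i ≤ k → (l : ℕ) = k + 1 → l ≤ j → w k < w l := by
    intro d
    induction d with
    | zero => intro i hd hij; exact absurd hij (by rw [Fin.lt_def]; omega)
    | succ d ih =>
      intro i hd hij hw k l hik hl hlj
      rcases eq_or_lt_of_le hik with rfl | hik
      · exact h.ascent_of_lt hij hw hl
      · have hi' : (i : ℕ) + 1 < n := by rw [Fin.lt_def] at hik; omega
        have h1 := h.ascent_of_lt hij hw (k := ⟨i + 1, hi'⟩) rfl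
        have h2 := (h i ⟨i + 1, hi'⟩ rfl h1).1
        have hne : (⟨i + 1, hi'⟩ : Fin n) < j := by
          rw [Fin.lt_def] at *; rw [Fin.le_def] at *; simp; omega
        refine ih ⟨i + 1, hi'⟩ (by simp; omega) hne ?_ k l ?_ hl hlj
        · have hne' : w ⟨i + 1, hi'⟩ ≠ w j := fun h' => hne.ne (w.injective h')
          have hne2 : (w ⟨i + 1, hi'⟩ : ℕ) ≠ w j := fun h' => hne' (Fin.ext h')
          rw [Fin.lt_def] at *; omega
        · rw [Fin.le_def]; rw [Fin.lt_def] at hik; simp; omega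
  exact fun k l => key (j - i) i (by rw [Fin.lt_def] at hij; omega) hij hw k l

lemma label_eq_of_lt (h : Good w t) {i j : Fin n} (hij : i < j) (hw : w i < w j) : t i = t j := by
  have hb := h.ascent_of_lt_of_between hij hw
  have key : ∀ m : ℕ, ∀ hm : m < n, (i : ℕ) ≤ m → m ≤ j → t i = t ⟨m, hm⟩ := by
    intro m hm him
    induction m, him using Nat.le_induction with
    | base => intro _; rfl
    | succ m him ih =>
      intro hmj
      rw [ih (by omega) (by omega)]
      exact (h ⟨m, by omega⟩ ⟨m + 1, hm⟩ rfl (hb _ _ him rfl hmj)).2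
  exact key j j.2 (le_of_lt hij) le_rfl

lemma lt_iff (h : Good w t) {i j : Fin n} (hij : i < j) :
    w i < w j ↔ ∀ k l : Fin n, i ≤ k → (l : ℕ) = k + 1 → l ≤ j → w k < w l := by
  refine ⟨h.ascent_of_lt_of_between hij, fun hb => ?_⟩
  have key : ∀ m : ℕ, ∀ hm : m < n, (i : ℕ) ≤ m → m ≤ j → w i ≤ w ⟨m, hm⟩ := by
    intro m hm him
    induction m, him using Nat.le_induction with
    | base => intro _; rfl
    | succ m him ih =>
      intro hmj
      exact (ih (by omega) (by omega)).trans (hb ⟨m, by omega⟩ ⟨m + 1, hm⟩ him rfl hmj).le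
  exact lt_of_le_of_ne (key j j.2 (le_of_lt hij) le_rfl) (fun h' => hij.ne (w.injective h'))

lemma succ_of_val_succ (h : Good w t) {i j : Fin n} (hij : i < j) (hw : (w j : ℕ) = w i + 1) :
    (j : ℕ) = i + 1 := by
  have hlt : w i < w j := by rw [Fin.lt_def]; omega
  have hi' : (i : ℕ) + 1 < n := by rw [Fin.lt_def] at hij; omega
  have h2 := (h i ⟨i + 1, hi'⟩ rfl (h.ascent_of_lt hij hlt rfl)).1
  have h3 : j = ⟨i + 1, hi'⟩ := w.injective (Fin.ext (by omega))
  rw [h3]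

end Good

/-- Permutations are determined by their order relation. -/
lemma perm_eq_of_lt_iff (h : ∀ i j : Fin n, w i < w j ↔ w' i < w' j) : w = w' := by
  have h1 : StrictMono (w' ∘ w.symm) := by
    intro a b hab
    have := (h (w.symm a) (w.symm b)).1 (by simpa using hab)
    simpa using this
  have h2 : ∀ a, (w' ∘ w.symm) a = a := by
    intro a
    have := congrFun (Subsingleton.elim (α := Fin n ≃o Fin n)
      (StrictMono.orderIsoOfSurjective _ h1 (by
        exact w'.surjective.comp w.symm.surjective)) (OrderIso.refl _) ▸ rfl :
        ((StrictMono.orderIsoOfSurjective _ h1 (w'.surjective.comp w.symm.surjective) :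
          Fin n ≃o Fin n) : Fin n → Fin n) = (OrderIso.refl (Fin n) : Fin n → Fin n)) a
    exact this
  ext i
  have := h2 (w i)
  simp at this
  rw [this]

lemma Good.perm_eq (h : Good w t) (h' : Good w' t')
    (hasc : ∀ i j : Fin n, (j : ℕ) = i + 1 → (w i < w j ↔ w' i < w' j)) : w = w' := by
  have key : ∀ i j : Fin n, i < j → (w i < w j ↔ w' i < w' j) := by
    intro i j hij
    rw [h.lt_iff hij, h'.lt_iff hij]
    exact forall_congr' fun k => forall_congr' fun l =>
      ⟨fun H a b c => (hasc k l b).1 (H a b c), fun H a b c => (hasc k l b).2 (H a b c)⟩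
  refine perm_eq_of_lt_iff fun i j => ?_
  rcases lt_trichotomy i j with hij | rfl | hij
  · exact key i j hij
  · simp
  · have := key j i hij
    have e1 : w i ≠ w j := fun h => hij.ne (w.injective h).symm
    have e2 : w' i ≠ w' j := fun h => hij.ne (w'.injective h).symm
    constructor
    · intro h3
      by_contra h4
      exact lt_asymm h3 (this.2 (lt_of_le_of_ne (not_lt.1 h4) e2.symm))
    · intro h3
      by_contra h4
      exact lt_asymm h3 (this.1 (lt_of_le_of_ne (not_lt.1 h4) e1.symm))

lemma exists_perm_of_key (K : Fin n → ℕ) (hK : Function.Injective K) :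
    ∃ w : Perm (Fin n), ∀ i j, w i < w j ↔ K i < K j := by
  classical
  let S := Finset.univ.image K
  have hS : S.card = n := by simp [S, Finset.card_image_of_injective _ hK]
  let o := S.orderIsoOfFin hS
  have hmem : ∀ i, K i ∈ S := fun i => Finset.mem_image_of_mem _ (Finset.mem_univ i)
  let f : Fin n → Fin n := fun i => o.symm ⟨K i, hmem i⟩
  have hf : Function.Injective f := by
    intro i j hij
    have := o.symm.injective hij
    exact hK (congrArg Subtype.val this)
  refine ⟨Equiv.ofBijective f (Finite.injective_iff_bijective.1 hf), fun i j => ?_⟩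
  simp [f]

/-- Every prescribed set of ascents is realised. -/
lemma exists_good (a : Fin n → Prop) (t : Fin n → T)
    (ht : ∀ i j : Fin n, (j : ℕ) = i + 1 → a j → t i = t j) :
    ∃ w : Perm (Fin n), Good w t ∧ ∀ i j : Fin n, (j : ℕ) = i + 1 → (w i < w j ↔ a j) := by
  classical
  let R : ℕ → ℕ := fun m => (Finset.univ.filter fun k : Fin n => (k : ℕ) ≤ m ∧ ¬ a k).card
  have hR : ∀ m, R m ≤ n := fun m => (Finset.card_le_univ _).trans (by simp)
  let K : Fin n → ℕ := fun j => (n - R j) * n + j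
  have hKinj : Function.Injective K := by
    intro i j hij
    have hi := i.2
    have hj := j.2
    have h1 : K i % n = i := by
      simp only [K]; rw [Nat.mul_add_mod_self_right, Nat.mod_eq_of_lt hi]
    have h2 : K j % n = j := by
      simp only [K]; rw [Nat.mul_add_mod_self_right, Nat.mod_eq_of_lt hj]
    exact Fin.ext (by rw [← h1, ← h2, hij])
  obtain ⟨w, hw⟩ := exists_perm_of_key K hKinj
  have hstep : ∀ i j : Fin n, (j : ℕ) = i + 1 → (a j → K j = K i + 1) ∧ (¬ a j → K j < K i) := by
    intro i j hij
    constructor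
    · intro haj
      have : R j = R i := by
        refine congrArg Finset.card (Finset.filter_congr fun k _ => ?_)
        constructor
        · rintro ⟨h1, h2⟩
          refine ⟨?_, h2⟩
          rcases Nat.lt_or_ge k j with h | h
          · omega
          · exact absurd (by rwa [show k = j from Fin.ext (by omega)]) h2
        · rintro ⟨h1, h2⟩; exact ⟨by omega, h2⟩
      change (n - R j) * n + j = (n - R i) * n + i + 1
      rw [this, hij]; omega
    · intro haj
      have : R j = R i + 1 := by
        have : (Finset.univ.filter fun k : Fin n => (k : ℕ) ≤ j ∧ ¬ a k) =
            insert j (Finset.univ.filter fun k : Fin n => (k : ℕ) ≤ i ∧ ¬ a k) := by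
          ext k
          simp only [Finset.mem_filter, Finset.mem_univ, true_and, Finset.mem_insert]
          constructor
          · rintro ⟨h1, h2⟩
            by_cases hk : k = j
            · exact Or.inl hk
            · refine Or.inr ⟨?_, h2⟩
              have : (k : ℕ) ≠ j := fun h => hk (Fin.ext h)
              omega
          · rintro (rfl | ⟨h1, h2⟩)
            · exact ⟨le_rfl, haj⟩
            · exact ⟨by omega, h2⟩
        simp only [R]
        rw [this, Finset.card_insert_of_notMem]
        intro hh
        have := (Finset.mem_filter.1 hh).2.1
        omega
      have h1 := hR j
      have h2 : n - R i = (n - R j) + 1 := by omega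
      have hj := j.2
      simp only [K, h2, Nat.add_mul, one_mul]
      omega
  refine ⟨w, ?_, ?_⟩
  · intro i j hij hlt
    have haj : a j := by
      by_contra h
      have h1 := (hstep i j hij).2 h
      have h2 := (hw i j).1 hlt
      omega
    refine ⟨?_, ht i j hij haj⟩
    have hK1 := (hstep i j hij).1 haj
    by_contra hne
    rw [Fin.lt_def] at hlt
    have hx : (w i : ℕ) + 1 < n := by have := (w j).2; omega
    obtain ⟨k, hk⟩ := w.surjective ⟨w i + 1, hx⟩
    have h1 : K i < K k := (hw i k).1 (by rw [hk, Fin.lt_def]; simp)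
    have h2 : K k < K j := (hw k j).1 (by rw [hk, Fin.lt_def]; simp; omega)
    omega
  · intro i j hij
    rw [hw]
    constructor
    · intro h1
      by_contra h
      have := (hstep i j hij).2 h
      omega
    · intro h
      have := (hstep i j hij).1 h
      omega

/-- Composing a good permutation with the reversal gives the involution reversing each run. -/
lemma Good.rev_rev (h : Good w t) (j : Fin n) :
    Fin.rev (w (Fin.rev (w j))) = j ∧ t (Fin.rev (w j)) = t j := by
  classical
  let run : Fin n → Fin n → Prop := fun i j => i ≤ j ∧ w i ≤ w j
  have hconv : ∀ i j k, run i j → i ≤ k → k ≤ j → run i k ∧ run k j := by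
    rintro i j k ⟨h1, h2⟩ hik hkj
    rcases eq_or_lt_of_le hik with rfl | hik
    · exact ⟨⟨le_rfl, le_rfl⟩, h1, h2⟩
    rcases eq_or_lt_of_le hkj with rfl | hkj
    · exact ⟨⟨h1, h2⟩, le_rfl, le_rfl⟩
    have hij := hik.trans hkj
    have hlt : w i < w j := lt_of_le_of_ne h2 fun h' => hij.ne (w.injective h')
    have hb := h.ascent_of_lt_of_between hij hlt
    refine ⟨⟨hik.le, ?_⟩, hkj.le, ?_⟩
    · exact ((h.lt_iff hik).2 fun a b h1 h2 h3 => hb a b h1 h2 (h3.trans hkj.le)).le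
    · exact ((h.lt_iff hkj).2 fun a b h1 h2 h3 => hb a b (hik.le.trans h1) h2 h3).le
  have htrans : ∀ i j k, run i j → run j k → run i k :=
    fun i j k h1 h2 => ⟨h1.1.trans h2.1, h1.2.trans h2.2⟩
  have hlab : ∀ i j, run i j → t i = t j := by
    rintro i j ⟨h1, h2⟩
    rcases eq_or_lt_of_le h1 with rfl | h1
    · rfl
    · exact h.label_eq_of_lt h1 (lt_of_le_of_ne h2 fun h' => h1.ne (w.injective h'))
  -- the ends of the run of `j`
  obtain ⟨f, hf, hfmin⟩ : ∃ f, run f j ∧ ∀ i, run i j → f ≤ i := by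
    have hne : (Finset.univ.filter fun i => run i j).Nonempty :=
      ⟨j, by simp [run]⟩
    refine ⟨(Finset.univ.filter fun i => run i j).min' hne, ?_, ?_⟩
    · have := Finset.min'_mem _ hne
      simpa using this
    · intro i hi
      exact Finset.min'_le _ _ (by simpa using hi)
  obtain ⟨l, hl, hlmax⟩ : ∃ l, run j l ∧ ∀ i, run j i → i ≤ l := by
    have hne : (Finset.univ.filter fun i => run j i).Nonempty :=
      ⟨j, by simp [run]⟩
    refine ⟨(Finset.univ.filter fun i => run j i).max' hne, ?_, ?_⟩
    · have := Finset.max'_mem _ hne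
      simpa using this
    · intro i hi
      exact Finset.le_max' _ _ (by simpa using hi)
  have hfl : run f l := htrans _ _ _ hf hl
  have hin : ∀ i, f ≤ i → i ≤ l → run f i ∧ run i l := fun i h1 h2 => hconv f l i hfl h1 h2
  have hcross : ∀ a b, f ≤ a → a ≤ l → run a b → b ≤ l := by
    intro a b ha hal hab
    by_contra hb
    have h1 : run f b := htrans _ _ _ (hin a ha hal).1 hab
    have h2 := (hconv f b j h1 hf.1 (hl.1.trans (not_le.1 hb).le)).2
    exact hb (hlmax b h2)
  have hcross' : ∀ a b, f ≤ b → b ≤ l → run a b → f ≤ a := by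
    intro a b hb hbl hab
    by_contra ha
    have h1 : run a l := htrans _ _ _ hab (hin b hb hbl).2
    have h2 := (hconv a l j h1 ((not_le.1 ha).le.trans hf.1) hl.1).1
    exact ha (hfmin a h2)
  have hcount : ∀ i, f ≤ i → i ≤ l → ((Fin.rev (w i) : Fin n) : ℕ) = f + (l - i) := by
    intro i h1 h2
    have hset : (Finset.univ.filter fun k => w i < w k) = Finset.Iio f ∪ Finset.Ioc i l := by
      ext k
      simp only [Finset.mem_filter, Finset.mem_univ, true_and, Finset.mem_union, Finset.mem_Iio,
        Finset.mem_Ioc]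
      constructor
      · intro hk
        rcases lt_trichotomy i k with hik | rfl | hik
        · exact Or.inr ⟨hik, hcross i k h1 h2 ⟨hik.le, hk.le⟩⟩
        · exact absurd hk (lt_irrefl _)
        · refine Or.inl (lt_of_not_ge fun hfk => ?_)
          have := ((hconv f i k (hin i h1 h2).1 hfk hik.le).2).2
          exact absurd hk (not_lt.2 this)
      · rintro (hk | ⟨hik, hkl⟩)
        · by_contra hlt
          have := hcross' k i h1 h2 ⟨(hk.trans_le h1).le, not_lt.1 hlt⟩
          exact absurd hk (not_lt.2 this)
        · exact lt_of_le_of_ne ((hconv i l k (hin i h1 h2).2 hik.le hkl).1).2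
            fun h' => hik.ne (w.injective h')
    have hcard : (Finset.univ.filter fun k => w i < w k).card = n - 1 - w i := by
      have : (Finset.univ.filter fun k => w i < w k) =
          (Finset.Ioi (w i)).map w.symm.toEmbedding := by
        ext k
        simp
      rw [this, Finset.card_map, Fin.card_Ioi]
    rw [hset, Finset.card_union_of_disjoint, Fin.card_Iio, Fin.card_Ioc] at hcard
    · rw [Fin.val_rev]
      omega
    · rw [Finset.disjoint_left]
      intro k hk hk'
      simp only [Finset.mem_Iio, Finset.mem_Ioc] at hk hk'
      exact absurd (h1.trans_lt (hk'.1.trans hk)) (lt_irrefl _)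
  have hj := hcount j hf.1 hl.1
  have hfj := Fin.le_def.1 hf.1
  have hjl := Fin.le_def.1 hl.1
  have b1 : f ≤ Fin.rev (w j) := by rw [Fin.le_def]; omega
  have b2 : Fin.rev (w j) ≤ l := by rw [Fin.le_def]; omega
  constructor
  · have h2 := hcount _ b1 b2
    ext
    rw [h2, hj]
    omega
  · rw [← hlab _ _ (hin _ b1 b2).1, hlab _ _ hf]

lemma natCard_good [Fintype T] (m : ℕ) :
    Nat.card {p : Perm (Fin (m + 1)) × (Fin (m + 1) → T) // Good p.1 p.2} =
      Fintype.card T * (Fintype.card T + 1) ^ m := by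
  classical
  let f : {p : Perm (Fin (m + 1)) × (Fin (m + 1) → T) // Good p.1 p.2} →
      T × (Fin m → Option T) := fun p =>
    (p.1.2 0, fun i => if p.1.1 i.castSucc < p.1.1 i.succ then none else some (p.1.2 i.succ))
  have hinj : Function.Injective f := by
    rintro ⟨⟨w, t⟩, h⟩ ⟨⟨w', t'⟩, h'⟩ heq
    simp only [f, Prod.mk.injEq] at heq
    dsimp only at h h'
    obtain ⟨h0, hs⟩ := heq
    have hasc : ∀ i : Fin m, (w i.castSucc < w i.succ ↔ w' i.castSucc < w' i.succ) := by
      intro i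
      have := congrFun hs i
      by_cases h1 : w i.castSucc < w i.succ <;> by_cases h2 : w' i.castSucc < w' i.succ <;>
        simp [h1, h2] at this ⊢
    have ht : ∀ i, t i = t' i := by
      intro i
      induction i using Fin.induction with
      | zero => exact h0
      | succ i ih =>
        by_cases hi : w i.castSucc < w i.succ
        · rw [← (h i.castSucc i.succ (by simp) hi).2, ih,
            (h' i.castSucc i.succ (by simp) ((hasc i).1 hi)).2]
        · have := congrFun hs i
          rw [if_neg hi, if_neg (fun hh => hi ((hasc i).2 hh))] at this
          exact Option.some.inj this
    have hw : w = w' := by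
      refine Good.perm_eq h h' fun i j hij => ?_
      have hi : (i : ℕ) < m := by have := j.2; omega
      have := hasc ⟨i, hi⟩
      have e1 : (⟨i, hi⟩ : Fin m).castSucc = i := rfl
      have e2 : (⟨i, hi⟩ : Fin m).succ = j := by ext; simp [hij]
      rwa [e1, e2] at this
    have : t = t' := funext ht
    subst hw this
    rfl
  have hsurj : Function.Surjective f := by
    rintro ⟨t0, d⟩
    let t : Fin (m + 1) → T := fun i => Fin.induction (motive := fun _ => T) t0
      (fun i x => (d i).getD x) i
    let a : Fin (m + 1) → Prop := fun j => ∃ i : Fin m, i.succ = j ∧ d i = none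
    have ht : ∀ i : Fin m, t i.succ = (d i).getD (t i.castSucc) := fun i => by
      simp [t]
    have key : ∀ i j : Fin (m + 1), (j : ℕ) = i + 1 → ∃ k : Fin m, k.castSucc = i ∧ k.succ = j := by
      intro i j hij
      have hi : (i : ℕ) < m := by have := j.2; omega
      exact ⟨⟨i, hi⟩, rfl, by ext; simp [hij]⟩
    obtain ⟨w, hw, hasc⟩ := exists_good a t (by
      intro i j hij haj
      obtain ⟨k, rfl, rfl⟩ := key i j hij
      obtain ⟨k', hk', hd⟩ := haj
      rw [Fin.succ_inj] at hk'
      subst hk'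
      rw [ht, hd]; rfl)
    refine ⟨⟨(w, t), hw⟩, ?_⟩
    simp only [f]
    refine Prod.ext ?_ (funext fun i => ?_)
    · simp [t]
    · have h1 := hasc i.castSucc i.succ (by simp)
      simp only [h1]
      split_ifs with hi
      · obtain ⟨k, hk, hd⟩ := hi
        rw [Fin.succ_inj] at hk
        rw [← hk, hd]
      · have : d i ≠ none := fun hd => hi ⟨i, rfl, hd⟩
        obtain ⟨x, hx⟩ := Option.ne_none_iff_exists'.1 this
        rw [ht, hx]; rfl
  rw [Nat.card_congr (Equiv.ofBijective f ⟨hinj, hsurj⟩), Nat.card_eq_fintype_card]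
  simp

end Runs

end GelfandGraev

namespace GelfandGraev

open Matrix

section MatrixGroups

variable {ι : Type*} [Fintype ι] [DecidableEq ι] {F : Type*} [Field F] [Finite F]

omit [DecidableEq ι] in
omit [Field F] in
lemma finite_matrix : Finite (Matrix ι ι F) := by
  classical
  exact inferInstanceAs (Finite (ι → ι → F))

instance : Finite (GL ι F) := by
  have : Finite (Matrix ι ι F) := finite_matrix
  exact Finite.of_injective (fun g : GL ι F => g.val) Units.val_injective

/-- A multiplicatively closed subset of a finite group is a subgroup. -/
def subgroupOfFinite {G : Type*} [Group G] [Finite G] (S : Submonoid G) : Subgroup G :=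
  { S with
    inv_mem' := fun {x} hx => by
      rw [← mul_one x⁻¹, inv_mul_eq_iff_eq_mul.2 (pow_orderOf_eq_one x ▸ ?_ :
        (1 : G) = x * x ^ (orderOf x - 1))]
      · exact S.pow_mem hx _
      · rw [← pow_succ', Nat.sub_add_cancel (orderOf_pos x)] }

/-- The unipotent radical of the parabolic attached to `β`. -/
def unip (F : Type*) [Field F] [Finite F] (β : ι → ℕ) : Subgroup (GL ι F) :=
  subgroupOfFinite
    { carrier := {g | ∀ i j, β j ≤ β i → g.val i j = (1 : Matrix ι ι F) i j}
      one_mem' := fun i j _ => rfl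
      mul_mem' := fun {g h} hg hh i j hij => by
        rw [Units.val_mul, Matrix.mul_apply, ← Matrix.one_mul (1 : Matrix ι ι F), Matrix.mul_apply]
        refine Finset.sum_congr rfl fun k _ => ?_
        rcases le_or_gt (β k) (β i) with h1 | h1
        · rw [hg i k h1]
          by_cases hik : i = k
          · subst hik; rw [hh i j hij]
          · rw [Matrix.one_apply_ne hik, zero_mul, zero_mul]
        · have h2 : β j < β k := hij.trans_lt h1
          have h3 : k ≠ j := by rintro rfl; exact lt_irrefl _ h2
          rw [hh k j h2.le, Matrix.one_apply_ne h3, mul_zero, mul_zero] }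

/-- The parabolic attached to `β`. -/
def para (F : Type*) [Field F] [Finite F] (β : ι → ℕ) : Subgroup (GL ι F) :=
  subgroupOfFinite
    { carrier := {g | ∀ i j, β j < β i → g.val i j = 0}
      one_mem' := fun i j h => Matrix.one_apply_ne (by rintro rfl; exact lt_irrefl _ h)
      mul_mem' := fun {g h} hg hh i j hij => by
        rw [Units.val_mul, Matrix.mul_apply]
        refine Finset.sum_eq_zero fun k _ => ?_
        rcases lt_or_ge (β k) (β i) with h1 | h1
        · rw [hg i k h1, zero_mul]
        · rw [hh k j (hij.trans_le h1), mul_zero] }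

/-- The Levi subgroup attached to `β`. -/
def levi (F : Type*) [Field F] [Finite F] (β : ι → ℕ) : Subgroup (GL ι F) :=
  subgroupOfFinite
    { carrier := {g | ∀ i j, β i ≠ β j → g.val i j = 0}
      one_mem' := fun i j h => Matrix.one_apply_ne (by rintro rfl; exact h rfl)
      mul_mem' := fun {g h} hg hh i j hij => by
        rw [Units.val_mul, Matrix.mul_apply]
        refine Finset.sum_eq_zero fun k _ => ?_
        by_cases h1 : β i = β k
        · rw [hh k j (h1 ▸ hij), mul_zero]
        · rw [hg i k h1, zero_mul] }

lemma unip_le_para (β : ι → ℕ) : unip F β ≤ para F β := by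
  intro g hg i j hij
  rw [hg i j hij.le, Matrix.one_apply_ne]
  rintro rfl; exact lt_irrefl _ hij

lemma levi_le_para (β : ι → ℕ) : levi F β ≤ para F β :=
  fun _ hg i j hij => hg i j hij.ne'

lemma unip_mono {β r : ι → ℕ} (h : ∀ i j, r j ≤ r i → β j ≤ β i) : unip F β ≤ unip F r :=
  fun _ hg i j hij => hg i j (h i j hij)

lemma unip_le_para_of_refines {β r : ι → ℕ} (h : ∀ i j, β i < β j → r i < r j) :
    unip F r ≤ para F β := by
  intro g hg i j hij
  rw [hg i j (h j i hij).le, Matrix.one_apply_ne]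
  rintro rfl; exact lt_irrefl _ hij

omit [Finite F] in
lemma val_mul_val_inv (g : GL ι F) : g.val * (g⁻¹).val = 1 := by
  rw [← Units.val_mul, mul_inv_cancel, Units.val_one]

omit [Finite F] in
lemma val_inv_mul_val (g : GL ι F) : (g⁻¹).val * g.val = 1 := by
  rw [← Units.val_mul, inv_mul_cancel, Units.val_one]

lemma levi_conj_unip {β : ι → ℕ} {l u : GL ι F} (hl : l ∈ levi F β) (hu : u ∈ unip F β) :
    l * u * l⁻¹ ∈ unip F β := by
  intro i j hij
  have hl' := (levi F β).inv_mem hl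
  rw [← val_mul_val_inv l, Units.val_mul, Units.val_mul]
  rw [Matrix.mul_apply, Matrix.mul_apply]
  refine Finset.sum_congr rfl fun m _ => ?_
  by_cases hm : β m = β j
  · congr 1
    rw [Matrix.mul_apply]
    have : l.val i m = ∑ k, l.val i k * (1 : Matrix ι ι F) k m := by
      rw [← Matrix.mul_apply, Matrix.mul_one]
    rw [this]
    refine Finset.sum_congr rfl fun k _ => ?_
    by_cases hk : β i = β k
    · rw [hu k m (by omega)]
    · rw [hl i k hk, zero_mul, zero_mul]
  · rw [hl' m j hm, mul_zero, mul_zero]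

/-- Levi decomposition. -/
lemma exists_levi_mul_unip {β : ι → ℕ} {p : GL ι F} (hp : p ∈ para F β) :
    ∃ l ∈ levi F β, ∃ u ∈ unip F β, p = l * u := by
  have hp' := (para F β).inv_mem hp
  let bd : Matrix ι ι F → Matrix ι ι F := fun M => Matrix.of fun i j =>
    if β i = β j then M i j else 0
  have key : ∀ g h : GL ι F, g ∈ para F β → h ∈ para F β →
      ∀ i j, β j ≤ β i → (bd g.val * h.val) i j = if β i = β j then (g * h).val i j else 0 := by
    intro g h hg hh i j hij
    rw [Units.val_mul, Matrix.mul_apply, Matrix.mul_apply]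
    split_ifs with h1
    · refine Finset.sum_congr rfl fun k _ => ?_
      simp only [bd, Matrix.of_apply]
      split_ifs with h2
      · rfl
      · rcases lt_or_gt_of_ne h2 with h2 | h2
        · rw [hh k j (by omega), zero_mul, mul_zero]
        · rw [hg i k h2]
    · refine Finset.sum_eq_zero fun k _ => ?_
      simp only [bd, Matrix.of_apply]
      split_ifs with h2
      · rw [hh k j (by omega), mul_zero]
      · rw [zero_mul]
  have hbd : ∀ g h : GL ι F, g ∈ para F β → h ∈ para F β → g * h = 1 →
      bd g.val * bd h.val = 1 := by
    intro g h hg hh hgh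
    ext i j
    have h1 : (bd g.val * bd h.val) i j = if β i = β j then (bd g.val * h.val) i j else 0 := by
      rw [Matrix.mul_apply, Matrix.mul_apply]
      split_ifs with h1
      · refine Finset.sum_congr rfl fun k _ => ?_
        simp only [bd, Matrix.of_apply]
        split_ifs with h2 h3 h3
        · rfl
        · omega
        · rfl
        · simp
      · refine Finset.sum_eq_zero fun k _ => ?_
        simp only [bd, Matrix.of_apply]
        split_ifs with h2 h3 h3
        · omega
        all_goals simp
    rw [h1]
    split_ifs with h2
    · rw [key g h hg hh i j (by omega), if_pos h2, hgh, Units.val_one]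
    · rw [Matrix.one_apply_ne]; rintro rfl; exact h2 rfl
  let l : GL ι F := ⟨bd p.val, bd (p⁻¹).val, hbd _ _ hp hp' (mul_inv_cancel _),
    hbd _ _ hp' hp (inv_mul_cancel _)⟩
  refine ⟨l, fun i j hij => by simp [l, bd, hij], l⁻¹ * p, fun i j hij => ?_,
    (mul_inv_cancel_left _ _).symm⟩
  have h1 : (l⁻¹ * p).val = bd (p⁻¹).val * p.val := rfl
  rw [h1, key _ _ hp' hp i j hij, inv_mul_cancel, Units.val_one]
  split_ifs with h2
  · rfl
  · rw [Matrix.one_apply_ne]; rintro rfl; exact h2 rfl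

end MatrixGroups

section Embedding

variable {ι α α' : Type*} [Fintype ι] [DecidableEq ι] [Fintype α] [DecidableEq α]
  [Fintype α'] [DecidableEq α'] {F : Type*} [Field F]

/-- The 0-1 matrix of an injection. -/
def inc (F : Type*) [Field F] (φ : α ↪ ι) : Matrix ι α F :=
  Matrix.of fun i a => if i = φ a then 1 else 0

omit [Fintype α] in
lemma inc_transpose_mul_inc (φ : α ↪ ι) : (inc F φ)ᵀ * inc F φ = 1 := by
  ext a b
  simp [inc, Matrix.mul_apply, Matrix.one_apply, eq_comm]

omit [Fintype α] [DecidableEq α] in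
lemma mul_inc_apply (φ : α ↪ ι) (M : Matrix ι ι F) (i : ι) (b : α) :
    (M * inc F φ) i b = M i (φ b) := by
  simp [inc, Matrix.mul_apply]

omit [Fintype α] [DecidableEq α] in
lemma inc_transpose_mul_apply (φ : α ↪ ι) (M : Matrix ι ι F) (a : α) (j : ι) :
    ((inc F φ)ᵀ * M) a j = M (φ a) j := by
  simp [inc, Matrix.mul_apply]

/-- Extension of a matrix by the identity along an injection. -/
def embMat (φ : α ↪ ι) : Matrix α α F →* Matrix ι ι F where
  toFun M := 1 + inc F φ * (M - 1) * (inc F φ)ᵀ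
  map_one' := by simp
  map_mul' M N := by
    have h : ∀ X Y : Matrix α α F, inc F φ * X * (inc F φ)ᵀ * (inc F φ * Y * (inc F φ)ᵀ) =
        inc F φ * (X * Y) * (inc F φ)ᵀ := by
      intro X Y
      calc _ = inc F φ * X * ((inc F φ)ᵀ * inc F φ) * Y * (inc F φ)ᵀ := by
            simp only [Matrix.mul_assoc]
        _ = _ := by rw [inc_transpose_mul_inc, Matrix.mul_one]; simp only [Matrix.mul_assoc]
    have h2 : M * N - 1 = (M - 1) + (N - 1) + (M - 1) * (N - 1) := by noncomm_ring
    rw [h2, Matrix.mul_add, Matrix.mul_add, Matrix.add_mul, Matrix.add_mul, ← h]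
    noncomm_ring

/-- Extension of an invertible matrix by the identity along an injection. -/
def emb (φ : α ↪ ι) : GL α F →* GL ι F := Units.map (embMat φ)

lemma emb_val (φ : α ↪ ι) (g : GL α F) :
    (emb φ g).val = 1 + inc F φ * (g.val - 1) * (inc F φ)ᵀ := rfl

omit [Fintype ι] [DecidableEq α] in
lemma inc_mul_mul_apply (φ : α ↪ ι) (X : Matrix α α F) (i j : ι) :
    (inc F φ * X * (inc F φ)ᵀ) i j =
      ∑ a, ∑ b, if i = φ a ∧ j = φ b then X a b else 0 := by
  simp only [inc, Matrix.mul_apply, Matrix.transpose_apply, Matrix.of_apply, Finset.sum_mul]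
  rw [Finset.sum_comm]
  refine Finset.sum_congr rfl fun a _ => Finset.sum_congr rfl fun b _ => ?_
  split_ifs <;> simp_all

lemma emb_apply_apply (φ : α ↪ ι) (g : GL α F) (a b : α) :
    (emb φ g).val (φ a) (φ b) = g.val a b := by
  rw [emb_val, Matrix.add_apply, inc_mul_mul_apply, Finset.sum_eq_single a, Finset.sum_eq_single b]
  · simp [Matrix.one_apply]
  · intro c _ hc; simp [hc.symm]
  · simp
  · intro c _ hc; simp [hc.symm]
  · simp

lemma emb_apply_of_notMem_left (φ : α ↪ ι) (g : GL α F) {i : ι} (hi : ∀ a, φ a ≠ i) (j : ι) :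
    (emb φ g).val i j = (1 : Matrix ι ι F) i j := by
  rw [emb_val, Matrix.add_apply, inc_mul_mul_apply, Finset.sum_eq_zero, add_zero]
  intro a _
  refine Finset.sum_eq_zero fun b _ => if_neg ?_
  rintro ⟨h, -⟩
  exact hi a h.symm

lemma emb_apply_of_notMem_right (φ : α ↪ ι) (g : GL α F) (i : ι) {j : ι} (hj : ∀ a, φ a ≠ j) :
    (emb φ g).val i j = (1 : Matrix ι ι F) i j := by
  rw [emb_val, Matrix.add_apply, inc_mul_mul_apply, Finset.sum_eq_zero, add_zero]
  intro a _
  refine Finset.sum_eq_zero fun b _ => if_neg ?_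
  rintro ⟨-, h⟩
  exact hj b h.symm

lemma emb_injective (φ : α ↪ ι) : Function.Injective (emb (F := F) φ) := by
  intro g h hgh
  ext a b
  have := congrArg (fun x : GL ι F => x.val (φ a) (φ b)) hgh
  simpa only [emb_apply_apply] using this

/-- To compare a matrix with an extension by the identity it suffices to compare the block and the
remaining entries. -/
lemma eq_emb_iff {φ : α ↪ ι} {g : GL α F} {h : GL ι F}
    (h1 : ∀ a b, h.val (φ a) (φ b) = g.val a b)
    (h2 : ∀ i j, ((∀ a, φ a ≠ i) ∨ (∀ a, φ a ≠ j)) → h.val i j = (1 : Matrix ι ι F) i j) :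
    h = emb φ g := by
  ext i j
  by_cases hi : ∃ a, φ a = i
  · by_cases hj : ∃ b, φ b = j
    · obtain ⟨a, rfl⟩ := hi
      obtain ⟨b, rfl⟩ := hj
      rw [h1, emb_apply_apply]
    · push Not at hj
      rw [h2 i j (Or.inr hj), emb_apply_of_notMem_right φ g i hj]
  · push Not at hi
    rw [h2 i j (Or.inl hi), emb_apply_of_notMem_left φ g hi]

lemma emb_emb (φ : α' ↪ α) (φ' : α ↪ ι) (g : GL α' F) :
    emb φ' (emb φ g) = emb (φ.trans φ') g := by
  refine eq_emb_iff (fun a b => ?_) (fun i j hij => ?_)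
  · simp [emb_apply_apply]
  · by_cases hi : ∃ a, φ' a = i
    · by_cases hj : ∃ b, φ' b = j
      · obtain ⟨a, rfl⟩ := hi
        obtain ⟨b, rfl⟩ := hj
        have h1 : (1 : Matrix ι ι F) (φ' a) (φ' b) = (1 : Matrix α α F) a b := by
          simp [Matrix.one_apply]
        rw [emb_apply_apply, h1]
        rcases hij with h | h
        · exact emb_apply_of_notMem_left φ g (fun c hc => h c (by simp [hc])) b
        · exact emb_apply_of_notMem_right φ g a (fun c hc => h c (by simp [hc]))
      · push Not at hj
        exact emb_apply_of_notMem_right _ _ _ hj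
    · push Not at hi
      exact emb_apply_of_notMem_left _ _ hi _

lemma emb_comp (φ : α' ↪ α) (φ' : α ↪ ι) :
    (emb (F := F) φ').comp (emb φ) = emb (φ.trans φ') :=
  MonoidHom.ext fun g => emb_emb φ φ' g

/-- Elements that are trivial on the rows and columns in the range commute with the extension. -/
lemma emb_commute_of_trivial {φ : α ↪ ι} {h : GL ι F}
    (h1 : ∀ a j, h.val (φ a) j = (1 : Matrix ι ι F) (φ a) j)
    (h2 : ∀ i a, h.val i (φ a) = (1 : Matrix ι ι F) i (φ a)) (g : GL α F) :
    emb φ g * h = h * emb φ g := by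
  have e1 : (inc F φ)ᵀ * h.val = (inc F φ)ᵀ := by
    ext a j
    rw [inc_transpose_mul_apply, h1]
    simp [inc, Matrix.one_apply, eq_comm]
  have e2 : h.val * inc F φ = inc F φ := by
    ext i a
    rw [mul_inc_apply, h2]
    simp [inc, Matrix.one_apply]
  apply Units.ext
  rw [Units.val_mul, Units.val_mul, emb_val, Matrix.add_mul, Matrix.mul_add, Matrix.one_mul,
    Matrix.mul_one, Matrix.mul_assoc, e1, ← Matrix.mul_assoc, ← Matrix.mul_assoc, e2]

lemma emb_commute {φ : α ↪ ι} {φ' : α' ↪ ι} (h : ∀ a b, φ a ≠ φ' b) (g : GL α F) (g' : GL α' F) :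
    emb φ g * emb φ' g' = emb φ' g' * emb φ g :=
  emb_commute_of_trivial (fun a _ => emb_apply_of_notMem_left _ _ (fun b => (h a b).symm) _)
    (fun _ a => emb_apply_of_notMem_right _ _ _ (fun b => (h a b).symm)) g

variable [Finite F]

lemma emb_mem_levi {β : ι → ℕ} {φ : α ↪ ι} (h : ∀ a b, β (φ a) = β (φ b)) (g : GL α F) :
    emb φ g ∈ levi F β := by
  intro i j hij
  have hne : i ≠ j := by rintro rfl; exact hij rfl
  by_cases hi : ∃ a, φ a = i
  · by_cases hj : ∃ b, φ b = j
    · obtain ⟨a, rfl⟩ := hi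
      obtain ⟨b, rfl⟩ := hj
      exact absurd (h a b) hij
    · push Not at hj
      rw [emb_apply_of_notMem_right _ _ _ hj, Matrix.one_apply_ne hne]
  · push Not at hi
    rw [emb_apply_of_notMem_left _ _ hi, Matrix.one_apply_ne hne]

lemma emb_mem_unip {β : ι → ℕ} {φ : α ↪ ι} {g : GL α F} (hg : g ∈ unip F (fun a => β (φ a))) :
    emb φ g ∈ unip F β := by
  intro i j hij
  by_cases hi : ∃ a, φ a = i
  · by_cases hj : ∃ b, φ b = j
    · obtain ⟨a, rfl⟩ := hi
      obtain ⟨b, rfl⟩ := hj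
      rw [emb_apply_apply, hg a b hij]
      simp [Matrix.one_apply]
    · push Not at hj
      exact emb_apply_of_notMem_right _ _ _ hj
  · push Not at hi
    exact emb_apply_of_notMem_left _ _ hi _

/-- Splitting off one block of an element of a Levi subgroup. -/
lemma exists_block_of_mem_levi {β : ι → ℕ} {φ : α ↪ ι} {c : ℕ} (hφ : ∀ i, β i = c ↔ ∃ a, φ a = i)
    {l : GL ι F} (hl : l ∈ levi F β) :
    ∃ (g : GL α F) (r : GL ι F), r ∈ levi F β ∧ l = r * emb φ g ∧
      (∀ a j, r.val (φ a) j = (1 : Matrix ι ι F) (φ a) j) ∧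
      (∀ i a, r.val i (φ a) = (1 : Matrix ι ι F) i (φ a)) := by
  have hβ : ∀ a, β (φ a) = c := fun a => (hφ _).2 ⟨a, rfl⟩
  have hsub : ∀ g h : GL ι F, g ∈ levi F β → g * h = 1 →
      (g.val.submatrix φ φ) * (h.val.submatrix φ φ) = 1 := by
    intro g h hg hgh
    ext a b
    have h1 : (g * h).val (φ a) (φ b) = (1 : Matrix α α F) a b := by
      rw [hgh, Units.val_one]; simp [Matrix.one_apply]
    rw [← h1, Units.val_mul, Matrix.mul_apply, Matrix.mul_apply]
    have h2 : ∑ k, g.val (φ a) k * h.val k (φ b) =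
        ∑ k ∈ Finset.univ.map φ, g.val (φ a) k * h.val k (φ b) := by
      symm
      refine Finset.sum_subset (Finset.subset_univ _) fun k _ hk => ?_
      have : β (φ a) ≠ β k := by
        rw [hβ]
        intro hc
        obtain ⟨d, hd⟩ := (hφ k).1 hc.symm
        exact hk (by simp [← hd])
      rw [hg _ _ this, zero_mul]
    rw [h2, Finset.sum_map]
    rfl
  have hl' := (levi F β).inv_mem hl
  let g : GL α F := ⟨l.val.submatrix φ φ, (l⁻¹).val.submatrix φ φ,
    hsub _ _ hl (mul_inv_cancel _), hsub _ _ hl' (inv_mul_cancel _)⟩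
  have hr : l * (emb φ g)⁻¹ ∈ levi F β :=
    (levi F β).mul_mem hl ((levi F β).inv_mem (emb_mem_levi (fun a b => by rw [hβ, hβ]) g))
  have hlg : l = (l * (emb φ g)⁻¹) * emb φ g := by group
  have hblock : ∀ a b, (l * (emb φ g)⁻¹).val (φ a) (φ b) = (1 : Matrix ι ι F) (φ a) (φ b) := by
    intro a b
    have hsubm : ((l * (emb φ g)⁻¹).val.submatrix φ φ) * (l.val.submatrix φ φ) =
        l.val.submatrix φ φ := by
      ext a b
      rw [Matrix.mul_apply]
      conv_rhs => rw [Matrix.submatrix_apply, hlg, Units.val_mul, Matrix.mul_apply]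
      have h2 : ∑ k, (l * (emb φ g)⁻¹).val (φ a) k * (emb φ g).val k (φ b) =
          ∑ k ∈ Finset.univ.map φ, (l * (emb φ g)⁻¹).val (φ a) k * (emb φ g).val k (φ b) := by
        symm
        refine Finset.sum_subset (Finset.subset_univ _) fun k _ hk => ?_
        have : β (φ a) ≠ β k := by
          rw [hβ]
          intro hc
          obtain ⟨d, hd⟩ := (hφ k).1 hc.symm
          exact hk (by simp [← hd])
        rw [hr _ _ this, zero_mul]
      rw [h2, Finset.sum_map]
      refine Finset.sum_congr rfl fun k _ => ?_
      rw [emb_apply_apply]; rfl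
    have h3 : ((l * (emb φ g)⁻¹).val.submatrix φ φ) = 1 := by
      have := congrArg (· * (l⁻¹).val.submatrix φ φ) hsubm
      simp only [Matrix.mul_assoc] at this
      rwa [hsub _ _ hl (mul_inv_cancel _), Matrix.mul_one] at this
    have := congrFun (congrFun h3 a) b
    rw [Matrix.submatrix_apply] at this
    rw [this]; simp [Matrix.one_apply]
  refine ⟨g, l * (emb φ g)⁻¹, hr, hlg, fun a j => ?_, fun i a => ?_⟩
  · by_cases hj : β j = c
    · obtain ⟨b, rfl⟩ := (hφ j).1 hj
      exact hblock a b
    · rw [hr _ _ (by rw [hβ]; exact Ne.symm hj), Matrix.one_apply_ne]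
      rintro rfl; exact hj (hβ a)
  · by_cases hi : β i = c
    · obtain ⟨b, rfl⟩ := (hφ i).1 hi
      exact hblock b a
    · rw [hr _ _ (by rw [hβ]; exact hi), Matrix.one_apply_ne]
      rintro rfl; exact hi (hβ a)

end Embedding

section Bruhat

variable {ι : Type*} [Fintype ι] [DecidableEq ι] {F : Type*} [Field F]

/-- The unipotent matrix `1 + a bᵀ` for orthogonal `a`, `b`. -/
def rankOne (a b : ι → F) (h : b ⬝ᵥ a = 0) : GL ι F where
  val := 1 + vecMulVec a b
  inv := 1 - vecMulVec a b
  val_inv := by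
    have : vecMulVec a b * vecMulVec a b = 0 := by
      rw [vecMulVec_mul_vecMulVec, h]; ext; simp [vecMulVec_apply]
    rw [Matrix.add_mul, Matrix.mul_sub, Matrix.mul_sub, this]; simp
  inv_val := by
    have : vecMulVec a b * vecMulVec a b = 0 := by
      rw [vecMulVec_mul_vecMulVec, h]; ext; simp [vecMulVec_apply]
    rw [Matrix.sub_mul, Matrix.mul_add, Matrix.mul_add, this]; simp

/-- The monomial matrix with entry `t j` at position `(w j, j)`. -/
def mono (w : Equiv.Perm ι) (t : ι → Fˣ) : GL ι F where
  val := Matrix.of fun i j => if i = w j then (t j : F) else 0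
  inv := Matrix.of fun j i => if i = w j then ((t j)⁻¹ : Fˣ) else (0 : F)
  val_inv := by
    ext i k
    rw [Matrix.mul_apply, Finset.sum_eq_single (w.symm i)]
    · by_cases h : i = k
      · subst h; simp
      · simp [h, Ne.symm h]
    · intro j _ hj
      have : i ≠ w j := fun h => hj (by rw [h, Equiv.symm_apply_apply])
      simp [this]
    · simp
  inv_val := by
    ext i k
    rw [Matrix.mul_apply, Finset.sum_eq_single (w k)]
    · by_cases h : i = k
      · subst h; simp
      · simp [h, Ne.symm h]
    · intro j _ hj
      simp [hj]
    · simp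

lemma mono_apply (w : Equiv.Perm ι) (t : ι → Fˣ) (i j : ι) :
    (mono w t).val i j = if i = w j then (t j : F) else 0 := rfl

lemma mono_mul_apply (w : Equiv.Perm ι) (t : ι → Fˣ) (M : Matrix ι ι F) (i j : ι) :
    ((mono w t).val * M) (w i) j = t i * M i j := by
  rw [Matrix.mul_apply, Finset.sum_eq_single i]
  · simp [mono_apply]
  · intro k _ hk; simp [mono_apply, Ne.symm hk]
  · simp

lemma mul_mono_apply (w : Equiv.Perm ι) (t : ι → Fˣ) (M : Matrix ι ι F) (i j : ι) :
    (M * (mono w t).val) i j = M i (w j) * t j := by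
  rw [Matrix.mul_apply, Finset.sum_eq_single (w j)]
  · simp [mono_apply]
  · intro k _ hk; simp [mono_apply, hk]
  · simp

variable [Finite F]

lemma rankOne_mem_unip {β : ι → ℕ} {a b : ι → F} (h : b ⬝ᵥ a = 0)
    (hab : ∀ i j, β j ≤ β i → a i * b j = 0) : rankOne a b h ∈ unip F β := by
  intro i j hij
  simp [rankOne, vecMulVec_apply, hab i j hij]

/-- Bruhat decomposition with respect to two arbitrary orderings. -/
lemma bruhat {r c : ι → ℕ} (hr : Function.Injective r) (hc : Function.Injective c) (g : GL ι F) :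
    ∃ u ∈ unip F r, ∃ v ∈ unip F c, ∃ w t, g = u * mono w t * v := by
  classical
  have key : ∀ T : ℕ, ∃ u ∈ unip F r, ∃ v ∈ unip F c, ∃ p : ι → ι, ∀ j, c j < T →
      (u * g * v).val (p j) j ≠ 0 ∧ (∀ i, i ≠ p j → (u * g * v).val i j = 0) ∧
      (∀ k, k ≠ j → (u * g * v).val (p j) k = 0) := by
    intro T
    induction T with
    | zero => exact ⟨1, one_mem _, 1, one_mem _, id, fun j hj => absurd hj (Nat.not_lt_zero _)⟩
    | succ T ih =>
      obtain ⟨u, hu, v, hv, p, hp⟩ := ih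
      by_cases hT : ∃ j, c j = T
      swap
      · refine ⟨u, hu, v, hv, p, fun j hj => hp j ?_⟩
        have : c j ≠ T := fun h => hT ⟨j, h⟩
        omega
      obtain ⟨j₀, hj₀⟩ := hT
      set h := u * g * v with hh
      have hcol : (Finset.univ.filter fun i => h.val i j₀ ≠ 0).Nonempty := by
        by_contra hne
        rw [Finset.not_nonempty_iff_eq_empty, Finset.filter_eq_empty_iff] at hne
        have h1 := congrFun (congrFun (val_inv_mul_val h) j₀) j₀
        rw [Matrix.mul_apply, Finset.sum_eq_zero, Matrix.one_apply_eq] at h1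
        · exact zero_ne_one h1
        · intro k _
          have := hne (Finset.mem_univ k)
          rw [not_not] at this
          rw [this, mul_zero]
      obtain ⟨i₀, hi₀, hmax⟩ := Finset.exists_max_image _ r hcol
      simp only [Finset.mem_filter, Finset.mem_univ, true_and] at hi₀ hmax
      have hS : ∀ j, c j < T → h.val (p j) j₀ = 0 := fun j hj =>
        (hp j hj).2.2 j₀ (by rintro rfl; omega)
      have hi₀p : ∀ j, c j < T → i₀ ≠ p j := by
        rintro j hj rfl; exact hi₀ (hS j hj)
      have hrow : ∀ j, c j < T → h.val i₀ j = 0 := fun j hj => (hp j hj).2.1 i₀ (hi₀p j hj)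
      let a : ι → F := fun i => if i = i₀ then 0 else -(h.val i j₀ / h.val i₀ j₀)
      let b : ι → F := fun j => if j = j₀ then 0 else -(h.val i₀ j / h.val i₀ j₀)
      have ha : Pi.single i₀ (1 : F) ⬝ᵥ a = 0 := by simp [a]
      have hb : b ⬝ᵥ Pi.single j₀ (1 : F) = 0 := by simp [b]
      have hX : rankOne a (Pi.single i₀ 1) ha ∈ unip F r := by
        refine rankOne_mem_unip ha fun i j hij => ?_
        by_cases hj : j = i₀
        · subst hj
          have : a i = 0 := by
            simp only [a]
            split_ifs with h1
            · rfl
            · have : h.val i j₀ = 0 := by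
                by_contra h2
                exact h1 (hr (le_antisymm (hmax i h2) hij))
              simp [this]
          rw [this, zero_mul]
        · simp [hj]
      have hY : rankOne (Pi.single j₀ 1) b hb ∈ unip F c := by
        refine rankOne_mem_unip hb fun i j hij => ?_
        by_cases hi : i = j₀
        · subst hi
          have : b j = 0 := by
            simp only [b]
            split_ifs with h1
            · rfl
            · have : c j ≠ c i := fun h2 => h1 (hc h2)
              rw [hrow j (by omega)]; simp
          rw [this, mul_zero]
        · simp [hi]
      have hval : ∀ i j,
          (rankOne a (Pi.single i₀ 1) ha * h * rankOne (Pi.single j₀ 1) b hb).val i j =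
          (h.val i j + a i * h.val i₀ j) + (h.val i j₀ + a i * h.val i₀ j₀) * b j := by
        intro i j
        simp [rankOne, Matrix.add_mul, Matrix.mul_add, Matrix.vecMulVec_mul, Matrix.mul_vecMulVec,
          vecMulVec_apply]
      have hval2 : ∀ i, h.val i j₀ + a i * h.val i₀ j₀ = if i = i₀ then h.val i₀ j₀ else 0 := by
        intro i
        simp only [a]
        split_ifs with h1
        · rw [h1]; ring
        · field_simp; ring
      have hval3 : ∀ i j, (rankOne a (Pi.single i₀ 1) ha * u * g *
          (v * rankOne (Pi.single j₀ 1) b hb)).val i j =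
          (h.val i j + a i * h.val i₀ j) + (if i = i₀ then h.val i₀ j₀ else 0) * b j := by
        intro i j
        rw [← hval2, ← hval, hh]; simp only [mul_assoc]
      refine ⟨_, mul_mem hX hu, _, mul_mem hv hY, Function.update p j₀ i₀, fun j hj => ?_⟩
      rcases Nat.lt_succ_iff_lt_or_eq.1 hj with hj | hj
      · have hne : j ≠ j₀ := by rintro rfl; omega
        have hbj : b j = 0 := by simp [b, hrow j hj]
        rw [Function.update_of_ne hne]
        simp only [hval3, hbj, hrow j hj, mul_zero, add_zero]
        refine ⟨(hp j hj).1, (hp j hj).2.1, fun k hk => ?_⟩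
        have : a (p j) = 0 := by simp [a, hS j hj]
        rw [(hp j hj).2.2 k hk, this, if_neg (hi₀p j hj).symm]; ring
      · have : j = j₀ := hc (hj.trans hj₀.symm)
        subst this
        rw [Function.update_self]
        simp only [hval3]
        have hbj : b j = 0 := by simp [b]
        have hai : a i₀ = 0 := by simp [a]
        simp only [hbj, mul_zero, add_zero, hval2, hai, zero_mul, if_true]
        refine ⟨hi₀, fun i hi => by simp [hi], fun k hk => ?_⟩
        simp only [b, if_neg hk]
        field_simp; ring
  obtain ⟨u, hu, v, hv, p, hp⟩ := key (Finset.univ.sup c + 1)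
  have hp' := fun j => hp j (Nat.lt_succ_of_le (Finset.le_sup (Finset.mem_univ j)))
  have hinj : Function.Injective p := by
    intro j k hjk
    by_contra hne
    have h1 := (hp' j).2.2 k (Ne.symm hne)
    rw [hjk] at h1
    exact (hp' k).1 h1
  let w : Equiv.Perm ι := Equiv.ofBijective p (Finite.injective_iff_bijective.1 hinj)
  refine ⟨u⁻¹, inv_mem hu, v⁻¹, inv_mem hv, w, fun j => Units.mk0 _ (hp' j).1, ?_⟩
  have : mono w (fun j => Units.mk0 _ (hp' j).1) = u * g * v := by
    ext i j
    rw [mono_apply]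
    by_cases hi : i = p j
    · subst hi; simp [w]
    · rw [if_neg (by simpa [w] using hi), (hp' j).2.1 i hi]
  rw [this]; group

end Bruhat

end GelfandGraev

namespace GelfandGraev

open Matrix

section Generic

variable {F : Type*} [Field F] [Finite F] {n : ℕ}

/-- The sum of the superdiagonal entries. -/
def superSum (M : Matrix (Fin n) (Fin n) F) : F :=
  ∑ i : Fin n, ∑ j : Fin n, if (j : ℕ) = i + 1 then M i j else 0

/-- The group of upper unitriangular matrices. -/
abbrev uni (F : Type*) [Field F] [Finite F] (n : ℕ) : Subgroup (GL (Fin n) F) :=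
  unip F (fun i : Fin n => (i : ℕ))

lemma uni_apply_self {u : GL (Fin n) F} (hu : u ∈ uni F n) (i : Fin n) : u.val i i = 1 := by
  rw [hu i i le_rfl, Matrix.one_apply_eq]

lemma uni_apply_lt {u : GL (Fin n) F} (hu : u ∈ uni F n) {i j : Fin n} (h : j < i) :
    u.val i j = 0 := by
  rw [hu i j (Fin.lt_def.1 h).le, Matrix.one_apply_ne h.ne']

lemma superSum_mul {u v : GL (Fin n) F} (hu : u ∈ uni F n) (hv : v ∈ uni F n) :
    superSum (u * v).val = superSum u.val + superSum v.val := by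
  simp only [superSum, ← Finset.sum_add_distrib]
  refine Finset.sum_congr rfl fun i _ => Finset.sum_congr rfl fun j _ => ?_
  split_ifs with h
  · have hij : i ≠ j := by rintro rfl; omega
    rw [Units.val_mul, Matrix.mul_apply, ← Finset.add_sum_erase _ _ (Finset.mem_univ i),
      ← Finset.add_sum_erase _ _ (Finset.mem_erase.2 ⟨hij.symm, Finset.mem_univ j⟩),
      Finset.sum_eq_zero, uni_apply_self hu, uni_apply_self hv]
    · ring
    · intro k hk
      simp only [Finset.mem_erase, Finset.mem_univ, and_true] at hk
      have h1 : (k : ℕ) ≠ i := fun h => hk.2 (Fin.ext h)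
      have h2 : (k : ℕ) ≠ j := fun h => hk.1 (Fin.ext h)
      by_cases h3 : k < i
      · rw [uni_apply_lt hu h3, zero_mul]
      · rw [uni_apply_lt hv (i := k) (j := j) (by rw [Fin.lt_def] at *; omega), mul_zero]
  · simp

/-- The generic character of the unitriangular group attached to an additive character. -/
noncomputable def genChar (ψ : AddChar F ℂ) (n : ℕ) : uni F n →* ℂ where
  toFun u := ψ (superSum u.1.val)
  map_one' := by
    have : superSum (1 : Matrix (Fin n) (Fin n) F) = 0 := by
      refine Finset.sum_eq_zero fun i _ => Finset.sum_eq_zero fun j _ => ?_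
      split_ifs with h
      · rw [Matrix.one_apply_ne]; rintro rfl; omega
      · rfl
    simp [this]
  map_mul' u v := by
    rw [← AddChar.map_add_eq_mul, ← superSum_mul u.2 v.2]; rfl

lemma genChar_apply (ψ : AddChar F ℂ) (u : uni F n) : genChar ψ n u = ψ (superSum u.1.val) := rfl

/-- The idempotent of the Gelfand–Graev representation. -/
noncomputable def gg (ψ : AddChar F ℂ) (n : ℕ) : GA (GL (Fin n) F) := avg (uni F n) (genChar ψ n)

variable {ψ : AddChar F ℂ}

lemma dl_mul_gg {u : GL (Fin n) F} (hu : u ∈ uni F n) :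
    dl u * gg ψ n = ψ (superSum u.val) • gg ψ n :=
  dl_mul_avg (χ := genChar ψ n) ⟨u, hu⟩

lemma gg_mul_dl {u : GL (Fin n) F} (hu : u ∈ uni F n) :
    gg ψ n * dl u = ψ (superSum u.val) • gg ψ n :=
  avg_mul_dl (χ := genChar ψ n) ⟨u, hu⟩

/-- Elementary unipotent matrices. -/
def elem {ι : Type*} [Fintype ι] [DecidableEq ι] {i j : ι} (h : i ≠ j) (a : F) : GL ι F :=
  rankOne (Pi.single i a) (Pi.single j 1) (by simp [h.symm])

omit [Finite F] in
lemma elem_apply {ι : Type*} [Fintype ι] [DecidableEq ι] {i j : ι} (h : i ≠ j) (a : F) (k l : ι) :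
    (elem h a).val k l = (1 : Matrix ι ι F) k l + if k = i ∧ l = j then a else 0 := by
  simp only [elem, rankOne, Matrix.add_apply, vecMulVec_apply, Pi.single_apply]
  split_ifs <;> simp_all

lemma elem_mem_unip {ι : Type*} [Fintype ι] [DecidableEq ι] {i j : ι} (h : i ≠ j) (a : F)
    {β : ι → ℕ} (hβ : β i < β j) : elem h a ∈ unip F β := by
  intro k l hkl
  rw [elem_apply, if_neg, add_zero]
  rintro ⟨rfl, rfl⟩
  omega

lemma mono_mul_elem {ι : Type*} [Fintype ι] [DecidableEq ι] (w : Equiv.Perm ι) (t : ι → Fˣ)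
    {i j : ι} (h : i ≠ j) (a : F) :
    mono w t * elem h a = elem (w.injective.ne h) (t i * a * ((t j)⁻¹ : Fˣ)) * mono w t := by
  ext k l
  obtain ⟨k, rfl⟩ := w.surjective k
  rw [Units.val_mul, Units.val_mul, mono_mul_apply, mul_mono_apply, elem_apply, elem_apply]
  simp only [Matrix.one_apply, w.injective.eq_iff]
  split_ifs with h1 h2 h2
  · exact absurd (h2.1.symm.trans (h1.trans h2.2)) h
  · subst h1; ring
  · rw [h2.1, h2.2]; simp [mul_assoc]
  · ring

lemma superSum_elem {i j : Fin n} (h : i ≠ j) (a : F) :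
    superSum (elem h a).val = if (j : ℕ) = i + 1 then a else 0 := by
  rw [superSum, Finset.sum_eq_single i, Finset.sum_eq_single j]
  · simp [elem_apply, h]
  · intro l _ hl
    simp only [elem_apply, hl, Matrix.one_apply]
    split_ifs with h1 h2 <;> simp_all
  · simp
  · intro k _ hk
    refine Finset.sum_eq_zero fun l _ => ?_
    simp only [elem_apply, hk, Matrix.one_apply]
    split_ifs with h1 h2 <;> simp_all
  · simp

/-- Only monomial matrices attached to good labelled permutations support bi-equivariant
functions. -/
lemma good_of_ne_zero (hψ : ψ ≠ 1) {w : Equiv.Perm (Fin n)} {t : Fin n → Fˣ}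
    (h : gg ψ n * dl (mono w t) * gg ψ n ≠ 0) : Good w t := by
  intro i j hij hw
  have hne : i ≠ j := by rintro rfl; omega
  have key : ∀ a : F, ψ (if (w j : ℕ) = w i + 1 then t i * a * ((t j)⁻¹ : Fˣ) else 0) = ψ a := by
    intro a
    have h1 : gg ψ n * dl (elem (w.injective.ne hne) (t i * a * ((t j)⁻¹ : Fˣ))) *
        dl (mono w t) * gg ψ n = gg ψ n * dl (mono w t) * (dl (elem hne a) * gg ψ n) := by
      rw [mul_assoc (gg ψ n) (dl (elem _ _)), ← dl_mul, ← mono_mul_elem _ _ hne, dl_mul]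
      simp only [mul_assoc]
    rw [gg_mul_dl (elem_mem_unip _ _ hw), dl_mul_gg (elem_mem_unip _ _ (by simp [hij])),
      superSum_elem, superSum_elem, if_pos hij, smul_mul_assoc, smul_mul_assoc, mul_smul_comm] at h1
    exact smul_left_injective ℂ h h1
  have hsucc : (w j : ℕ) = w i + 1 := by
    by_contra hns
    apply hψ
    ext a
    have := key a
    rw [if_neg hns] at this
    rw [← this]; simp
  refine ⟨hsucc, ?_⟩
  by_contra ht
  apply hψ
  ext a
  have hd : (t i : F) * ((t j)⁻¹ : Fˣ) - 1 ≠ 0 := by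
    rw [sub_ne_zero]
    intro h1
    apply ht
    have : t i * (t j)⁻¹ = 1 := Units.ext (by simpa using h1)
    exact mul_inv_eq_one.1 this
  have := key (a / ((t i : F) * ((t j)⁻¹ : Fˣ) - 1))
  rw [if_pos hsucc] at this
  set b := a / ((t i : F) * ((t j)⁻¹ : Fˣ) - 1)
  have hb : t i * b * ((t j)⁻¹ : Fˣ) = a + b := by
    have : b * ((t i : F) * ((t j)⁻¹ : Fˣ) - 1) = a := div_mul_cancel₀ _ hd
    rw [← this]; ring
  rw [hb, AddChar.map_add_eq_mul] at this
  have hb0 : ψ b ≠ 0 := by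
    intro h0
    have := AddChar.map_zero_eq_one ψ
    rw [← add_neg_cancel b, AddChar.map_add_eq_mul, h0, zero_mul] at this
    exact zero_ne_one this
  rw [AddChar.one_apply]
  exact mul_right_cancel₀ hb0 (this.trans (one_mul _).symm)

lemma superSum_conj {w : Equiv.Perm (Fin n)} {t : Fin n → Fˣ} (hg : Good w t)
    {u v : GL (Fin n) F} (hu : u ∈ uni F n) (hv : v ∈ uni F n) (h : u * mono w t = mono w t * v) :
    superSum u.val = superSum v.val := by
  have hent : ∀ i j, u.val (w i) (w j) * t j = t i * v.val i j := by
    intro i j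
    rw [← mul_mono_apply, ← mono_mul_apply, ← Units.val_mul, ← Units.val_mul, h]
  rw [superSum, superSum, ← Equiv.sum_comp w]
  refine Finset.sum_congr rfl fun i _ => ?_
  rw [← Equiv.sum_comp w]
  refine Finset.sum_congr rfl fun j _ => ?_
  have hij := hent i j
  by_cases h1 : (j : ℕ) = i + 1
  · rw [if_pos h1]
    have hne : i ≠ j := by rintro rfl; omega
    rcases lt_or_gt_of_ne (w.injective.ne hne) with h2 | h2
    · obtain ⟨h3, h4⟩ := hg i j h1 h2
      rw [if_pos h3]
      rw [h4, mul_comm] at hij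
      exact mul_left_cancel₀ (Units.ne_zero _) hij
    · rw [uni_apply_lt hu h2, zero_mul] at hij
      rw [if_neg (by rw [Fin.lt_def] at h2; omega)]
      exact ((mul_eq_zero.1 hij.symm).resolve_left (Units.ne_zero _)).symm
  · rw [if_neg h1]
    split_ifs with h2
    · have hlt : j < i := by
        have hne : i ≠ j := by rintro rfl; omega
        rcases lt_or_gt_of_ne hne with h3 | h3
        · exact absurd (hg.succ_of_val_succ h3 h2) h1
        · exact h3
      rw [uni_apply_lt hv hlt, mul_zero] at hij
      exact (mul_eq_zero.1 hij).resolve_right (Units.ne_zero _)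
    · rfl

lemma gg_mono_ne_zero {w : Equiv.Perm (Fin n)} {t : Fin n → Fˣ} (hg : Good w t) :
    gg ψ n * dl (mono w t) * gg ψ n ≠ 0 := by
  set S : Set (GL (Fin n) F) := {g | ∃ v ∈ uni F n, g = mono w t * v} with hS
  have hSr : ∀ h : uni F n, ∀ x, x * (h : GL (Fin n) F) ∈ S ↔ x ∈ S := by
    intro h x
    constructor
    · rintro ⟨v, hv, hx⟩
      exact ⟨v * (h : GL (Fin n) F)⁻¹, mul_mem hv (inv_mem h.2), by
        rw [← mul_assoc, ← hx]; group⟩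
    · rintro ⟨v, hv, rfl⟩
      exact ⟨v * h, mul_mem hv h.2, by rw [mul_assoc]⟩
  have hme : dl (mono w t) * gg ψ n ≠ 0 := by
    intro h0
    have := congrArg (dl (mono w t)⁻¹ * ·) h0
    simp only [← mul_assoc, dl_inv_mul_self, one_mul, mul_zero] at this
    exact avg_ne_zero this
  obtain ⟨c, hc, h⟩ : ∃ c : ℂ, c ≠ 0 ∧
      pr S (gg ψ n * dl (mono w t)) * gg ψ n = c • (dl (mono w t) * gg ψ n) := by
    refine ⟨_, ?_, map_avg (S := {u | u * mono w t ∈ S}) ((LinearMap.mulRight ℂ (gg ψ n)).comp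
      ((pr S).comp (LinearMap.mulRight ℂ (dl (mono w t))))) ?_ ?_⟩
    · have : Nonempty {h : uni F n // (h : GL (Fin n) F) ∈ {u | u * mono w t ∈ S}} :=
        ⟨⟨1, 1, one_mem _, by simp⟩⟩
      exact mul_ne_zero (inv_ne_zero (natCard_ne_zero_subgroup _))
        (by exact_mod_cast Nat.card_pos.ne')
    · intro u hu
      simp only [LinearMap.comp_apply, LinearMap.mulRight_apply, ← dl_mul]
      rw [pr_dl_of_mem (S := S) hu]
      obtain ⟨v, hv, huv⟩ := hu
      rw [huv, dl_mul, mul_assoc, dl_mul_gg hv, mul_smul_comm, genChar_apply,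
        superSum_conj hg u.2 hv huv]
    · intro u hu
      simp only [LinearMap.comp_apply, LinearMap.mulRight_apply, ← dl_mul]
      rw [pr_dl_of_notMem (S := S) hu, zero_mul]
  intro h0
  have h1 : pr S (gg ψ n * dl (mono w t) * gg ψ n) = pr S (gg ψ n * dl (mono w t)) * gg ψ n :=
    pr_mul_avg_comm hSr _
  rw [h0, map_zero, h] at h1
  exact smul_ne_zero hc hme h1.symm

lemma mono_unique {w w' : Equiv.Perm (Fin n)} {t t' : Fin n → Fˣ} {u v : GL (Fin n) F}
    (hu : u ∈ uni F n) (hv : v ∈ uni F n) (h : u * mono w t * v = mono w' t') :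
    w = w' ∧ t = t' := by
  have hu' := inv_mem hu
  have h1 : u⁻¹ * mono w' t' = mono w t * v := by rw [← h]; group
  have hent : ∀ j, (u⁻¹).val (w j) (w' j) * t' j = t j := by
    intro j
    rw [← mul_mono_apply, ← Units.val_mul, h1, Units.val_mul, mono_mul_apply, uni_apply_self hv,
      mul_one]
  have hle : ∀ j, w j ≤ w' j := by
    intro j
    by_contra hlt
    have := hent j
    rw [uni_apply_lt hu' (not_le.1 hlt), zero_mul] at this
    exact Units.ne_zero _ this.symm
  have hsum : ∑ j, (w j : ℕ) = ∑ j, (w' j : ℕ) := by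
    rw [Equiv.sum_comp w (fun i => (i : ℕ)), Equiv.sum_comp w' (fun i => (i : ℕ))]
  have heq := (Finset.sum_eq_sum_iff_of_le (fun j _ => Fin.le_def.1 (hle j))).1 hsum
  have hw : w = w' := Equiv.ext fun j => Fin.ext (heq j (Finset.mem_univ j))
  refine ⟨hw, funext fun j => Units.ext ?_⟩
  have := hent j
  rw [hw, uni_apply_self hu', one_mul] at this
  exact this.symm

/-- Basis elements of the Gelfand–Graev Hecke algebra. -/
noncomputable def ggBasis (ψ : AddChar F ℂ) (n : ℕ)
    (p : {p : Equiv.Perm (Fin n) × (Fin n → Fˣ) // Good p.1 p.2}) : GA (GL (Fin n) F) :=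
  gg ψ n * dl (mono p.1.1 p.1.2) * gg ψ n

lemma gg_mul_self : gg ψ n * gg ψ n = gg ψ n := avg_mul_avg

lemma linearIndependent_ggBasis : LinearIndependent ℂ (ggBasis ψ n) := by
  classical
  have := Fintype.ofFinite {p : Equiv.Perm (Fin n) × (Fin n → Fˣ) // Good p.1 p.2}
  rw [Fintype.linearIndependent_iff]
  intro g hg p
  set S : Set (GL (Fin n) F) :=
    {x | ∃ u ∈ uni F n, ∃ v ∈ uni F n, x = u * mono p.1.1 p.1.2 * v} with hS
  have hSr : ∀ h : uni F n, ∀ x, x * (h : GL (Fin n) F) ∈ S ↔ x ∈ S := by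
    intro h x
    constructor
    · rintro ⟨u, hu, v, hv, hx⟩
      exact ⟨u, hu, v * (h : GL (Fin n) F)⁻¹, mul_mem hv (inv_mem h.2), by
        rw [← mul_assoc, ← hx]; group⟩
    · rintro ⟨u, hu, v, hv, rfl⟩
      exact ⟨u, hu, v * h, mul_mem hv h.2, by group⟩
  have hSl : ∀ h : uni F n, ∀ x, (h : GL (Fin n) F) * x ∈ S ↔ x ∈ S := by
    intro h x
    constructor
    · rintro ⟨u, hu, v, hv, hx⟩
      exact ⟨(h : GL (Fin n) F)⁻¹ * u, mul_mem (inv_mem h.2) hu, v, hv, by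
        rw [mul_assoc, mul_assoc, ← mul_assoc u, ← hx]; group⟩
    · rintro ⟨u, hu, v, hv, rfl⟩
      exact ⟨h * u, mul_mem h.2 hu, v, hv, by group⟩
  have hpr : ∀ x, pr S (gg ψ n * x * gg ψ n) = gg ψ n * pr S x * gg ψ n := by
    intro x
    rw [gg, pr_mul_avg_comm hSr, pr_avg_mul_comm hSl]
  have h1 := congrArg (pr S) hg
  rw [map_sum, map_zero, Finset.sum_eq_single p] at h1
  · rw [map_smul, ggBasis, hpr, pr_dl_of_mem (S := S) ⟨1, one_mem _, 1, one_mem _, by simp⟩] at h1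
    exact (smul_eq_zero.1 h1).resolve_right (gg_mono_ne_zero p.2)
  · intro p' _ hp'
    rw [map_smul, ggBasis, hpr, pr_dl_of_notMem (S := S), mul_zero, zero_mul, smul_zero]
    rintro ⟨u, hu, v, hv, h⟩
    obtain ⟨h1, h2⟩ := mono_unique hu hv h.symm
    exact hp' (Subtype.ext (Prod.ext h1.symm h2.symm))
  · simp

lemma span_ggBasis (hψ : ψ ≠ 1) :
    Submodule.span ℂ (Set.range (ggBasis ψ n)) = cornerSubmodule (gg ψ n) := by
  apply le_antisymm
  · rw [Submodule.span_le]
    rintro _ ⟨p, rfl⟩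
    exact mem_cornerSubmodule.2 ⟨_, rfl⟩
  · intro x hx
    obtain ⟨y, rfl⟩ := mem_cornerSubmodule.1 hx
    refine sandwich_mem _ _ _ (fun g => ?_) y
    have hinj : Function.Injective fun i : Fin n => (i : ℕ) := Fin.val_injective
    obtain ⟨u, hu, v, hv, w, t, rfl⟩ := bruhat hinj hinj g
    rw [dl_mul, dl_mul]
    have : gg ψ n * (dl u * dl (mono w t) * dl v) * gg ψ n =
        (gg ψ n * dl u) * dl (mono w t) * (dl v * gg ψ n) := by simp only [mul_assoc]
    rw [this, gg_mul_dl hu, dl_mul_gg hv, smul_mul_assoc, smul_mul_assoc, mul_smul_comm]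
    refine Submodule.smul_mem _ _ (Submodule.smul_mem _ _ ?_)
    by_cases h : gg ψ n * dl (mono w t) * gg ψ n = 0
    · rw [h]; exact Submodule.zero_mem _
    · exact Submodule.subset_span ⟨⟨(w, t), good_of_ne_zero hψ h⟩, rfl⟩

/-- Reflection in the antidiagonal. -/
def flip (g : GL (Fin n) F) : GL (Fin n) F where
  val := (g.val.submatrix Fin.rev Fin.rev)ᵀ
  inv := ((g⁻¹).val.submatrix Fin.rev Fin.rev)ᵀ
  val_inv := by
    rw [← Matrix.transpose_mul, ← Matrix.submatrix_mul _ _ _ _ _ Fin.rev_bijective,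
      val_inv_mul_val]
    ext i j; simp [Matrix.one_apply, eq_comm]
  inv_val := by
    rw [← Matrix.transpose_mul, ← Matrix.submatrix_mul _ _ _ _ _ Fin.rev_bijective,
      val_mul_val_inv]
    ext i j; simp [Matrix.one_apply, eq_comm]

omit [Finite F] in
lemma flip_apply (g : GL (Fin n) F) (i j : Fin n) :
    (flip g).val i j = g.val (Fin.rev j) (Fin.rev i) := rfl

omit [Finite F] in
lemma flip_mul (g h : GL (Fin n) F) : flip (g * h) = flip h * flip g := by
  apply Units.ext
  change ((g.val * h.val).submatrix Fin.rev Fin.rev)ᵀ = _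
  rw [Matrix.submatrix_mul _ _ _ _ _ Fin.rev_bijective, Matrix.transpose_mul]
  rfl

omit [Finite F] in
lemma flip_flip (g : GL (Fin n) F) : flip (flip g) = g := by
  ext i j; simp [flip_apply]

lemma flip_mem_uni {u : GL (Fin n) F} (hu : u ∈ uni F n) : flip u ∈ uni F n := by
  intro i j hij
  rw [flip_apply, hu _ _ (by simp only [Fin.val_rev]; simp only at hij; omega)]
  simp [Matrix.one_apply, eq_comm]

omit [Finite F] in
lemma superSum_flip (u : GL (Fin n) F) : superSum (flip u).val = superSum u.val := by
  rw [superSum, superSum, Finset.sum_comm, ← Equiv.sum_comp Fin.revPerm]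
  refine Finset.sum_congr rfl fun i _ => ?_
  rw [← Equiv.sum_comp Fin.revPerm]
  refine Finset.sum_congr rfl fun j _ => ?_
  simp only [flip_apply, Fin.revPerm_apply, Fin.rev_rev, Fin.val_rev]
  congr 1
  simp only [eq_iff_iff]
  omega

/-- The anti-automorphism of the group algebra induced by `flip`. -/
noncomputable def flipAlg (n : ℕ) : GA (GL (Fin n) F) →ₗ[ℂ] GA (GL (Fin n) F) :=
  lin fun g => dl (flip g)

omit [Finite F] in
lemma flipAlg_dl (g : GL (Fin n) F) : flipAlg n (dl g) = dl (flip g) := lin_dl _ _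

omit [Finite F] in
lemma flipAlg_mul (x y : GA (GL (Fin n) F)) : flipAlg n (x * y) = flipAlg n y * flipAlg n x :=
  lin_anti_mul _ flip_mul x y

omit [Finite F] in
lemma flipAlg_flipAlg (x : GA (GL (Fin n) F)) : flipAlg n (flipAlg n x) = x :=
  lin_ext (f := (flipAlg n).comp (flipAlg n)) (f' := LinearMap.id)
    (fun g => by simp [flipAlg_dl, flip_flip]) x

lemma flipAlg_gg : flipAlg n (gg ψ n) = gg ψ n := by
  have h1 : gg ψ n * flipAlg n (gg ψ n) = flipAlg n (gg ψ n) := by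
    refine avg_mul_eq fun u => ?_
    have h2 : dl (u : GL (Fin n) F) = flipAlg n (dl (flip u.1)) := by
      rw [flipAlg_dl, flip_flip]
    rw [h2, ← flipAlg_mul, gg_mul_dl (flip_mem_uni u.2), map_smul, superSum_flip, genChar_apply]
  have h3 := congrArg (flipAlg n) h1
  rw [flipAlg_mul, flipAlg_flipAlg, h1] at h3
  exact h3

omit [Finite F] in
lemma flip_mono {w : Equiv.Perm (Fin n)} {t : Fin n → Fˣ} (hg : Good w t) :
    flip (mono w t) = mono w t := by
  ext i j
  rw [flip_apply, mono_apply, mono_apply]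
  have h1 := hg.rev_rev j
  by_cases h : i = w j
  · have : Fin.rev j = w (Fin.rev i) := by rw [h, ← Fin.rev_inj, Fin.rev_rev, h1.1]
    rw [if_pos this, if_pos h, h, h1.2]
  · rw [if_neg h, if_neg]
    intro h2
    apply h
    have h3 := (hg.rev_rev (Fin.rev i)).1
    rw [← h2, Fin.rev_rev] at h3
    exact (Fin.rev_injective h3).symm

lemma flipAlg_corner (hψ : ψ ≠ 1) {x : GA (GL (Fin n) F)} (hx : x ∈ cornerSubmodule (gg ψ n)) :
    flipAlg n x = x := by
  rw [← span_ggBasis hψ] at hx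
  induction hx using Submodule.span_induction with
  | mem x hx =>
    obtain ⟨p, rfl⟩ := hx
    rw [ggBasis, flipAlg_mul, flipAlg_mul, flipAlg_gg, flipAlg_dl, flip_mono p.2, mul_assoc]
  | zero => simp
  | add x y _ _ hx hy => rw [map_add, hx, hy]
  | smul c x _ hx => rw [map_smul, hx]

/-- The Gelfand–Graev representation is multiplicity free. -/
lemma isGelfand_gg (hψ : ψ ≠ 1) : IsGelfand (gg ψ n) where
  idem := avg_mul_avg
  adj_eq := adj_avg
  comm x y := by
    have hx := flipAlg_corner hψ (mem_cornerSubmodule.2 ⟨x, rfl⟩)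
    have hy := flipAlg_corner hψ (mem_cornerSubmodule.2 ⟨y, rfl⟩)
    have hxy := flipAlg_corner hψ (x := (gg ψ n * x * gg ψ n) * (gg ψ n * y * gg ψ n))
      (mem_cornerSubmodule.2 ⟨x * gg ψ n * gg ψ n * y, by simp only [mul_assoc]⟩)
    rw [← hxy, flipAlg_mul, hx, hy]

lemma card_isMin_gg (hψ : ψ ≠ 1) (m : ℕ) :
    Nat.card {z // IsMin (gg ψ (m + 1)) z} = (Nat.card F - 1) * Nat.card F ^ m := by
  classical
  have := Fintype.ofFinite F
  have := Fintype.ofFinite {p : Equiv.Perm (Fin (m + 1)) × (Fin (m + 1) → Fˣ) // Good p.1 p.2}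
  rw [card_isMin (isGelfand_gg hψ), ← span_ggBasis hψ, finrank_span_eq_card
    linearIndependent_ggBasis, ← Nat.card_eq_fintype_card, natCard_good, Fintype.card_units,
    Nat.card_eq_fintype_card, Nat.sub_add_cancel Fintype.card_pos]

lemma card_isMin_gg_zero (hψ : ψ ≠ 1) : Nat.card {z // IsMin (gg (F := F) ψ 0) z} = 1 := by
  classical
  have := Fintype.ofFinite {p : Equiv.Perm (Fin 0) × (Fin 0 → Fˣ) // Good p.1 p.2}
  rw [card_isMin (isGelfand_gg hψ), ← span_ggBasis hψ, finrank_span_eq_card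
    linearIndependent_ggBasis, Fintype.card_eq_one_iff]
  exact ⟨⟨1, fun i => i.elim0⟩, fun p => Subsingleton.elim _ _⟩

end Generic

end GelfandGraev

namespace GelfandGraev

open Matrix

section Restriction

variable {G G' : Type*} [Group G] [Group G']

lemma pr_gmap_mul {f : G' →* G} {S : Set G} (h : ∀ g x, f g * x ∈ S ↔ x ∈ S) (y : GA G')
    (x : GA G) : pr S (gmap f y * x) = gmap f y * pr S x :=
  lin_ext (f := (pr S).comp ((LinearMap.mulRight ℂ x).comp (gmap f).toLinearMap))
    (f' := (LinearMap.mulRight ℂ (pr S x)).comp (gmap f).toLinearMap)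
    (fun g => by simp only [LinearMap.comp_apply, LinearMap.mulRight_apply,
      AlgHom.toLinearMap_apply, gmap_dl]; exact pr_dl_mul (h g) x) y

lemma pr_mul_gmap {f : G' →* G} {S : Set G} (h : ∀ g x, x * f g ∈ S ↔ x ∈ S) (y : GA G')
    (x : GA G) : pr S (x * gmap f y) = pr S x * gmap f y :=
  lin_ext (f := (pr S).comp ((LinearMap.mulLeft ℂ x).comp (gmap f).toLinearMap))
    (f' := (LinearMap.mulLeft ℂ (pr S x)).comp (gmap f).toLinearMap)
    (fun g => by simp only [LinearMap.comp_apply, LinearMap.mulLeft_apply,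
      AlgHom.toLinearMap_apply, gmap_dl]; exact pr_mul_dl (h g) x) y

/-- Products of nonzero elements supported on independent subgroups are nonzero. -/
lemma gmap_mul_gmap_ne_zero {G'' : Type*} [Group G''] {f : G' →* G} {f' : G'' →* G}
    (hf : Function.Injective f) (h : ∀ a b, f a = f' b → b = 1) {x : GA G'} {y : GA G''}
    (hx : x ≠ 0) (hy : y ≠ 0) : gmap f x * gmap f' y ≠ 0 := by
  obtain ⟨g, hg⟩ : ∃ g, y.coeff g ≠ 0 := by
    by_contra! hc
    apply hy
    ext g
    simpa using hc g
  intro h0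
  have h1 : gmap f x * gmap f' (y * dl g⁻¹) = 0 := by
    rw [map_mul, ← mul_assoc, h0, zero_mul]
  have h2 : pr (Set.range f) (gmap f' (y * dl g⁻¹)) = y.coeff g • (1 : GA G) := by
    refine dl_induction (p := fun y => pr (Set.range f) (gmap f' (y * dl g⁻¹)) =
      y.coeff g • (1 : GA G)) ?_ ?_ ?_ ?_ y
    · simp
    · intro k
      rw [← dl_mul, gmap_dl]
      by_cases hk : k = g
      · subst hk
        rw [mul_inv_cancel, map_one, pr_dl_of_mem (S := Set.range f) ⟨1, map_one _⟩]
        simp [dl]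
        rfl
      · rw [pr_dl_of_notMem]
        · simp [dl, hk]
        · rintro ⟨a, ha⟩
          exact hk (mul_inv_eq_one.1 (h _ _ ha))
    · intro a b ha hb; simp only [add_mul, map_add, ha, hb, MonoidAlgebra.coeff_add,
        Finsupp.add_apply, add_smul]
    · intro c a ha; simp only [smul_mul_assoc, map_smul, ha, MonoidAlgebra.coeff_smul,
        Finsupp.smul_apply, smul_eq_mul, mul_smul]
  have h3 : pr (Set.range f) (gmap f x * gmap f' (y * dl g⁻¹)) =
      gmap f x * pr (Set.range f) (gmap f' (y * dl g⁻¹)) :=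
    pr_gmap_mul (fun g x => by
      have := f.range.mul_mem_cancel_left (x := f g) (y := x) ⟨g, rfl⟩
      simpa using this) _ _
  rw [h1, map_zero, h2, mul_smul_comm, mul_one] at h3
  have h4 := (smul_eq_zero.1 h3.symm).resolve_left hg
  exact hx (gmap_injective hf (by rw [h4, map_zero]))

end Restriction

section Radical

variable {ι : Type*} [Fintype ι] [DecidableEq ι] {F : Type*} [Field F] [Finite F]

/-- The idempotent of the trivial character of the unipotent radical. -/
noncomputable def rad (F : Type*) [Field F] [Finite F] (β : ι → ℕ) : GA (GL ι F) :=
  avg (unip F β) 1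

variable {β γ : ι → ℕ}

lemma dl_mul_rad {u : GL ι F} (hu : u ∈ unip F β) : dl u * rad F β = rad F β :=
  (dl_mul_avg (χ := 1) ⟨u, hu⟩).trans (one_smul _ _)

lemma rad_mul_dl {u : GL ι F} (hu : u ∈ unip F β) : rad F β * dl u = rad F β :=
  (avg_mul_dl (χ := 1) ⟨u, hu⟩).trans (one_smul _ _)

lemma rad_mul_eq {x : GA (GL ι F)} (h : ∀ u ∈ unip F β, dl u * x = x) : rad F β * x = x :=
  avg_mul_eq fun u => (h u u.2).trans (one_smul _ _).symm

lemma mul_rad_eq {x : GA (GL ι F)} (h : ∀ u ∈ unip F β, x * dl u = x) : x * rad F β = x :=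
  mul_avg_eq fun u => (h u u.2).trans (one_smul _ _).symm

lemma rad_mul_self : rad F β * rad F β = rad F β := avg_mul_avg

lemma adj_rad : adj (rad F β) = rad F β := adj_avg

lemma rad_mul_rad_of_le (h : unip F β ≤ unip F γ) : rad F β * rad F γ = rad F γ :=
  rad_mul_eq fun _ hu => dl_mul_rad (h hu)

lemma rad_mul_rad_of_le' (h : unip F β ≤ unip F γ) : rad F γ * rad F β = rad F γ :=
  mul_rad_eq fun _ hu => rad_mul_dl (h hu)

lemma dl_levi_mul_rad {l : GL ι F} (hl : l ∈ levi F β) : dl l * rad F β = rad F β * dl l := by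
  refine dl_mul_avg_of_normalizes (fun u => ⟨⟨_, levi_conj_unip hl u.2⟩, rfl, rfl⟩)
    (fun u => ⟨⟨l⁻¹ * u * l, ?_⟩, ?_, rfl⟩)
  · simpa using levi_conj_unip (inv_mem hl) u.2
  · simp [mul_assoc]

lemma dl_para_mul_rad {p : GL ι F} (hp : p ∈ para F β) :
    ∃ l ∈ levi F β, p * l⁻¹ ∈ unip F β ∧ rad F β * dl p = rad F β * dl l ∧
      dl p * rad F β = dl l * rad F β := by
  obtain ⟨l, hl, u, hu, rfl⟩ := exists_levi_mul_unip hp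
  refine ⟨l, hl, levi_conj_unip hl hu, ?_, ?_⟩
  · rw [dl_mul, ← mul_assoc, ← dl_levi_mul_rad hl, mul_assoc, rad_mul_dl hu]
  · rw [dl_mul, mul_assoc, dl_mul_rad hu]

omit [Finite F] in
lemma mono_mul_val_mul_inv (w : Equiv.Perm ι) (t : ι → Fˣ) (g : GL ι F) (i j : ι) :
    (mono w t * g * (mono w t)⁻¹).val (w i) (w j) = t i * g.val i j * ((t j)⁻¹ : Fˣ) := by
  have h : (mono w t * g * (mono w t)⁻¹) * mono w t = mono w t * g := by group
  have h1 := congrArg (fun x : GL ι F => x.val (w i) j) h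
  simp only [Units.val_mul] at h1
  rw [mul_mono_apply, mono_mul_apply] at h1
  rw [← h1, Units.val_mul, Units.val_mul]
  simp

lemma mono_conj_mem_unip (w : Equiv.Perm ι) (t : ι → Fˣ) {u : GL ι F} (hu : u ∈ unip F (β ∘ w)) :
    mono w t * u * (mono w t)⁻¹ ∈ unip F β := by
  intro i j hij
  obtain ⟨i, rfl⟩ := w.surjective i
  obtain ⟨j, rfl⟩ := w.surjective j
  rw [mono_mul_val_mul_inv, hu i j hij]
  by_cases h : i = j
  · subst h; simp
  · simp [h]

omit [Finite F] in
lemma exists_mono_inv (w : Equiv.Perm ι) (t : ι → Fˣ) :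
    ∃ t', (mono w t)⁻¹ = mono w⁻¹ t' := by
  refine ⟨fun i => (t (w.symm i))⁻¹, ?_⟩
  rw [inv_eq_iff_mul_eq_one]
  ext i j
  obtain ⟨i, rfl⟩ := w.surjective i
  rw [Units.val_mul, mono_mul_apply, mono_apply]
  by_cases h : w i = j
  · subst h; simp
  · have : ¬ i = w⁻¹ j := fun h' => h (by simp [h'])
    rw [if_neg this, mul_zero, Units.val_one, Matrix.one_apply_ne h]

lemma dl_mono_mul_rad (w : Equiv.Perm ι) (t : ι → Fˣ) :
    dl (mono w t) * rad F (β ∘ w) = rad F β * dl (mono w t) := by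
  refine dl_mul_avg_of_normalizes (fun u => ⟨⟨_, mono_conj_mem_unip w t u.2⟩, rfl, rfl⟩)
    (fun u => ⟨⟨(mono w t)⁻¹ * u * mono w t, ?_⟩, ?_, rfl⟩)
  · obtain ⟨t', ht⟩ := exists_mono_inv w t
    have : (mono w t)⁻¹ * u * mono w t = mono w⁻¹ t' * u * (mono w⁻¹ t')⁻¹ := by
      rw [← ht, inv_inv]
    rw [this]
    apply mono_conj_mem_unip
    have h2 : (β ∘ w) ∘ ⇑w⁻¹ = β := by ext i; simp
    rw [h2]
    exact u.2
  · simp [mul_assoc]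

variable {α : Type*} [Fintype α] [DecidableEq α]

lemma exists_eq_emb {φ : α ↪ ι} {l : GL ι F}
    (h : ∀ i j, ((∀ a, φ a ≠ i) ∨ (∀ a, φ a ≠ j)) → l.val i j = (1 : Matrix ι ι F) i j) :
    ∃ g, l = emb φ g := by
  classical
  let δ : ι → ℕ := fun i => if ∃ a, φ a = i then 1 else 0
  have hδ : ∀ i, δ i = 1 ↔ ∃ a, φ a = i := by intro i; simp [δ]
  have hl : l ∈ levi F δ := by
    intro i j hij
    have hne : i ≠ j := by rintro rfl; exact hij rfl
    rw [h i j, Matrix.one_apply_ne hne]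
    by_contra! hc
    exact hij (((hδ i).2 hc.1).trans ((hδ j).2 hc.2).symm)
  obtain ⟨g, r, -, h1, h2, h3⟩ := exists_block_of_mem_levi hδ hl
  refine ⟨g, ?_⟩
  have hr : r = l * emb φ g⁻¹ := by rw [h1, map_inv]; group
  have : r = 1 := by
    ext i j
    by_cases hi : ∃ a, φ a = i
    · obtain ⟨a, rfl⟩ := hi
      exact h2 a j
    · push Not at hi
      rw [hr, Units.val_mul, Matrix.mul_apply, Finset.sum_eq_single i]
      · rw [h i i (Or.inl hi), Matrix.one_apply_eq, one_mul, emb_apply_of_notMem_left _ _ hi]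
        rfl
      · intro k _ hk
        rw [h i k (Or.inl hi), Matrix.one_apply_ne hk.symm, zero_mul]
      · simp
  rw [h1, this, one_mul]

lemma rad_comm_gmap {φ : α ↪ ι} (h : ∀ a b, β (φ a) = β (φ b)) (x : GA (GL α F)) :
    gmap (emb φ) x * rad F β = rad F β * gmap (emb φ) x :=
  commute_gmap_left (fun g => dl_levi_mul_rad (emb_mem_levi h g)) x

/-- Transitivity of unipotent radicals. -/
lemma rad_mul_gmap_rad {φ : α ↪ ι} {δ : α → ℕ}
    (h1 : ∀ i j, γ j ≤ γ i → β j ≤ β i) (h2 : ∀ a b, δ a ≤ δ b ↔ γ (φ a) ≤ γ (φ b))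
    (h3 : ∀ i j, β i = β j → γ i < γ j → (∃ a, φ a = i) ∧ ∃ b, φ b = j) :
    rad F β * gmap (emb φ) (rad F δ) = rad F γ := by
  have hle : unip F β ≤ unip F γ := unip_mono h1
  have hδ : ∀ g ∈ unip F δ, emb φ g ∈ unip F γ := fun g hg =>
    emb_mem_unip fun a b hab => hg a b ((h2 _ _).2 hab)
  have e1 : rad F γ * (rad F β * gmap (emb φ) (rad F δ)) = rad F γ := by
    rw [← mul_assoc, rad_mul_rad_of_le' hle]
    exact map_avg_eq ((LinearMap.mulLeft ℂ (rad F γ)).comp (gmap (emb φ)).toLinearMap)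
      (χ := (1 : unip F δ →* ℂ)) (fun u => by
        simp only [LinearMap.comp_apply, AlgHom.toLinearMap_apply, gmap_dl,
          LinearMap.mulLeft_apply, MonoidHom.one_apply, one_smul]
        exact rad_mul_dl (hδ u u.2))
  rw [← e1]
  symm
  apply rad_mul_eq
  intro u hu
  have hup : u ∈ para F β := by
    intro i j hij
    rw [hu i j (by by_contra hc; exact absurd (h1 j i (by omega)) (by omega)),
      Matrix.one_apply_ne]
    rintro rfl; exact lt_irrefl _ hij
  obtain ⟨l, hl, hul, -, -⟩ := dl_para_mul_rad hup
  have hlu : l ∈ unip F γ := by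
    have : l = (u * l⁻¹)⁻¹ * u := by group
    rw [this]
    exact mul_mem (inv_mem (hle hul)) hu
  obtain ⟨g, hg⟩ : ∃ g, l = emb φ g := by
    apply exists_eq_emb
    intro i j hij
    by_cases hb : β i = β j
    · by_cases hc : γ i < γ j
      · obtain ⟨⟨a, ha⟩, ⟨b, hb⟩⟩ := h3 i j hb hc
        rcases hij with h | h
        · exact absurd ha (h a)
        · exact absurd hb (h b)
      · exact hlu i j (not_lt.1 hc)
    · rw [hl i j hb, Matrix.one_apply_ne]
      rintro rfl; exact hb rfl
  have hgδ : g ∈ unip F δ := by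
    intro a b hab
    have := hlu (φ a) (φ b) ((h2 _ _).1 hab)
    rw [hg, emb_apply_apply] at this
    rw [this]; simp [Matrix.one_apply]
  have hu' : u = (u * l⁻¹) * l := by group
  rw [hu', dl_mul, mul_assoc (dl _), ← mul_assoc (dl l), dl_levi_mul_rad hl, mul_assoc (rad F β),
    ← mul_assoc (dl (u * l⁻¹)), dl_mul_rad hul, hg, ← gmap_dl, ← map_mul, dl_mul_rad hgδ]

end Radical

end GelfandGraev

namespace GelfandGraev

open Matrix

section Blocks

variable {F : Type*} [Field F] [Finite F] {ψ : AddChar F ℂ} {a b n : ℕ}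

/-- The inclusion of the first block. -/
def lo (h : a + b = n) : Fin a ↪ Fin n :=
  ⟨fun i => ⟨i, by omega⟩, fun i j hij => Fin.ext (by simpa using hij)⟩

/-- The inclusion of the last block. -/
def hi (h : a + b = n) : Fin b ↪ Fin n :=
  ⟨fun i => ⟨a + i, by omega⟩, fun i j hij => Fin.ext (by simpa using hij)⟩

@[simp] lemma val_lo (h : a + b = n) (i : Fin a) : (lo h i : ℕ) = i := rfl

@[simp] lemma val_hi (h : a + b = n) (i : Fin b) : (hi h i : ℕ) = a + i := rfl

/-- The labelling of positions defining the lower triangular maximal parabolic. -/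
def bl (n a : ℕ) : Fin n → ℕ := fun i => if (i : ℕ) < a then 1 else 0

@[simp] lemma bl_lo (h : a + b = n) (i : Fin a) : bl n a (lo h i) = 1 := by simp [bl]

@[simp] lemma bl_hi (h : a + b = n) (i : Fin b) : bl n a (hi h i) = 0 := by simp [bl]

lemma bl_eq_one_iff (h : a + b = n) (i : Fin n) : bl n a i = 1 ↔ ∃ k, lo h k = i := by
  constructor
  · intro hi
    have : (i : ℕ) < a := by by_contra hc; simp [bl, hc] at hi
    exact ⟨⟨i, this⟩, rfl⟩
  · rintro ⟨k, rfl⟩; simp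

lemma bl_eq_zero_iff (h : a + b = n) (i : Fin n) : bl n a i = 0 ↔ ∃ k, hi h k = i := by
  constructor
  · intro hi
    have : ¬ (i : ℕ) < a := by intro hc; simp [bl, hc] at hi
    exact ⟨⟨i - a, by omega⟩, Fin.ext (by simp; omega)⟩
  · rintro ⟨k, rfl⟩; simp

lemma lo_ne_hi (h : a + b = n) (i : Fin a) (j : Fin b) : lo h i ≠ hi h j := by
  intro hc
  have := congrArg Fin.val hc
  simp at this
  omega

lemma lo_or_hi (h : a + b = n) (i : Fin n) : (∃ k, lo h k = i) ∨ ∃ k, hi h k = i := by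
  rw [← bl_eq_one_iff, ← bl_eq_zero_iff h]
  unfold bl
  split_ifs <;> simp

lemma exists_lo_hi (h : a + b = n) {l : GL (Fin n) F} (hl : l ∈ levi F (bl n a)) :
    ∃ l₁ l₂, l = emb (lo h) l₁ * emb (hi h) l₂ := by
  obtain ⟨l₁, r, hr, h1, h2, h3⟩ := exists_block_of_mem_levi (bl_eq_one_iff h) hl
  obtain ⟨l₂, hl₂⟩ : ∃ g, r = emb (hi h) g := by
    apply exists_eq_emb
    intro i j hij
    rcases hij with hij | hij
    · obtain ⟨k, rfl⟩ := (lo_or_hi h i).resolve_right (fun ⟨k, hk⟩ => hij k hk)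
      exact h2 k j
    · obtain ⟨k, rfl⟩ := (lo_or_hi h j).resolve_right (fun ⟨k, hk⟩ => hij k hk)
      exact h3 i k
  exact ⟨l₁, l₂, by
    rw [h1, hl₂, emb_commute (fun i j => (lo_ne_hi h j i).symm)]⟩

omit [Finite F] in
lemma superSum_emb {φ : Fin a ↪ Fin n} {c : ℕ} (hφ : ∀ i, (φ i : ℕ) = c + i) (u : GL (Fin a) F) :
    superSum (emb φ u).val = superSum u.val := by
  symm
  refine Fintype.sum_of_injective φ φ.injective _ _ (fun i hi => ?_) (fun i => ?_)
  · refine Finset.sum_eq_zero fun j _ => ?_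
    split_ifs with h
    · rw [emb_apply_of_notMem_left _ _ (fun k hk => hi ⟨k, hk⟩), Matrix.one_apply_ne]
      rintro rfl; omega
    · rfl
  · refine Fintype.sum_of_injective φ φ.injective _ _ (fun j hj => ?_) (fun j => ?_)
    · split_ifs with h
      · rw [emb_apply_of_notMem_right _ _ _ (fun k hk => hj ⟨k, hk⟩), Matrix.one_apply_ne]
        rintro rfl; omega
      · rfl
    · rw [emb_apply_apply]
      congr 1
      rw [hφ, hφ, eq_iff_iff]
      omega

lemma emb_mem_uni {φ : Fin a ↪ Fin n} {c : ℕ} (hφ : ∀ i, (φ i : ℕ) = c + i) {u : GL (Fin a) F}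
    (hu : u ∈ uni F a) : emb φ u ∈ uni F n :=
  emb_mem_unip fun i j hij => hu i j (by
    have hij' : (φ j : ℕ) ≤ φ i := hij
    rw [hφ, hφ] at hij'
    change (j : ℕ) ≤ i
    omega)

lemma lo_shift (h : a + b = n) (i : Fin a) : (lo h i : ℕ) = 0 + i := by simp

lemma gmap_gg_mul_gg {φ : Fin a ↪ Fin n} {c : ℕ} (hφ : ∀ i, (φ i : ℕ) = c + i) :
    gmap (emb φ) (gg ψ a) * gg ψ n = gg ψ n := by
  refine map_avg_eq ((LinearMap.mulRight ℂ (gg ψ n)).comp (gmap (emb φ)).toLinearMap)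
    fun u => ?_
  simp only [LinearMap.comp_apply, AlgHom.toLinearMap_apply, gmap_dl, LinearMap.mulRight_apply]
  rw [dl_mul_gg (emb_mem_uni hφ u.2), superSum_emb hφ, genChar_apply]

/-- The inducing element for a parabolic product. -/
noncomputable def pre (h : a + b = n) (x : GA (GL (Fin a) F)) (y : GA (GL (Fin b) F)) :
    GA (GL (Fin n) F) :=
  rad F (bl n a) * gmap (emb (lo h)) x * gmap (emb (hi h)) y

omit [Finite F] in
lemma lo_commute_hi (h : a + b = n) (x : GA (GL (Fin a) F)) (y : GA (GL (Fin b) F)) :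
    gmap (emb (lo h)) x * gmap (emb (hi h)) y = gmap (emb (hi h)) y * gmap (emb (lo h)) x :=
  commute_gmap (emb_commute (lo_ne_hi h)) x y

lemma lo_comm_rad (h : a + b = n) (x : GA (GL (Fin a) F)) :
    gmap (emb (lo h)) x * rad F (bl n a) = rad F (bl n a) * gmap (emb (lo h)) x :=
  rad_comm_gmap (by simp) x

lemma hi_comm_rad (h : a + b = n) (x : GA (GL (Fin b) F)) :
    gmap (emb (hi h)) x * rad F (bl n a) = rad F (bl n a) * gmap (emb (hi h)) x :=
  rad_comm_gmap (by simp) x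

lemma pre_mul_pre (h : a + b = n) (x x' : GA (GL (Fin a) F)) (y y' : GA (GL (Fin b) F)) :
    pre h x y * pre h x' y' = pre h (x * x') (y * y') := by
  have e1 : pre h x y * pre h x' y' = rad F (bl n a) * gmap (emb (lo h)) x *
      (gmap (emb (hi h)) y * rad F (bl n a)) * gmap (emb (lo h)) x' *
        gmap (emb (hi h)) y' := by simp only [pre, mul_assoc]
  have e2 : rad F (bl n a) * gmap (emb (lo h)) x *
      (gmap (emb (hi h)) y * rad F (bl n a)) * gmap (emb (lo h)) x' *
        gmap (emb (hi h)) y' = rad F (bl n a) * (gmap (emb (lo h)) x * rad F (bl n a)) *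
        (gmap (emb (hi h)) y * gmap (emb (lo h)) x') * gmap (emb (hi h)) y' := by
    rw [hi_comm_rad]; simp only [mul_assoc]
  rw [e1, e2, lo_comm_rad, ← lo_commute_hi, pre, map_mul, map_mul, ← mul_assoc (rad F (bl n a)),
    rad_mul_self]
  simp only [mul_assoc]

lemma pre_smul_smul (h : a + b = n) (c d : ℂ) (x : GA (GL (Fin a) F)) (y : GA (GL (Fin b) F)) :
    pre h (c • x) (d • y) = (c * d) • pre h x y := by
  simp only [pre, map_smul, mul_smul_comm, smul_mul_assoc, smul_smul]
  rw [mul_comm c d]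

lemma pre_one_one (h : a + b = n) :
    pre h (1 : GA (GL (Fin a) F)) (1 : GA (GL (Fin b) F)) = rad F (bl n a) := by
  simp [pre]

lemma pre_mul_gg (h : a + b = n) (x : GA (GL (Fin a) F)) (y : GA (GL (Fin b) F)) :
    pre h x y * gg ψ n = pre h (x * gg ψ a) (y * gg ψ b) * gg ψ n := by
  conv_lhs => rw [← gmap_gg_mul_gg (lo_shift h), ← gmap_gg_mul_gg (val_hi h)]
  simp only [pre, map_mul, mul_assoc]
  rw [← mul_assoc (gmap (emb (hi h)) y), ← lo_commute_hi]
  simp only [mul_assoc]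

/-- The mixed Mackey formula for the unipotent radical and the generic character. -/
lemma exists_rad_mul_dl_mul_gg (hψ : ψ ≠ 1) (h : a + b = n) (g : GL (Fin n) F) :
    ∃ (c : ℂ) (l₁ : GL (Fin a) F) (l₂ : GL (Fin b) F),
      rad F (bl n a) * dl g * gg ψ n = c • (pre h (dl l₁) (dl l₂) * gg ψ n) := by
  by_cases h0 : rad F (bl n a) * dl g * gg ψ n = 0
  · exact ⟨0, 1, 1, by rw [h0, zero_smul]⟩
  let r : Fin n → ℕ := fun i => i + n * bl n a i
  have hbl : ∀ i : Fin n, bl n a i = 0 ∨ bl n a i = 1 := fun i => by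
    unfold bl; split_ifs <;> simp
  have hrlt : ∀ i j, bl n a i < bl n a j → r i < r j := by
    intro i j hij
    have h1 : bl n a i = 0 := by have := hbl i; have := hbl j; omega
    have h2 : bl n a j = 1 := by have := hbl i; have := hbl j; omega
    simp only [r, h1, h2]; omega
  have hr : Function.Injective r := by
    intro i j hij
    rcases lt_trichotomy (bl n a i) (bl n a j) with h1 | h1 | h1
    · exact absurd hij (hrlt _ _ h1).ne
    · simp only [r, h1] at hij
      exact Fin.ext (by omega)
    · exact absurd hij (hrlt _ _ h1).ne'
  obtain ⟨u, hu, v, hv, w, t, rfl⟩ := bruhat hr (Fin.val_injective (n := n)) g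
  obtain ⟨l, hl, -, hul, -⟩ := dl_para_mul_rad (unip_le_para_of_refines hrlt hu)
  have e1 : rad F (bl n a) * dl (u * mono w t * v) * gg ψ n =
      ψ (superSum v.val) • (dl l * (rad F (bl n a) * dl (mono w t) * gg ψ n)) := by
    rw [dl_mul, dl_mul, ← mul_assoc, ← mul_assoc, hul, ← dl_levi_mul_rad hl]
    simp only [mul_assoc]
    rw [dl_mul_gg hv]
    simp only [mul_smul_comm]
  have hne : rad F (bl n a) * dl (mono w t) * gg ψ n ≠ 0 := by
    intro hc; apply h0; rw [e1, hc, mul_zero, smul_zero]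
  have hstep : ∀ i j : Fin n, (j : ℕ) = i + 1 → bl n a (w j) ≤ bl n a (w i) := by
    intro i j hij
    by_contra! hlt
    apply hψ
    ext x
    have hij' : i ≠ j := by rintro rfl; omega
    have key : rad F (bl n a) * dl (mono w t) * gg ψ n =
        ψ x • (rad F (bl n a) * dl (mono w t) * gg ψ n) := by
      calc _ = rad F (bl n a) * dl (elem (w.injective.ne hij') (t i * x * ((t j)⁻¹ : Fˣ))) *
              dl (mono w t) * gg ψ n := by rw [rad_mul_dl (elem_mem_unip _ _ hlt)]
        _ = rad F (bl n a) * dl (mono w t) * (dl (elem hij' x) * gg ψ n) := by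
          rw [mul_assoc (rad F (bl n a)) (dl (elem _ _)), ← dl_mul, ← mono_mul_elem _ _ hij',
            dl_mul]
          simp only [mul_assoc]
        _ = _ := by
          rw [dl_mul_gg (elem_mem_unip _ _ (by simp [hij])), superSum_elem, if_pos hij,
            mul_smul_comm]
    have h2 := sub_eq_zero.2 key
    nth_rewrite 1 [← one_smul ℂ (rad F (bl n a) * dl (mono w t) * gg ψ n)] at h2
    rw [← sub_smul, smul_eq_zero] at h2
    rw [AddChar.one_apply]
    exact (sub_eq_zero.1 (h2.resolve_right hne)).symm
  have hanti : ∀ i j : Fin n, i ≤ j → bl n a (w j) ≤ bl n a (w i) := by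
    intro i j hij
    have : ∀ m : ℕ, ∀ hm : m < n, (i : ℕ) ≤ m → bl n a (w ⟨m, hm⟩) ≤ bl n a (w i) := by
      intro m hm him
      induction m, him using Nat.le_induction with
      | base => rfl
      | succ m him ih => exact (hstep ⟨m, by omega⟩ ⟨m + 1, hm⟩ rfl).trans (ih (by omega))
    exact this j j.2 hij
  have hw : ∀ i, bl n a (w i) = bl n a i := by
    have hle : ∀ i, bl n a (w i) ≤ bl n a i := by
      intro i
      by_contra! hlt
      have h1 : bl n a i = 0 := by have := hbl i; have := hbl (w i); omega
      have h2 : bl n a (w i) = 1 := by have := hbl i; have := hbl (w i); omega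
      have h3 : a ≤ i := by by_contra hc; simp [bl, not_le.1 hc] at h1
      have h4 : ∀ j : Fin n, (j : ℕ) ≤ a → (w j : ℕ) < a := by
        intro j hj
        have := hanti j i (Fin.le_def.2 (hj.trans h3))
        by_contra hc
        simp [bl, hc] at this
        simp [bl] at h2
        omega
      have h5 := Fintype.card_le_of_injective (fun j : Fin (a + 1) =>
        (⟨w ⟨j, by omega⟩, h4 _ (by simp; omega)⟩ : Fin a)) (fun j k hjk => by
          have h6 : (w ⟨j, by omega⟩ : ℕ) = w ⟨k, by omega⟩ := by
            simpa using congrArg (fun z : Fin a => (z : ℕ)) hjk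
          have := congrArg Fin.val (w.injective (Fin.ext h6))
          exact Fin.ext this)
      simp at h5
    have := (Finset.sum_eq_sum_iff_of_le (fun j _ => hle j)).1 (Equiv.sum_comp w (bl n a))
    exact fun i => this i (Finset.mem_univ i)
  have hm : mono w t ∈ levi F (bl n a) := by
    intro i j hij
    rw [mono_apply, if_neg]
    rintro rfl
    exact hij (hw j)
  obtain ⟨l₁, l₂, hll⟩ := exists_lo_hi h (mul_mem hl hm)
  refine ⟨ψ (superSum v.val), l₁, l₂, ?_⟩
  rw [e1, ← mul_assoc, ← mul_assoc, dl_levi_mul_rad hl, mul_assoc (rad F (bl n a)) (dl l), ← dl_mul,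
    hll, dl_mul, pre, gmap_dl, gmap_dl]
  simp only [mul_assoc]

omit [Finite F] in
lemma gmap_lo_mul_gmap_hi_ne_zero (h : a + b = n) {x : GA (GL (Fin a) F)} {y : GA (GL (Fin b) F)}
    (hx : x ≠ 0) (hy : y ≠ 0) : gmap (emb (lo h)) x * gmap (emb (hi h)) y ≠ 0 := by
  refine gmap_mul_gmap_ne_zero (emb_injective _) (fun g g' hg => ?_) hx hy
  ext i j
  rw [← emb_apply_apply (hi h), ← hg, emb_apply_of_notMem_left _ _ (fun k => lo_ne_hi h k i)]
  simp [Matrix.one_apply]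

lemma pre_ne_zero (h : a + b = n) {x : GA (GL (Fin a) F)} {y : GA (GL (Fin b) F)}
    (hx : x ≠ 0) (hy : y ≠ 0) : pre h x y ≠ 0 := by
  intro h0
  set S : Set (GL (Fin n) F) :=
    ((levi F (bl n a) : Subgroup (GL (Fin n) F)) : Set (GL (Fin n) F)) with hS
  obtain ⟨c, hc, h1⟩ := pr_avg_mul (S := S) (H := unip F (bl n a)) (χ := 1)
    (gmap (emb (lo h)) x * gmap (emb (hi h)) y) (one_mem (levi F (bl n a))) (by
      intro u hu
      have : (u : GL (Fin n) F) = 1 := by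
        ext i j
        by_cases hij : bl n a i = bl n a j
        · exact u.2 i j hij.ge
        · rw [hu i j hij, Units.val_one, Matrix.one_apply_ne]
          rintro rfl; exact hij rfl
      rw [this, dl_one, one_mul, MonoidHom.one_apply, one_smul])
  have h2 : pr S (pre h x y) = pr S (rad F (bl n a)) *
      (gmap (emb (lo h)) x * gmap (emb (hi h)) y) := by
    rw [pre, pr_mul_gmap, pr_mul_gmap, mul_assoc]
    · exact fun g z => (levi F (bl n a)).mul_mem_cancel_right (emb_mem_levi (by simp) g)
    · exact fun g z => (levi F (bl n a)).mul_mem_cancel_right (emb_mem_levi (by simp) g)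
  rw [h0, map_zero, rad, h1] at h2
  exact smul_ne_zero hc (gmap_lo_mul_gmap_hi_ne_zero h hx hy) h2.symm

lemma pre_mul_gg_ne_zero (h : a + b = n) {x : GA (GL (Fin a) F)} {y : GA (GL (Fin b) F)}
    (hx : x ≠ 0) (hy : y ≠ 0) (hxe : x * gg ψ a = x) (hye : y * gg ψ b = y) :
    pre h x y * gg ψ n ≠ 0 := by
  intro h0
  set S : Set (GL (Fin n) F) :=
    ((para F (bl n a) : Subgroup (GL (Fin n) F)) : Set (GL (Fin n) F)) with hS
  have hlp := levi_le_para (F := F) (bl n a)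
  obtain ⟨c, hc, h1⟩ := mul_pr_avg (S := S) (H := uni F n) (χ := genChar ψ n)
    (pre h x y) (one_mem (para F (bl n a))) (by
      intro u hu
      have hul : (u : GL (Fin n) F) ∈ levi F (bl n a) := by
        intro i j hij
        rcases lt_or_gt_of_ne hij with h1 | h1
        · apply uni_apply_lt u.2
          rw [Fin.lt_def]
          simp only [bl] at h1
          split_ifs at h1 <;> omega
        · exact hu i j h1
      obtain ⟨l₁, l₂, hl⟩ := exists_lo_hi h hul
      have hent1 : ∀ i j, u.1.val (lo h i) (lo h j) = l₁.val i j := by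
        intro i j
        rw [hl, Units.val_mul, Matrix.mul_apply, Finset.sum_eq_single (lo h j), emb_apply_apply,
          emb_apply_of_notMem_left _ _ (fun k => (lo_ne_hi h j k).symm), Matrix.one_apply_eq,
          mul_one]
        · intro k _ hk
          rw [emb_apply_of_notMem_right (hi h) _ _ (fun k => (lo_ne_hi h j k).symm),
            Matrix.one_apply_ne hk, mul_zero]
        · simp
      have hent2 : ∀ i j, u.1.val (hi h i) (hi h j) = l₂.val i j := by
        intro i j
        rw [hl, Units.val_mul, Matrix.mul_apply, Finset.sum_eq_single (hi h i), emb_apply_apply,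
          emb_apply_of_notMem_left _ _ (fun k => (lo_ne_hi h k i)), Matrix.one_apply_eq,
          one_mul]
        · intro k _ hk
          rw [emb_apply_of_notMem_left (lo h) _ (fun k => (lo_ne_hi h k i)),
            Matrix.one_apply_ne hk.symm, zero_mul]
        · simp
      have hl₁ : l₁ ∈ uni F a := by
        intro i j hij
        rw [← hent1, u.2 _ _ (by simpa using hij)]; simp [Matrix.one_apply]
      have hl₂ : l₂ ∈ uni F b := by
        intro i j hij
        rw [← hent2, u.2 _ _ (by simpa using hij)]; simp [Matrix.one_apply]
      have hsum : superSum u.1.val = superSum l₁.val + superSum l₂.val := by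
        rw [hl, superSum_mul (emb_mem_uni (lo_shift h) hl₁) (emb_mem_uni (val_hi h) hl₂),
          superSum_emb (lo_shift h), superSum_emb (val_hi h)]
      have hx' : x * dl l₁ = ψ (superSum l₁.val) • x := by
        conv_lhs => rw [← hxe, mul_assoc, gg_mul_dl hl₁, mul_smul_comm, hxe]
      have hy' : y * dl l₂ = ψ (superSum l₂.val) • y := by
        conv_lhs => rw [← hye, mul_assoc, gg_mul_dl hl₂, mul_smul_comm, hye]
      rw [genChar_apply, hsum, AddChar.map_add_eq_mul, ← pre_smul_smul, ← hx', ← hy', hl, dl_mul,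
        pre, pre, map_mul, map_mul, gmap_dl, gmap_dl]
      have := lo_commute_hi h (dl l₁) y
      rw [gmap_dl] at this
      simp only [mul_assoc]
      rw [← mul_assoc (gmap (emb (hi h)) y), ← this, mul_assoc])
  have h2 : pr S (pre h x y * gg ψ n) = pre h x y * pr S (gg ψ n) := by
    rw [pre, mul_assoc, mul_assoc, rad, pr_avg_mul_comm, pr_gmap_mul, pr_gmap_mul]
    · simp only [mul_assoc]
    · exact fun g z => (para F (bl n a)).mul_mem_cancel_left (hlp (emb_mem_levi (by simp) g))
    · exact fun g z => (para F (bl n a)).mul_mem_cancel_left (hlp (emb_mem_levi (by simp) g))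
    · exact fun u z => (para F (bl n a)).mul_mem_cancel_left (unip_le_para _ u.2)
  rw [h0, map_zero, gg, h1] at h2
  exact smul_ne_zero hc (pre_ne_zero h hx hy) h2.symm

end Blocks

end GelfandGraev

namespace GelfandGraev

open Matrix

section Product

variable {F : Type*} [Field F] [Finite F] {ψ : AddChar F ℂ} {a b c n p r : ℕ}

/-- The vector attached to a pair of minimal idempotents. -/
noncomputable def xi (ψ : AddChar F ℂ) (h : a + b = n) (x : GA (GL (Fin a) F))
    (y : GA (GL (Fin b) F)) : GA (GL (Fin n) F) := pre h x y * gg ψ n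

lemma xi_def (h : a + b = n) (x : GA (GL (Fin a) F)) (y : GA (GL (Fin b) F)) :
    pre h x y * gg ψ n = xi ψ h x y := rfl

lemma xi_ne_zero (h : a + b = n) {x : GA (GL (Fin a) F)} {y : GA (GL (Fin b) F)}
    (hx : IsMin (gg ψ a) x) (hy : IsMin (gg ψ b) y) : xi ψ h x y ≠ 0 :=
  pre_mul_gg_ne_zero h hx.1 hy.1 hx.2.2.2.1 hy.2.2.2.1

lemma exists_pre_mul_mul_gg (hψ : ψ ≠ 1) (h : a + b = n) {x : GA (GL (Fin a) F)}
    {y : GA (GL (Fin b) F)} (hx : IsMin (gg ψ a) x) (hy : IsMin (gg ψ b) y)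
    (Z : GA (GL (Fin n) F)) : ∃ k : ℂ, pre h x y * Z * gg ψ n = k • xi ψ h x y := by
  have := sandwich_mem (pre h x y) (gg ψ n) (Submodule.span ℂ {xi ψ h x y}) (fun g => by
    obtain ⟨k, l₁, l₂, hk⟩ := exists_rad_mul_dl_mul_gg hψ h g
    obtain ⟨k₁, hk₁⟩ := hx.2.2.2.2 (dl l₁)
    obtain ⟨k₂, hk₂⟩ := hy.2.2.2.2 (dl l₂)
    have e1 : pre h x y = pre h x y * rad F (bl n a) := by
      rw [← pre_one_one h, pre_mul_pre, mul_one, mul_one]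
    rw [e1, mul_assoc, mul_assoc, ← mul_assoc (rad _ _), hk, mul_smul_comm, ← mul_assoc,
      pre_mul_pre, pre_mul_gg, hk₁, hk₂, pre_smul_smul, smul_mul_assoc, smul_smul]
    exact Submodule.smul_mem _ _ (Submodule.mem_span_singleton_self _)) Z
  obtain ⟨k, hk⟩ := Submodule.mem_span_singleton.1 this
  exact ⟨k, hk.symm⟩

lemma xi_mul_eq_of_ne_zero (hψ : ψ ≠ 1) (h : a + b = n) {x : GA (GL (Fin a) F)}
    {y : GA (GL (Fin b) F)} (hx : IsMin (gg ψ a) x) (hy : IsMin (gg ψ b) y)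
    {z : GA (GL (Fin n) F)} (hz : IsMin (gg ψ n) z) (h0 : xi ψ h x y * z ≠ 0) :
    xi ψ h x y * z = xi ψ h x y := by
  obtain ⟨k, hk⟩ := exists_pre_mul_mul_gg hψ h hx hy z
  have h1 : xi ψ h x y * z = k • xi ψ h x y := by
    rw [← hk, xi, mul_assoc, hz.2.2.1, mul_assoc, hz.2.2.2.1]
  have h2 : xi ψ h x y * z * z = k • (xi ψ h x y * z) := by
    nth_rw 1 [h1]; rw [smul_mul_assoc]
  rw [mul_assoc, hz.2.1] at h2
  have h3 : k = 1 := by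
    have h4 := sub_eq_zero.2 h2
    nth_rewrite 1 [← one_smul ℂ (xi ψ h x y * z)] at h4
    rw [← sub_smul, smul_eq_zero] at h4
    exact (sub_eq_zero.1 (h4.resolve_right h0)).symm
  rw [h1, h3, one_smul]

lemma exists_xi_mul_ne_zero (hψ : ψ ≠ 1) (h : a + b = n) {x : GA (GL (Fin a) F)}
    {y : GA (GL (Fin b) F)} (hx : IsMin (gg ψ a) x) (hy : IsMin (gg ψ b) y) :
    ∃ z, IsMin (gg ψ n) z ∧ xi ψ h x y * z ≠ 0 :=
  exists_mul_ne_zero (isGelfand_gg hψ) (by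
    rw [xi, mul_assoc, gg_mul_self]; exact xi_ne_zero h hx hy)

lemma eq_of_xi_mul_ne_zero (hψ : ψ ≠ 1) (h : a + b = n) {x : GA (GL (Fin a) F)}
    {y : GA (GL (Fin b) F)} (hx : IsMin (gg ψ a) x) (hy : IsMin (gg ψ b) y)
    {z z' : GA (GL (Fin n) F)} (hz : IsMin (gg ψ n) z) (hz' : IsMin (gg ψ n) z')
    (h0 : xi ψ h x y * z ≠ 0) (h0' : xi ψ h x y * z' ≠ 0) : z = z' := by
  refine IsMin.eq_of_mul_ne_zero (isGelfand_gg hψ) hz hz' fun hzz => h0' ?_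
  rw [← xi_mul_eq_of_ne_zero hψ h hx hy hz h0, mul_assoc, hzz, mul_zero]

lemma pre_assoc (hab : a + b = p) (hbc : b + c = r) (hp : p + c = n) (hr : a + r = n)
    (x : GA (GL (Fin a) F)) (y : GA (GL (Fin b) F)) (z : GA (GL (Fin c) F)) :
    pre hp (pre hab x y) z = pre hr x (pre hbc y z) := by
  let γ : Fin n → ℕ := fun i => if (i : ℕ) < a then 2 else if (i : ℕ) < p then 1 else 0
  have h1 : rad F (bl n p) * gmap (emb (lo hp)) (rad F (bl p a)) = rad F γ := by
    refine rad_mul_gmap_rad (fun i j hij => ?_) (fun i j => ?_) (fun i j hij hlt => ?_)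
    · simp only [γ, bl] at hij ⊢
      split_ifs at hij ⊢ <;> omega
    · have := i.2; have := j.2
      simp only [γ, bl, val_lo]
      grind
    · simp only [γ, bl] at hij hlt
      rw [← bl_eq_one_iff hp, ← bl_eq_one_iff hp]
      unfold bl
      split_ifs at hij hlt ⊢ <;> simp at * <;> omega
  have h2 : rad F (bl n a) * gmap (emb (hi hr)) (rad F (bl r b)) = rad F γ := by
    refine rad_mul_gmap_rad (fun i j hij => ?_) (fun i j => ?_) (fun i j hij hlt => ?_)
    · simp only [γ, bl] at hij ⊢
      split_ifs at hij ⊢ <;> omega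
    · have := i.2; have := j.2
      simp only [γ, bl, val_hi]
      grind
    · simp only [γ, bl] at hij hlt
      rw [← bl_eq_zero_iff hr, ← bl_eq_zero_iff hr]
      unfold bl
      split_ifs at hij hlt ⊢ <;> simp at * <;> omega
  have e1 : (emb (lo hp)).comp (emb (F := F) (lo hab)) = emb (lo hr) := by
    rw [emb_comp]; rfl
  have e2 : (emb (lo hp)).comp (emb (F := F) (hi hab)) = (emb (hi hr)).comp (emb (lo hbc)) := by
    rw [emb_comp, emb_comp]; congr 1
  have e3 : (emb (hi hr)).comp (emb (F := F) (hi hbc)) = emb (hi hp) := by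
    rw [emb_comp]; congr 1; ext i; simp; omega
  have l1 : pre hp (pre hab x y) z = rad F γ * gmap (emb (lo hr)) x *
      gmap ((emb (hi hr)).comp (emb (lo hbc))) y * gmap (emb (hi hp)) z := by
    simp only [pre, map_mul, gmap_gmap, e1, e2, ← h1, mul_assoc]
  have l2 : pre hr x (pre hbc y z) = rad F γ * gmap (emb (lo hr)) x *
      gmap ((emb (hi hr)).comp (emb (lo hbc))) y * gmap (emb (hi hp)) z := by
    have l3 := lo_commute_hi hr x (rad F (bl r b))
    simp only [pre, map_mul, gmap_gmap, e3, ← h2]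
    simp only [mul_assoc]
    rw [← mul_assoc (gmap (emb (lo hr)) x), l3, mul_assoc]
  rw [l1, l2]

lemma assoc_of_ne_zero (hψ : ψ ≠ 1) (hab : a + b = p) (hbc : b + c = r) (hp : p + c = n)
    (hr : a + r = n) {x : GA (GL (Fin a) F)} {y : GA (GL (Fin b) F)} {z : GA (GL (Fin c) F)}
    {s : GA (GL (Fin p) F)} {s' : GA (GL (Fin r) F)} {t t' : GA (GL (Fin n) F)}
    (hx : IsMin (gg ψ a) x) (hy : IsMin (gg ψ b) y) (hz : IsMin (gg ψ c) z)
    (hs : IsMin (gg ψ p) s) (hs' : IsMin (gg ψ r) s') (ht : IsMin (gg ψ n) t)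
    (ht' : IsMin (gg ψ n) t') (h1 : xi ψ hab x y * s ≠ 0) (h2 : xi ψ hp s z * t ≠ 0)
    (h3 : xi ψ hbc y z * s' ≠ 0) (h4 : xi ψ hr x s' * t' ≠ 0) : t = t' := by
  have k1 := xi_mul_eq_of_ne_zero hψ hab hx hy hs h1
  have k2 := xi_mul_eq_of_ne_zero hψ hp hs hz ht h2
  have k3 := xi_mul_eq_of_ne_zero hψ hbc hy hz hs' h3
  have k4 := xi_mul_eq_of_ne_zero hψ hr hx hs' ht' h4
  have e1 : pre hp (pre hab x y) z * gg ψ n = pre hp (xi ψ hab x y) 1 * xi ψ hp s z := by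
    rw [pre_mul_gg, hz.2.2.2.1, xi_def hab, xi.eq_1 ψ hp, ← mul_assoc, pre_mul_pre, k1, one_mul]
  have e2 : pre hr x (pre hbc y z) * gg ψ n = pre hr 1 (xi ψ hbc y z) * xi ψ hr x s' := by
    rw [pre_mul_gg, hx.2.2.2.1, xi_def hbc, xi.eq_1 ψ hr, ← mul_assoc, pre_mul_pre, k3, one_mul]
  have m1 : pre hp (pre hab x y) z * gg ψ n * t = pre hp (pre hab x y) z * gg ψ n := by
    rw [e1, mul_assoc, k2]
  have m2 : pre hp (pre hab x y) z * gg ψ n * t' = pre hp (pre hab x y) z * gg ψ n := by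
    rw [pre_assoc hab hbc hp hr, e2, mul_assoc, k4]
  have m3 : pre hp (pre hab x y) z * gg ψ n ≠ 0 := by
    rw [pre_mul_gg, xi_def hab]
    refine pre_mul_gg_ne_zero hp (xi_ne_zero hab hx hy) ?_ ?_ ?_
    · rw [hz.2.2.2.1]; exact hz.1
    · rw [xi, mul_assoc, gg_mul_self]
    · rw [hz.2.2.2.1, hz.2.2.2.1]
  refine IsMin.eq_of_mul_ne_zero (isGelfand_gg hψ) ht ht' fun htt => m3 ?_
  rw [← m2, ← m1, mul_assoc _ t, htt, mul_zero]

omit [Finite F] in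
lemma flipAlg_gmap {φ : Fin a ↪ Fin n} {φ' : Fin a ↪ Fin n}
    (h : ∀ i, φ' (Fin.rev i) = Fin.rev (φ i)) (x : GA (GL (Fin a) F)) :
    flipAlg n (gmap (emb φ) x) = gmap (emb φ') (flipAlg a x) := by
  refine lin_ext (f := (flipAlg n).comp (gmap (emb φ)).toLinearMap)
    (f' := (gmap (emb φ')).toLinearMap.comp (flipAlg a)) (fun g => ?_) x
  simp only [LinearMap.comp_apply, AlgHom.toLinearMap_apply, gmap_dl, flipAlg_dl]
  congr 1
  refine eq_emb_iff (fun i j => ?_) (fun i j hij => ?_)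
  · rw [flip_apply, flip_apply, ← Fin.rev_rev i, ← Fin.rev_rev j, h, h, Fin.rev_rev, Fin.rev_rev,
      Fin.rev_rev, Fin.rev_rev, emb_apply_apply]
  · have key : ∀ i, (∀ k, φ' k ≠ i) → ∀ k, φ k ≠ Fin.rev i := by
      intro i hi k hk
      exact hi (Fin.rev k) (by rw [h, hk, Fin.rev_rev])
    rw [flip_apply]
    rcases hij with hi | hj
    · rw [emb_apply_of_notMem_right _ _ _ (key i hi)]; simp [Matrix.one_apply, eq_comm]
    · rw [emb_apply_of_notMem_left _ _ (key j hj)]; simp [Matrix.one_apply, eq_comm]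

lemma flipAlg_rad (h : a + b = n) : flipAlg n (rad F (bl n a)) = rad F (bl n b) := by
  have key : ∀ {a b : ℕ}, a + b = n →
      flipAlg n (rad F (bl n a)) * rad F (bl n b) = rad F (bl n b) := by
    intro a b h
    refine map_avg_eq ((LinearMap.mulRight ℂ (rad F (bl n b))).comp (flipAlg n)) fun u => ?_
    simp only [LinearMap.comp_apply, LinearMap.mulRight_apply, flipAlg_dl, MonoidHom.one_apply,
      one_smul]
    refine dl_mul_rad fun i j hij => ?_
    rw [flip_apply, u.2 _ _ (by
      simp only [bl, Fin.val_rev] at hij ⊢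
      split_ifs at hij ⊢ <;> omega)]
    simp [Matrix.one_apply, eq_comm]
  have h1 := congrArg (flipAlg n) (key ((add_comm b a).trans h))
  rw [flipAlg_mul, flipAlg_flipAlg, key h] at h1
  exact h1.symm

lemma adj_flipAlg_pre (h : a + b = n) (h' : b + a = n) (x : GA (GL (Fin a) F))
    (y : GA (GL (Fin b) F)) :
    adj (flipAlg n (pre h x y)) = pre h' (adj (flipAlg b y)) (adj (flipAlg a x)) := by
  simp only [pre, flipAlg_mul, adj_mul, flipAlg_rad h, adj_rad]
  rw [flipAlg_gmap (φ' := hi h') (fun i => by ext; simp; omega),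
    flipAlg_gmap (φ' := lo h') (fun i => by ext; simp; omega), adj_gmap, adj_gmap, mul_assoc,
    ← lo_commute_hi, mul_assoc]

lemma xi_mul_ne_zero_symm (hψ : ψ ≠ 1) (h : a + b = n) (h' : b + a = n) {x : GA (GL (Fin a) F)}
    {y : GA (GL (Fin b) F)} {z : GA (GL (Fin n) F)} (hx : IsMin (gg ψ a) x)
    (hy : IsMin (gg ψ b) y) (hz : IsMin (gg ψ n) z) (h0 : xi ψ h x y * z ≠ 0) :
    xi ψ h' y x * z ≠ 0 := by
  have key : ∀ {m : ℕ} {w : GA (GL (Fin m) F)}, IsMin (gg ψ m) w → adj (flipAlg m w) = w := by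
    intro m w hw
    rw [flipAlg_corner hψ (mem_cornerSubmodule.2 ⟨w, hw.corner⟩),
      IsMin.adj_eq (isGelfand_gg hψ) hw]
  intro h1
  apply h0
  have h2 : adj (flipAlg n (xi ψ h' y x * z)) = xi ψ h x y * z := by
    simp only [xi, flipAlg_mul, adj_mul, adj_flipAlg_pre h' h, key hx, key hy, key hz, flipAlg_gg,
      (isGelfand_gg hψ).adj_eq]
  rw [← h2, h1, map_zero, map_zero]

end Product

end GelfandGraev

namespace GelfandGraev

open Matrix

section Monoid

variable {F : Type*} [Field F] [Finite F] {ψ : AddChar F ℂ} {a b c n p r : ℕ}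

/-- Minimal idempotents of the Gelfand–Graev corners, in all ranks. -/
def Gen (ψ : AddChar F ℂ) : Type _ := Σ n : ℕ, {z : GA (GL (Fin n) F) // IsMin (gg ψ n) z}

namespace Gen

/-- The rank of a minimal idempotent. -/
def deg (x : Gen ψ) : ℕ := x.1

variable [hψ : Fact (ψ ≠ 1)]

noncomputable instance : Mul (Gen ψ) where
  mul x y := ⟨x.1 + y.1, (exists_xi_mul_ne_zero hψ.out rfl x.2.2 y.2.2).choose,
    (exists_xi_mul_ne_zero hψ.out rfl x.2.2 y.2.2).choose_spec.1⟩

lemma deg_mul (x y : Gen ψ) : deg (x * y) = deg x + deg y := rfl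

lemma mul_eq (h : a + b = n) {x : GA (GL (Fin a) F)} {y : GA (GL (Fin b) F)}
    {z : GA (GL (Fin n) F)} (hx : IsMin (gg ψ a) x) (hy : IsMin (gg ψ b) y)
    (hz : IsMin (gg ψ n) z) (h0 : xi ψ h x y * z ≠ 0) :
    (⟨a, x, hx⟩ * ⟨b, y, hy⟩ : Gen ψ) = ⟨n, z, hz⟩ := by
  subst h
  have hs := (exists_xi_mul_ne_zero hψ.out rfl hx hy).choose_spec
  have := eq_of_xi_mul_ne_zero hψ.out rfl hx hy hs.1 hz hs.2 h0
  exact Sigma.ext rfl (heq_of_eq (Subtype.ext this))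

omit hψ in
lemma isMin_gg_zero : IsMin (gg ψ 0) (gg ψ 0) := by
  refine ⟨avg_ne_zero, gg_mul_self, gg_mul_self, gg_mul_self, fun x => ?_⟩
  have := sandwich_mem (gg ψ 0) (gg ψ 0) (Submodule.span ℂ {gg ψ 0}) (fun g => by
    rw [Subsingleton.elim g 1, dl_one, mul_one, gg_mul_self]
    exact Submodule.mem_span_singleton_self _) x
  obtain ⟨k, hk⟩ := Submodule.mem_span_singleton.1 this
  exact ⟨k, hk.symm⟩

noncomputable instance : One (Gen ψ) where
  one := ⟨0, gg ψ 0, isMin_gg_zero⟩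

lemma deg_one : deg (1 : Gen ψ) = 0 := rfl

lemma eq_one_of_deg {x : Gen ψ} (h : deg x = 0) : x = 1 := by
  obtain ⟨n, z, hz⟩ := x
  obtain rfl : n = 0 := h
  have := IsMin.eq_of_mul_ne_zero (isGelfand_gg hψ.out) hz (isMin_gg_zero (ψ := ψ))
    (by rw [hz.2.2.2.1]; exact hz.1)
  exact Sigma.ext rfl (heq_of_eq (Subtype.ext this))

protected lemma mul_comm' (x y : Gen ψ) : x * y = y * x := by
  obtain ⟨a, x, hx⟩ := x
  obtain ⟨b, y, hy⟩ := y
  obtain ⟨z, hz, h0⟩ := exists_xi_mul_ne_zero hψ.out rfl hx hy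
  rw [mul_eq rfl hx hy hz h0,
    mul_eq (add_comm b a) hy hx hz (xi_mul_ne_zero_symm hψ.out _ _ hx hy hz h0)]

protected lemma mul_assoc' (x y z : Gen ψ) : x * y * z = x * (y * z) := by
  obtain ⟨a, x, hx⟩ := x
  obtain ⟨b, y, hy⟩ := y
  obtain ⟨c, z, hz⟩ := z
  obtain ⟨s, hs, h1⟩ := exists_xi_mul_ne_zero hψ.out rfl hx hy
  obtain ⟨t, ht, h2⟩ := exists_xi_mul_ne_zero hψ.out rfl hs hz
  obtain ⟨s', hs', h3⟩ := exists_xi_mul_ne_zero hψ.out rfl hy hz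
  have h : a + (b + c) = a + b + c := (add_assoc _ _ _).symm
  obtain ⟨t', ht', h4⟩ := exists_xi_mul_ne_zero hψ.out h hx hs'
  rw [mul_eq rfl hx hy hs h1, mul_eq rfl hs hz ht h2, mul_eq rfl hy hz hs' h3,
    mul_eq h hx hs' ht' h4]
  have := assoc_of_ne_zero hψ.out rfl rfl rfl h hx hy hz hs hs' ht ht' h1 h2 h3 h4
  exact Sigma.ext rfl (heq_of_eq (Subtype.ext this))

protected lemma one_mul' (x : Gen ψ) : 1 * x = x := by
  obtain ⟨n, y, hy⟩ := x
  refine mul_eq (zero_add n) isMin_gg_zero hy hy fun h0 => ?_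
  have h1 : gmap (emb (hi (zero_add n))) y = y := by
    refine lin_ext (f := (gmap (emb (hi (zero_add n)))).toLinearMap) (f' := LinearMap.id)
      (fun g => ?_) y
    simp only [AlgHom.toLinearMap_apply, gmap_dl, LinearMap.id_apply]
    congr 1
    symm
    refine eq_emb_iff (fun i j => ?_) (fun i j hij => ?_)
    · have h2 : ∀ k, hi (zero_add n) k = k := fun k => Fin.ext (by simp)
      rw [h2, h2]
    · rcases hij with h | h
      · exact absurd (by ext; simp) (h i)
      · exact absurd (by ext; simp) (h j)
  refine xi_ne_zero (zero_add n) (isMin_gg_zero (ψ := ψ)) hy ?_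
  have h2 : pre (zero_add n) (gg ψ 0) y * y = pre (zero_add n) (gg ψ 0) y := by
    conv_lhs => rw [pre, h1, mul_assoc, hy.2.1]
    rw [pre, h1]
  rw [← h0, xi, mul_assoc, hy.2.2.1, h2, pre_mul_gg, hy.2.2.2.1, gg_mul_self]
  rw [pre, h1, mul_assoc, hy.2.2.2.1]

noncomputable instance : CommMonoid (Gen ψ) where
  mul_assoc := Gen.mul_assoc'
  one_mul := Gen.one_mul'
  mul_one x := by rw [Gen.mul_comm', Gen.one_mul']
  mul_comm := Gen.mul_comm'

/-- Annihilation by all proper unipotent radicals, in positive rank. -/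
def IsCusp (z : Gen ψ) : Prop :=
  0 < deg z ∧ ∀ β : Fin z.1 → ℕ, (∃ i j, β i ≠ β j) → ∀ x, rad F β * x * z.2.1 = 0

omit hψ in
lemma pre_sum_sum (h : a + b = n) (s : Finset (GA (GL (Fin a) F)))
    (t : Finset (GA (GL (Fin b) F))) :
    pre h (∑ x ∈ s, x) (∑ y ∈ t, y) = ∑ x ∈ s, ∑ y ∈ t, pre h x y := by
  simp only [pre, map_sum, Finset.mul_sum, Finset.sum_mul]
  exact Finset.sum_comm

omit hψ in
lemma exists_rad_bl_ne_zero {β : Fin n → ℕ} (hβ : ∃ i j, β i ≠ β j)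
    {x z : GA (GL (Fin n) F)} (h0 : rad F β * x * z ≠ 0) :
    ∃ a, 0 < a ∧ a < n ∧ ∃ x', rad F (bl n a) * x' * z ≠ 0 := by
  obtain ⟨i₀, j₀, hij⟩ : ∃ i j, β i < β j := by
    obtain ⟨i, j, h⟩ := hβ
    rcases lt_or_gt_of_ne h with h | h
    exacts [⟨_, _, h⟩, ⟨_, _, h⟩]
  let P : Fin n → Prop := fun i => β i₀ < β i
  let β' : Fin n → ℕ := fun i => if P i then 1 else 0
  have h1 : rad F β' * rad F β = rad F β := by
    refine rad_mul_rad_of_le (unip_mono fun i j h => ?_)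
    simp only [β', P]
    split_ifs <;> omega
  let a := Fintype.card {i // P i}
  have ha : 0 < a := Fintype.card_pos_iff.2 ⟨⟨j₀, hij⟩⟩
  have han : a < n := by
    have := Fintype.card_subtype_lt (p := P) (x := i₀) (lt_irrefl _)
    simpa using this
  let e : {i : Fin n // (i : ℕ) < a} ≃ {i // P i} := Fintype.equivOfCardEq (by
    rw [Fintype.card_subtype, Fin.card_filter_val_lt, min_eq_right han.le])
  let w : Equiv.Perm (Fin n) := e.extendSubtype
  have hw : β' ∘ w = bl n a := by
    funext i
    simp only [Function.comp, β', bl]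
    by_cases h : (i : ℕ) < a
    · rw [if_pos h, if_pos (e.extendSubtype_mem i h)]
    · rw [if_neg h, if_neg (e.extendSubtype_not_mem i h)]
  have h2 := dl_mono_mul_rad (β := β') w (1 : Fin n → Fˣ)
  rw [hw] at h2
  refine ⟨a, ha, han, dl (mono w 1)⁻¹ * rad F β * x, fun h3 => h0 ?_⟩
  have h4 : rad F β * x * z = dl (mono w 1) *
      (rad F (bl n a) * (dl (mono w 1)⁻¹ * rad F β * x) * z) := by
    simp only [← mul_assoc]
    rw [h2, mul_assoc _ (dl _) (dl _), dl_mul_inv_self, mul_one, h1]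
  rw [h4, h3, mul_zero]

lemma exists_mul_of_not_isCusp {z : Gen ψ} (hz : ¬ IsCusp z) (hd : 0 < deg z) :
    ∃ x y : Gen ψ, deg x < deg z ∧ deg y < deg z ∧ z = x * y := by
  obtain ⟨n, z, hm⟩ := z
  simp only [IsCusp, hd, true_and, not_forall] at hz
  obtain ⟨β, hβ, x, h0⟩ := hz
  obtain ⟨a, ha, han, x, h0⟩ := exists_rad_bl_ne_zero hβ h0
  obtain ⟨b, h⟩ := Nat.exists_eq_add_of_le han.le
  replace h := h.symm
  have h1 : rad F (bl n a) * x * (gg ψ n * z) ≠ 0 := by rwa [hm.2.2.1]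
  obtain ⟨g, hg⟩ : ∃ g, rad F (bl n a) * dl g * (gg ψ n * z) ≠ 0 := by
    by_contra! hall
    exact h1 (sandwich_eq_zero hall x)
  obtain ⟨k, l₁, l₂, hk⟩ := exists_rad_mul_dl_mul_gg hψ.out h g
  obtain ⟨s, hs, hsum⟩ := exists_corner_decomposition (isGelfand_gg (n := a) hψ.out)
  obtain ⟨t, ht, htsum⟩ := exists_corner_decomposition (isGelfand_gg (n := b) hψ.out)
  rw [← mul_assoc, hk, pre_mul_gg, ← pre_mul_pre, ← hsum, ← htsum, pre_sum_sum,
    smul_mul_assoc] at hg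
  obtain ⟨x, hx, y, hy, hxy⟩ : ∃ x ∈ s, ∃ y ∈ t, xi ψ h x y * z ≠ 0 := by
    by_contra! hall
    apply hg
    rw [mul_assoc, mul_assoc, Finset.sum_mul, Finset.sum_eq_zero, mul_zero, smul_zero]
    intro x hx
    rw [Finset.sum_mul, Finset.sum_eq_zero]
    intro y hy
    rw [← mul_assoc]
    exact hall x hx y hy
  refine ⟨⟨a, x, (hs x).1 hx⟩, ⟨b, y, (ht y).1 hy⟩, ?_, ?_, (mul_eq h _ _ _ hxy).symm⟩
  · exact han
  · change b < n; omega

/-- Every minimal idempotent is a product of cuspidal ones. -/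
lemma exists_multiset_prod (z : Gen ψ) :
    ∃ s : Multiset (Gen ψ), (∀ x ∈ s, IsCusp x) ∧ s.prod = z := by
  induction hd : deg z using Nat.strong_induction_on generalizing z with
  | _ n ih =>
    subst hd
    rcases Nat.eq_zero_or_pos (deg z) with h0 | h0
    · exact ⟨0, by simp, by rw [eq_one_of_deg h0, Multiset.prod_zero]⟩
    by_cases hz : IsCusp z
    · exact ⟨{z}, by simpa using hz, by simp⟩
    obtain ⟨x, y, hx, hy, rfl⟩ := exists_mul_of_not_isCusp hz h0
    obtain ⟨s, hs, rfl⟩ := ih _ hx x rfl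
    obtain ⟨t, ht, rfl⟩ := ih _ hy y rfl
    exact ⟨s + t, fun x hx => (Multiset.mem_add.1 hx).elim (hs x) (ht x), Multiset.prod_add _ _⟩

end Gen

end Monoid

end GelfandGraev

namespace GelfandGraev

open Matrix

section Uniqueness

variable {F : Type*} [Field F] [Finite F] {ψ : AddChar F ℂ} {d d' n : ℕ}

lemma exists_dl_levi_mul {φ : Fin d ↪ Fin n} {β : Fin n → ℕ} {c : ℕ}
    (hφ : ∀ i, β i = c ↔ ∃ a, φ a = i) {l : GL (Fin n) F} (hl : l ∈ levi F β)
    {ε : GA (GL (Fin d) F)} {E : GA (GL (Fin n) F)} (hE : E * gmap (emb φ) ε = E) :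
    ∃ r g, E * dl l = E * dl r * gmap (emb φ) (ε * dl g) := by
  obtain ⟨g, r, -, rfl, h1, h2⟩ := exists_block_of_mem_levi hφ hl
  refine ⟨r, g, ?_⟩
  have h3 : gmap (emb φ) ε * dl r = dl r * gmap (emb φ) ε :=
    commute_gmap_left (fun a => by rw [← dl_mul, ← dl_mul, emb_commute_of_trivial h1 h2]) ε
  conv_lhs => rw [← hE]
  rw [dl_mul, map_mul, gmap_dl, mul_assoc E, ← mul_assoc _ (dl r), h3]
  simp only [mul_assoc]

lemma exists_mul_dl_levi {φ : Fin d ↪ Fin n} {β : Fin n → ℕ} {c : ℕ}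
    (hφ : ∀ i, β i = c ↔ ∃ a, φ a = i) {l : GL (Fin n) F} (hl : l ∈ levi F β)
    {ε : GA (GL (Fin d) F)} {E : GA (GL (Fin n) F)} (hE : gmap (emb φ) ε * E = E) :
    ∃ r g, dl l * E = gmap (emb φ) (dl g * ε) * (dl r * E) := by
  obtain ⟨r, g, h⟩ := exists_dl_levi_mul hφ (inv_mem hl) (ε := adj ε) (E := adj E)
    (by rw [← adj_gmap, ← adj_mul, hE])
  refine ⟨r⁻¹, g⁻¹, ?_⟩
  have := congrArg adj h
  simpa only [adj_mul, adj_adj, adj_dl, inv_inv, adj_gmap, mul_assoc] using this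

/-- Cuspidality forces a Bruhat cell to match blocks. -/
lemma const_of_ne_zero {φ : Fin d ↪ Fin n} {β β' : Fin n → ℕ} {c : ℕ}
    (hφ : ∀ i, β i = c ↔ ∃ a, φ a = i) {l : GL (Fin n) F} (hl : l ∈ levi F β)
    {ε : GA (GL (Fin d) F)}
    (hε : ∀ γ : Fin d → ℕ, (∃ i j, γ i ≠ γ j) → ∀ x, ε * x * rad F γ = 0)
    {E : GA (GL (Fin n) F)} (hE : E * gmap (emb φ) ε = E) {w : Equiv.Perm (Fin n)}
    {t : Fin n → Fˣ} {Y : GA (GL (Fin n) F)}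
    (h0 : E * dl l * rad F β * (dl (mono w t) * rad F β' * Y) ≠ 0) (i j : Fin n)
    (hi : β i = c) (hj : β j = c) : β' (w.symm i) = β' (w.symm j) := by
  by_contra hne
  apply h0
  obtain ⟨a, rfl⟩ := (hφ i).1 hi
  obtain ⟨b, rfl⟩ := (hφ j).1 hj
  let δ : Fin n → ℕ := β' ∘ w.symm
  have hδ : β' = δ ∘ w := by funext k; simp [δ]
  have h1 : dl (mono w t) * rad F β' = rad F δ * dl (mono w t) := by
    rw [hδ, dl_mono_mul_rad]
  have h2 : gmap (emb φ) (rad F (fun a => δ (φ a))) * rad F δ = rad F δ := by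
    refine map_avg_eq ((LinearMap.mulRight ℂ (rad F δ)).comp (gmap (emb φ)).toLinearMap)
      fun u => ?_
    simp only [LinearMap.comp_apply, AlgHom.toLinearMap_apply, gmap_dl, LinearMap.mulRight_apply]
    rw [dl_mul_rad (emb_mem_unip u.2), MonoidHom.one_apply, one_smul]
  have h3 : gmap (emb φ) (rad F (fun a => δ (φ a))) * rad F β =
      rad F β * gmap (emb φ) (rad F (fun a => δ (φ a))) :=
    rad_comm_gmap (fun a b => by rw [(hφ _).2 ⟨a, rfl⟩, (hφ _).2 ⟨b, rfl⟩]) _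
  obtain ⟨r, g, hrg⟩ := exists_dl_levi_mul hφ hl hE
  have h4 : ε * dl g * rad F (fun a => δ (φ a)) = 0 := hε _ ⟨a, b, hne⟩ _
  calc E * dl l * rad F β * (dl (mono w t) * rad F β' * Y)
      = E * dl l * (rad F β * gmap (emb φ) (rad F (fun a => δ (φ a)))) *
          (rad F δ * dl (mono w t) * Y) := by
        rw [h1]; conv_lhs => rw [← h2]
        simp only [mul_assoc]
    _ = E * dl r * gmap (emb φ) (ε * dl g * rad F (fun a => δ (φ a))) * rad F β *
          (rad F δ * dl (mono w t) * Y) := by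
        rw [← h3, hrg, map_mul (gmap (emb φ)) (ε * dl g)]; simp only [mul_assoc]
    _ = 0 := by rw [h4, map_zero, mul_zero, zero_mul, zero_mul]

lemma emb_mono_conj {φ φ' : Fin d ↪ Fin n} {w : Equiv.Perm (Fin n)} (t : Fin n → Fˣ)
    {q : Equiv.Perm (Fin d)} (hq : ∀ a, w (φ' a) = φ (q a)) (g : GL (Fin d) F) :
    emb φ (mono q (t ∘ φ') * g * (mono q (t ∘ φ'))⁻¹) =
      mono w t * emb φ' g * (mono w t)⁻¹ := by
  symm
  refine eq_emb_iff (fun a b => ?_) (fun i j hij => ?_)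
  · obtain ⟨a, rfl⟩ := q.surjective a
    obtain ⟨b, rfl⟩ := q.surjective b
    rw [← hq, ← hq, mono_mul_val_mul_inv, mono_mul_val_mul_inv, emb_apply_apply]; rfl
  · obtain ⟨i, rfl⟩ := w.surjective i
    obtain ⟨j, rfl⟩ := w.surjective j
    have key : ∀ i, (∀ a, φ a ≠ w i) → ∀ a, φ' a ≠ i := by
      rintro i hi a rfl
      exact hi _ (hq a).symm
    rw [mono_mul_val_mul_inv]
    have h1 : (emb φ' g).val i j = (1 : Matrix _ _ F) i j := by
      rcases hij with h | h
      · exact emb_apply_of_notMem_left _ _ (key i h) _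
      · exact emb_apply_of_notMem_right _ _ _ (key j h)
    rw [h1]
    by_cases h : i = j
    · subst h; simp
    · rw [Matrix.one_apply_ne h, Matrix.one_apply_ne (fun hc => h (w.injective hc))]; simp

lemma gmap_emb_mul_dl_mono {φ φ' : Fin d ↪ Fin n} {w : Equiv.Perm (Fin n)} (t : Fin n → Fˣ)
    {q : Equiv.Perm (Fin d)} (hq : ∀ a, w (φ' a) = φ (q a)) (y : GA (GL (Fin d) F)) :
    gmap (emb φ) y * dl (mono w t) =
      dl (mono w t) * gmap (emb φ') (dl (mono q (t ∘ φ'))⁻¹ * y * dl (mono q (t ∘ φ'))) := by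
  refine lin_ext (f := (LinearMap.mulRight ℂ (dl (mono w t))).comp (gmap (emb φ)).toLinearMap)
    (f' := (LinearMap.mulLeft ℂ (dl (mono w t))).comp ((gmap (emb φ')).toLinearMap.comp
      ((LinearMap.mulRight ℂ (dl (mono q (t ∘ φ')))).comp
        (LinearMap.mulLeft ℂ (dl (mono q (t ∘ φ'))⁻¹))))) (fun g => ?_) y
  simp only [LinearMap.comp_apply, AlgHom.toLinearMap_apply, gmap_dl, LinearMap.mulLeft_apply,
    LinearMap.mulRight_apply, ← dl_mul]
  congr 1
  have := emb_mono_conj t hq ((mono q (t ∘ φ'))⁻¹ * g * mono q (t ∘ φ'))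
  rw [show mono q (t ∘ φ') * ((mono q (t ∘ φ'))⁻¹ * g * mono q (t ∘ φ')) * (mono q (t ∘ φ'))⁻¹ = g
    by group] at this
  rw [this, inv_mul_cancel_right]

lemma eq_of_blocks [hψ : Fact (ψ ≠ 1)] {ε : GA (GL (Fin d) F)} {ε' : GA (GL (Fin d') F)}
    (hε : IsMin (gg ψ d) ε) (hε' : IsMin (gg ψ d') ε')
    {φ : Fin d ↪ Fin n} {φ' : Fin d' ↪ Fin n} {β β' : Fin n → ℕ} {c c' : ℕ}
    (hφ : ∀ i, β i = c ↔ ∃ a, φ a = i) (hφ' : ∀ i, β' i = c' ↔ ∃ a, φ' a = i)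
    {l l' : GL (Fin n) F} (hl : l ∈ levi F β) (hl' : l' ∈ levi F β')
    {E E' : GA (GL (Fin n) F)} (hE : E * gmap (emb φ) ε = E) (hE' : gmap (emb φ') ε' * E' = E')
    {w : Equiv.Perm (Fin n)} {t : Fin n → Fˣ}
    (hw : ∀ i, β' i = c' ↔ β (w i) = c)
    (h0 : E * dl l * rad F β * (dl (mono w t) * rad F β' * (dl l' * E')) ≠ 0) :
    (⟨d, ε, hε⟩ : Gen ψ) = ⟨d', ε', hε'⟩ := by
  have h1 : ∀ a, ∃ b, φ b = w (φ' a) := fun a => (hφ _).1 ((hw _).1 ((hφ' _).2 ⟨a, rfl⟩))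
  have h2 : ∀ b, ∃ a, φ' a = w.symm (φ b) := fun b =>
    (hφ' _).1 ((hw _).2 (by rw [w.apply_symm_apply]; exact (hφ _).2 ⟨b, rfl⟩))
  choose q hq using h1
  choose q' hq' using h2
  have hqi : Function.Injective q := fun a b hab => by
    have := hq a
    rw [hab, hq b] at this
    exact (φ'.injective (w.injective this)).symm
  have hqi' : Function.Injective q' := fun a b hab => by
    have := hq' a
    rw [hab, hq' b] at this
    exact (φ.injective (w.symm.injective this)).symm
  obtain rfl : d = d' := le_antisymm (by simpa using Fintype.card_le_of_injective _ hqi')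
    (by simpa using Fintype.card_le_of_injective _ hqi)
  let q₀ : Equiv.Perm (Fin d) := Equiv.ofBijective q (Finite.injective_iff_bijective.1 hqi)
  obtain ⟨r, g, hrg⟩ := exists_dl_levi_mul hφ hl hE
  obtain ⟨r', g', hrg'⟩ := exists_mul_dl_levi hφ' hl' hE'
  let m := mono q₀ (t ∘ φ')
  have h3 : gmap (emb φ) (ε * dl g) * rad F β = rad F β * gmap (emb φ) (ε * dl g) :=
    rad_comm_gmap (fun a b => by rw [(hφ _).2 ⟨a, rfl⟩, (hφ _).2 ⟨b, rfl⟩]) _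
  have h4 : gmap (emb φ') (dl g' * ε') * rad F β' = rad F β' * gmap (emb φ') (dl g' * ε') :=
    rad_comm_gmap (fun a b => by rw [(hφ' _).2 ⟨a, rfl⟩, (hφ' _).2 ⟨b, rfl⟩]) _
  have h5 := gmap_emb_mul_dl_mono t (φ := φ) (φ' := φ') (q := q₀) (fun a => (hq a).symm)
    (ε * dl g)
  have key : E * dl l * rad F β * (dl (mono w t) * rad F β' * (dl l' * E')) =
      E * dl r * rad F β * dl (mono w t) *
        gmap (emb φ') (dl m⁻¹ * (ε * (dl g * dl m * dl g') * ε')) * rad F β' * (dl r' * E') := by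
    calc _ = E * dl r * (gmap (emb φ) (ε * dl g) * rad F β) * (dl (mono w t) * (rad F β' *
            gmap (emb φ') (dl g' * ε')) * (dl r' * E')) := by
          rw [hrg, hrg']; simp only [mul_assoc]
      _ = E * dl r * rad F β * (gmap (emb φ) (ε * dl g) * dl (mono w t)) *
            gmap (emb φ') (dl g' * ε') * rad F β' * (dl r' * E') := by
          rw [h3, ← h4]; simp only [mul_assoc]
      _ = _ := by
          rw [h5]
          simp only [map_mul, mul_assoc, m]
  have h6 : ε = ε' := by
    refine IsMin.eq_of_mul_mul_ne_zero (isGelfand_gg hψ.out) hε hε' (x := dl g * dl m * dl g') ?_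
    intro h
    apply h0
    rw [key, h, mul_zero, map_zero, mul_zero, zero_mul, zero_mul]
  exact Sigma.ext rfl (heq_of_eq (Subtype.ext h6))

end Uniqueness

end GelfandGraev

namespace GelfandGraev

open Matrix

section Support

variable {F : Type*} [Field F] [Finite F] {ψ : AddChar F ℂ} {n : ℕ}

lemma gmap_mul_adj [hψ : Fact (ψ ≠ 1)] {d : ℕ} {φ : Fin d ↪ Fin n} {ε : GA (GL (Fin d) F)}
    (hε : IsMin (gg ψ d) ε) {E : GA (GL (Fin n) F)} (h : E * gmap (emb φ) ε = E) :
    gmap (emb φ) ε * adj E = adj E := by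
  have := congrArg adj h
  rwa [adj_mul, adj_gmap, IsMin.adj_eq (isGelfand_gg hψ.out) hε] at this

/-- A witness that `z` occurs in the parabolic induction of the family `c`. -/
structure Supp {κ : Type} (c : κ → Gen ψ) (z : GA (GL (Fin n) F)) where
  b : Fin n → κ
  r : κ → ℕ
  r_inj : Function.Injective r
  φ : ∀ k, Fin (c k).deg ↪ Fin n
  range : ∀ k i, b i = k ↔ ∃ a, φ k a = i
  E : GA (GL (Fin n) F)
  mul_left : ∀ k, gmap (emb (φ k)) (c k).2.1 * E = E
  mul_right : ∀ k, E * gmap (emb (φ k)) (c k).2.1 = E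
  x : GA (GL (Fin n) F)
  ne_zero : E * rad F (r ∘ b) * x * z ≠ 0

namespace Supp

variable {κ κ' : Type} {c : κ → Gen ψ} {c' : κ' → Gen ψ} {z : GA (GL (Fin n) F)}

lemma range' (S : Supp c z) (k : κ) (i : Fin n) : (S.r ∘ S.b) i = S.r k ↔ ∃ a, S.φ k a = i :=
  (S.r_inj.eq_iff).trans (S.range k i)

lemma exists_equiv [hψ : Fact (ψ ≠ 1)] (hz : IsMin (gg ψ n) z) (S : Supp c z) (S' : Supp c' z)
    (hc : ∀ k, (c k).IsCusp) (hc' : ∀ k, (c' k).IsCusp) :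
    ∃ σ : κ ≃ κ', ∀ k, c k = c' (σ k) := by
  have hG := isGelfand_gg (n := n) hψ.out
  have hcusp : ∀ y : Gen ψ, y.IsCusp → ∀ γ : Fin y.1 → ℕ, (∃ i j, γ i ≠ γ j) → ∀ x,
      y.2.1 * x * rad F γ = 0 := by
    intro y hy γ hγ x
    have h1 := congrArg adj (hy.2 γ hγ (adj x))
    rwa [adj_mul, adj_mul, adj_adj, adj_rad, map_zero,
      IsMin.adj_eq (isGelfand_gg hψ.out) y.2.2, ← mul_assoc] at h1
  have hsurj : Function.Surjective S.b := fun k =>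
    ⟨S.φ k ⟨0, (hc k).1⟩, (S.range _ _).2 ⟨_, rfl⟩⟩
  have hsurj' : Function.Surjective S'.b := fun k =>
    ⟨S'.φ k ⟨0, (hc' k).1⟩, (S'.range _ _).2 ⟨_, rfl⟩⟩
  have h1 : z * (adj S'.x * rad F (S'.r ∘ S'.b) * adj S'.E) ≠ 0 := by
    have := adj_ne_zero S'.ne_zero
    simpa only [adj_mul, adj_rad, IsMin.adj_eq hG hz, mul_assoc] using this
  have h2 := IsMin.mul_ne_zero' hG hz S.ne_zero h1
  obtain ⟨g, hg⟩ : ∃ g, S.E * rad F (S.r ∘ S.b) * dl g * (rad F (S'.r ∘ S'.b) * adj S'.E) ≠ 0 := by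
    by_contra! hall
    apply h2
    rw [← sandwich_eq_zero hall (S.x * z * adj S'.x)]
    simp only [mul_assoc]
  have hbr : ∀ β : Fin n → ℕ, ∃ R : Fin n → ℕ, Function.Injective R ∧
      ∀ i j, β i < β j → R i < R j := by
    intro β
    have hlt : ∀ i j : Fin n, β i < β j → (i : ℕ) + n * β i < j + n * β j := by
      intro i j hij
      have := Nat.mul_le_mul_left n hij
      rw [Nat.succ_eq_add_one, mul_add, mul_one] at this
      omega
    refine ⟨fun i => i + n * β i, fun i j hij => ?_, hlt⟩
    rcases lt_trichotomy (β i) (β j) with h | h | h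
    · exact absurd hij (hlt _ _ h).ne
    · simp only [h] at hij
      exact Fin.ext (by omega)
    · exact absurd hij (hlt _ _ h).ne'
  obtain ⟨R, hR, hR'⟩ := hbr (S.r ∘ S.b)
  obtain ⟨Q, hQ, hQ'⟩ := hbr (S'.r ∘ S'.b)
  obtain ⟨u, hu, v, hv, w, t, rfl⟩ := bruhat hR hQ g
  obtain ⟨l, hl, -, hul, -⟩ := dl_para_mul_rad (unip_le_para_of_refines hR' hu)
  obtain ⟨l', hl', -, -, hvl⟩ := dl_para_mul_rad (unip_le_para_of_refines hQ' hv)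
  have h3 : S.E * dl l * rad F (S.r ∘ S.b) *
      (dl (mono w t) * rad F (S'.r ∘ S'.b) * (dl l' * adj S'.E)) ≠ 0 := by
    convert hg using 1
    calc _ = S.E * (dl l * rad F (S.r ∘ S.b)) *
          (dl (mono w t) * (rad F (S'.r ∘ S'.b) * dl l') * adj S'.E) := by simp only [mul_assoc]
      _ = S.E * (rad F (S.r ∘ S.b) * dl u) *
          (dl (mono w t) * (dl v * rad F (S'.r ∘ S'.b)) * adj S'.E) := by
        rw [dl_levi_mul_rad hl, ← dl_levi_mul_rad hl', hul, hvl]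
      _ = _ := by simp only [dl_mul, mul_assoc]
  obtain ⟨t', ht'⟩ := exists_mono_inv w t
  have h4 : S'.E * dl l'⁻¹ * rad F (S'.r ∘ S'.b) *
      (dl (mono w⁻¹ t') * rad F (S.r ∘ S.b) * (dl l⁻¹ * adj S.E)) ≠ 0 := by
    have := adj_ne_zero h3
    simpa only [adj_mul, adj_rad, adj_adj, adj_dl, ht', mul_assoc] using this
  have c1 : ∀ i j, S.b i = S.b j → S'.b (w.symm i) = S'.b (w.symm j) := fun i j hij =>
    S'.r_inj (const_of_ne_zero (S.range' (S.b j)) hl (hcusp _ (hc _)) (S.mul_right _) h3 i j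
      (congrArg S.r hij) rfl)
  have c2 : ∀ i j, S'.b i = S'.b j → S.b (w i) = S.b (w j) := fun i j hij =>
    S.r_inj (const_of_ne_zero (S'.range' (S'.b j)) (inv_mem hl') (hcusp _ (hc' _))
      (S'.mul_right _) h4 i j (congrArg S'.r hij) rfl)
  have e1 : ∀ i, S'.b (w.symm (Function.surjInv hsurj (S.b i))) = S'.b (w.symm i) := fun i =>
    c1 _ _ (Function.surjInv_eq hsurj _)
  have e2 : ∀ i, S.b (w (Function.surjInv hsurj' (S'.b i))) = S.b (w i) := fun i =>
    c2 _ _ (Function.surjInv_eq hsurj' _)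
  refine ⟨⟨fun k => S'.b (w.symm (Function.surjInv hsurj k)),
    fun k => S.b (w (Function.surjInv hsurj' k)), fun k => ?_, fun k => ?_⟩, fun k => ?_⟩
  · obtain ⟨i, rfl⟩ := hsurj k
    simp only [e1, e2, Equiv.apply_symm_apply]
  · obtain ⟨i, rfl⟩ := hsurj' k
    simp only [e1, e2, Equiv.symm_apply_apply]
  · obtain ⟨i₀, rfl⟩ := hsurj k
    simp only [Equiv.coe_fn_mk, e1]
    refine eq_of_blocks (c (S.b i₀)).2.2 (c' (S'.b (w.symm i₀))).2.2 (S.range' _) (S'.range' _)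
      hl hl' (S.mul_right _) (gmap_mul_adj (c' _).2.2 (S'.mul_right _)) (fun i => ?_) h3
    simp only [Function.comp, S.r_inj.eq_iff, S'.r_inj.eq_iff]
    constructor
    · intro h
      have := c2 _ _ h
      rwa [Equiv.apply_symm_apply] at this
    · intro h
      have := c1 _ _ h
      rwa [Equiv.symm_apply_apply] at this

end Supp

end Support

end GelfandGraev

namespace GelfandGraev

open Matrix

section Existence

variable {F : Type*} [Field F] [Finite F] {ψ : AddChar F ℂ} [hψ : Fact (ψ ≠ 1)] {n a b : ℕ}

namespace Supp

/-- The support of the unit. -/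
noncomputable def one : Supp (PEmpty.elim : PEmpty → Gen ψ) (1 : Gen ψ).2.1 where
  b i := absurd i.2 (Nat.not_lt_zero _)
  r k := k.elim
  r_inj k := k.elim
  φ k := k.elim
  range k := k.elim
  E := 1
  mul_left k := k.elim
  mul_right k := k.elim
  x := 1
  ne_zero := by
    rw [one_mul, mul_one, rad_mul_eq]
    · exact (1 : Gen ψ).2.2.1
    · intro u _
      rw [Subsingleton.elim (h := inferInstanceAs (Subsingleton (GL (Fin 0) F))) u 1, dl_one,
        one_mul]

/-- The labelling of the blocks after adding a block in front. -/
def consLabel {κ : Type} (h : a + b = n) (l : Fin b → κ) (i : Fin n) : Option κ :=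
  if hi : (i : ℕ) < a then none else some (l ⟨i - a, by omega⟩)

lemma consLabel_lo {κ : Type} (h : a + b = n) (l : Fin b → κ) (i : Fin a) :
    consLabel h l (lo h i) = none := by simp [consLabel]

lemma consLabel_hi {κ : Type} (h : a + b = n) (l : Fin b → κ) (i : Fin b) :
    consLabel h l (hi h i) = some (l i) := by simp [consLabel]

omit [Finite F] in
lemma gmap_emb_trans (φ : Fin a ↪ Fin b) (φ' : Fin b ↪ Fin n) (x : GA (GL (Fin a) F)) :
    gmap (emb (φ.trans φ')) x = gmap (emb φ') (gmap (emb φ) x) := by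
  rw [← emb_comp, gmap_gmap]

lemma gmap_hi_mul_of_mul_eq (h : a + b = n) (μ : GA (GL (Fin a) F)) {x y : GA (GL (Fin b) F)}
    (hxy : x * y = y) :
    gmap (emb (hi h)) x * (gmap (emb (lo h)) μ * gmap (emb (hi h)) y) =
      gmap (emb (lo h)) μ * gmap (emb (hi h)) y := by
  rw [← mul_assoc, ← lo_commute_hi, mul_assoc, ← map_mul, hxy]

lemma nonempty_cons {κ : Type} [Fintype κ] {c : κ → Gen ψ} (h : a + b = n)
    {μ : GA (GL (Fin a) F)} {z : GA (GL (Fin b) F)} {z' : GA (GL (Fin n) F)}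
    (hμ : IsMin (gg ψ a) μ) (hz : IsMin (gg ψ b) z) (hz' : IsMin (gg ψ n) z')
    (h0 : xi ψ h μ z * z' ≠ 0) (S : Supp c z) :
    Nonempty (Supp (fun o : Option κ => o.elim ⟨a, μ, hμ⟩ c) z') := by
  let r' : Option κ → ℕ := fun o => o.elim (∑ k, S.r k + 1) S.r
  have hr : ∀ k, S.r k < ∑ k, S.r k + 1 := fun k =>
    Nat.lt_succ_of_le (Finset.single_le_sum (f := S.r) (fun _ _ => Nat.zero_le _)
      (Finset.mem_univ k))
  have hrad : rad F (bl n a) * gmap (emb (hi h)) (rad F (S.r ∘ S.b)) =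
      rad F (r' ∘ consLabel h S.b) := by
    refine rad_mul_gmap_rad (fun i j hij => ?_) (fun i j => ?_) (fun i j hij hlt => ?_)
    · rcases lo_or_hi h i with ⟨i, rfl⟩ | ⟨i, rfl⟩ <;> rcases lo_or_hi h j with ⟨j, rfl⟩ | ⟨j, rfl⟩
      · simp
      · simp
      · simp only [Function.comp, consLabel_lo, consLabel_hi, r', Option.elim] at hij
        exact absurd hij (not_le.2 (hr _))
      · simp
    · simp [consLabel_hi, r']
    · rcases lo_or_hi h i with ⟨i, rfl⟩ | ⟨i, rfl⟩ <;> rcases lo_or_hi h j with ⟨j, rfl⟩ | ⟨j, rfl⟩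
      · simp [consLabel_lo] at hlt
      · simp at hij
      · simp at hij
      · exact ⟨⟨_, rfl⟩, ⟨_, rfl⟩⟩
  refine ⟨{
    b := consLabel h S.b
    r := r'
    r_inj := ?_
    φ := fun o => match o with
      | none => lo h
      | some k => (S.φ k).trans (hi h)
    range := ?_
    E := gmap (emb (lo h)) μ * gmap (emb (hi h)) S.E
    mul_left := ?_
    mul_right := ?_
    x := gmap (emb (hi h)) (S.x * z)
    ne_zero := ?_ }⟩
  · rintro (_ | k) (_ | k') hkk
    · rfl
    · exact absurd hkk (hr k').ne'
    · exact absurd hkk (hr k).ne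
    · exact congrArg some (S.r_inj hkk)
  · rintro (_ | k) i <;> rcases lo_or_hi h i with ⟨i, rfl⟩ | ⟨i, rfl⟩
    · simp only [consLabel_lo, true_iff]; exact ⟨i, rfl⟩
    · simp only [consLabel_hi, reduceCtorEq, false_iff]
      rintro ⟨j, hj⟩
      exact lo_ne_hi h j i hj
    · simp only [consLabel_lo, reduceCtorEq, false_iff]
      rintro ⟨j, hj⟩
      exact lo_ne_hi h i _ hj.symm
    · rw [consLabel_hi, Option.some_inj, S.range]
      exact exists_congr fun j => (hi h).injective.eq_iff.symm
  · rintro (_ | k)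
    · change gmap (emb (lo h)) μ * _ = _
      rw [← mul_assoc, ← map_mul, hμ.2.1]
    · exact (congrArg (· * _) (gmap_emb_trans (S.φ k) (hi h) (c k).2.1)).trans
        (gmap_hi_mul_of_mul_eq h μ (S.mul_left k))
  · rintro (_ | k)
    · change _ * gmap (emb (lo h)) μ = _
      rw [mul_assoc, ← lo_commute_hi, ← mul_assoc, ← map_mul, hμ.2.1]
    · refine (congrArg (_ * ·) (gmap_emb_trans (S.φ k) (hi h) (c k).2.1)).trans ?_
      exact (mul_assoc _ _ _).trans (congrArg (_ * ·) ((map_mul _ _ _).symm.trans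
        (congrArg _ (S.mul_right k))))
  · have e1 : gmap (emb (lo h)) μ * gmap (emb (hi h)) S.E * rad F (r' ∘ consLabel h S.b) *
        gmap (emb (hi h)) (S.x * z) = pre h μ (S.E * rad F (S.r ∘ S.b) * S.x * z) := by
      rw [← hrad, ← mul_assoc, mul_assoc _ _ (rad F (bl n a)), hi_comm_rad, ← mul_assoc,
        lo_comm_rad]
      simp only [pre, map_mul, mul_assoc]
    rw [e1]
    intro h1
    refine pre_mul_gg_ne_zero (ψ := ψ) h hμ.1 S.ne_zero hμ.2.2.2.1
      (by rw [mul_assoc, hz.2.2.2.1]) ?_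
    have e2 : pre h μ (S.E * rad F (S.r ∘ S.b) * S.x * z) * gg ψ n =
        pre h 1 (S.E * rad F (S.r ∘ S.b) * S.x) * xi ψ h μ z := by
      rw [xi, ← mul_assoc, pre_mul_pre, one_mul]
    rw [e2, ← xi_mul_eq_of_ne_zero hψ.out h hμ hz hz' h0, ← mul_assoc, ← e2, mul_assoc, hz'.2.2.1,
      h1]

lemma exists_supp (s : Multiset (Gen ψ)) :
    ∃ (κ : Type) (_ : Fintype κ) (c : κ → Gen ψ), Finset.univ.val.map c = s ∧
      Nonempty (Supp c s.prod.2.1) := by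
  induction s using Multiset.induction with
  | empty => exact ⟨PEmpty, inferInstance, _, rfl, ⟨Supp.one⟩⟩
  | cons μ s ih =>
    obtain ⟨κ, _, c, hc, ⟨S⟩⟩ := ih
    refine ⟨Option κ, inferInstance, fun o => o.elim μ c, ?_, ?_⟩
    · rw [univ_option, ← hc]
      simp [Finset.insertNone, Multiset.map_map, Function.comp_def]
    · rw [Multiset.prod_cons]
      have hs := (exists_xi_mul_ne_zero hψ.out rfl μ.2.2 s.prod.2.2).choose_spec
      exact nonempty_cons rfl μ.2.2 s.prod.2.2 hs.1 hs.2 S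

end Supp

namespace Gen

lemma multiset_prod_injective {s t : Multiset (Gen ψ)} (hs : ∀ x ∈ s, IsCusp x)
    (ht : ∀ x ∈ t, IsCusp x) (h : s.prod = t.prod) : s = t := by
  obtain ⟨κ, _, c, rfl, ⟨S⟩⟩ := Supp.exists_supp s
  obtain ⟨κ', _, c', rfl, ⟨S'⟩⟩ := Supp.exists_supp t
  rw [← h] at S'
  obtain ⟨σ, hσ⟩ := S.exists_equiv (Multiset.prod (Finset.univ.val.map c)).2.2 S'
    (fun k => hs _ (by simp))
    (fun k => ht _ (by simp))
  rw [funext hσ, ← Function.comp_def c' σ, ← Multiset.map_map]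
  congr 1
  exact congrArg Finset.val (Finset.map_univ_equiv σ)

end Gen

end Existence

end GelfandGraev

namespace GelfandGraev

open Matrix

section Whittaker

variable {F : Type*} [Field F] {n : ℕ}

lemma exists_row {j i₀ l : Fin n} {w : Fin n → F} (hi : i₀ < j) (hw : w i₀ ≠ 0) (hl : l < j) :
    ∃ h : GL (Fin n) F, (∀ i k, j ≤ i ∨ j ≤ k → h.val i k = (1 : Matrix (Fin n) (Fin n) F) i k) ∧
      ∀ k < j, h.val l k = w k := by
  let w' : Fin n → F := fun k => if k < j then w k else 0
  let M : Matrix (Fin n) (Fin n) F := ((1 : Matrix (Fin n) (Fin n) F).updateCol i₀ w')ᵀ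
  have hM : M.det ≠ 0 := by
    rw [det_transpose, ← cramer_apply, cramer_one]
    simpa [w', hi] using hw
  have key : ∀ i k, (mono (Equiv.swap i₀ l) 1 * GeneralLinearGroup.mkOfDetNeZero M hM).val i k =
      M (Equiv.swap i₀ l i) k := by
    intro i k
    have := mono_mul_apply (Equiv.swap i₀ l) (1 : Fin n → Fˣ) M (Equiv.swap i₀ l i) k
    rw [Equiv.swap_apply_self, Pi.one_apply, Units.val_one, one_mul] at this
    exact this
  refine ⟨_, fun i k hik => (key i k).trans ?_, fun k hk => (key l k).trans ?_⟩
  · simp only [M, transpose_apply, updateCol_apply, w', one_apply]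
    by_cases h1 : i = i₀
    · subst h1
      rw [Equiv.swap_apply_left]
      grind
    by_cases h2 : i = l
    · subst h2
      rw [Equiv.swap_apply_right]
      grind
    rw [Equiv.swap_apply_of_ne_of_ne h1 h2]
    grind
  · simp [M, w', hk]

variable [Finite F]

/-- Unipotent matrices whose first `j` columns are trivial. -/
def colUni (F : Type*) [Field F] [Finite F] (n j : ℕ) : Subgroup (GL (Fin n) F) :=
  unip F fun i : Fin n => max ((i : ℕ) + 1) j

lemma mem_colUni {j : ℕ} {u : GL (Fin n) F} : u ∈ colUni F n j ↔
    ∀ i k : Fin n, (k ≤ i ∨ (k : ℕ) < j) → u.val i k = (1 : Matrix (Fin n) (Fin n) F) i k := by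
  refine forall₂_congr fun i k => ?_
  have : max ((k : ℕ) + 1) j ≤ max ((i : ℕ) + 1) j ↔ (k ≤ i ∨ (k : ℕ) < j) := by
    rw [Fin.le_def]; omega
  rw [this]

/-- The contribution of a row to a character of `colUni`. -/
def rowTerm (j : Fin n) (w : Fin n → F) (M : Matrix (Fin n) (Fin n) F) (i : Fin n) : F :=
  if i < j then w i * M i j else ∑ k : Fin n, if (k : ℕ) = i + 1 then M i k else 0

lemma rowTerm_mul {j : Fin n} {w : Fin n → F} {u v : GL (Fin n) F} (hu : u ∈ colUni F n j)
    (hv : v ∈ colUni F n j) (i : Fin n) :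
    rowTerm j w (u * v).val i = rowTerm j w u.val i + rowTerm j w v.val i := by
  rw [mem_colUni] at hu hv
  have key : ∀ k : Fin n, i < k → (∀ l, i < l → l < k → u.val i l = 0 ∨ v.val l k = 0) →
      (u * v).val i k = u.val i k + v.val i k := by
    intro k hik h
    rw [Units.val_mul, Matrix.mul_apply]
    rw [Finset.sum_eq_add_of_mem i k (Finset.mem_univ _) (Finset.mem_univ _) hik.ne]
    · rw [hu i i (Or.inl le_rfl), hv k k (Or.inl le_rfl), one_apply_eq, one_apply_eq]; ring
    · rintro l - ⟨h1, h2⟩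
      rcases lt_or_gt_of_ne h1 with h1 | h1
      · rw [hu i l (Or.inl h1.le), one_apply_ne h1.ne', zero_mul]
      rcases lt_or_gt_of_ne h2 with h2 | h2
      · rcases h l h1 h2 with h | h <;> simp [h]
      · rw [hv l k (Or.inl h2.le), one_apply_ne h2.ne', mul_zero]
  unfold rowTerm
  split_ifs with hij
  · rw [key j hij, mul_add]
    intro l h1 h2
    left
    rw [hu i l (Or.inr h2), one_apply_ne h1.ne]
  · rw [← Finset.sum_add_distrib]
    refine Finset.sum_congr rfl fun k _ => ?_
    split_ifs with hk
    · rw [key k (Fin.lt_def.2 (by omega))]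
      intro l h1 h2
      rw [Fin.lt_def] at h1 h2
      omega
    · rw [add_zero]

/-- The characters of `colUni F n j` which extend the generic character. -/
noncomputable def colChar (ψ : AddChar F ℂ) (j : Fin n) (w : Fin n → F) : colUni F n j →* ℂ where
  toFun u := ψ (∑ i, rowTerm j w u.1.val i)
  map_one' := by
    rw [Finset.sum_eq_zero, AddChar.map_zero_eq_one]
    intro i _
    unfold rowTerm
    split_ifs with h
    · rw [OneMemClass.coe_one, Units.val_one, one_apply_ne h.ne, mul_zero]
    · refine Finset.sum_eq_zero fun k _ => ?_
      split_ifs with h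
      · rw [OneMemClass.coe_one, Units.val_one, one_apply_ne]; rintro rfl; omega
      · rfl
  map_mul' u v := by
    rw [← AddChar.map_add_eq_mul, ← Finset.sum_add_distrib]
    exact congrArg ψ (Finset.sum_congr rfl fun i _ => rowTerm_mul u.2 v.2 i)

lemma colChar_apply (ψ : AddChar F ℂ) (j : Fin n) (w : Fin n → F) (u : colUni F n j) :
    colChar ψ j w u = ψ (∑ i, rowTerm j w u.1.val i) := rfl

end Whittaker

end GelfandGraev

namespace GelfandGraev

open Matrix

section Rep

variable {G : Type*} [Group G] {V : Type*} [AddCommGroup V] [Module ℂ V] (ρ : Representation ℂ G V)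

lemma rep_dl (g : G) : ρ.asAlgebraHom (dl g) = ρ g := Representation.asAlgebraHom_single_one ρ g

lemma rep_dl_mul (g : G) (x : GA G) (v : V) :
    ρ.asAlgebraHom (dl g * x) v = ρ g (ρ.asAlgebraHom x v) := by
  rw [map_mul, Module.End.mul_apply, rep_dl]

variable [Finite G] {H : Subgroup G} {χ : H →* ℂ}

lemma rep_avg_apply (h : H) (v : V) :
    ρ h (ρ.asAlgebraHom (avg H χ) v) = χ h • ρ.asAlgebraHom (avg H χ) v := by
  rw [← rep_dl_mul, dl_mul_avg, map_smul, LinearMap.smul_apply]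

omit [Finite G] in
lemma rep_avg_eq_sum [Fintype H] (v : V) : ρ.asAlgebraHom (avg H χ) v =
    (Nat.card H : ℂ)⁻¹ • ∑ h : H, χ h⁻¹ • ρ h v := by
  rw [avg, finsum_eq_sum_of_fintype, map_smul, map_sum, LinearMap.smul_apply, LinearMap.sum_apply]
  simp only [map_smul, LinearMap.smul_apply, rep_dl]

lemma rep_avg_eq_self {v : V} (h : ∀ u : H, ρ u v = χ u • v) : ρ.asAlgebraHom (avg H χ) v = v := by
  have := Fintype.ofFinite H
  rw [rep_avg_eq_sum, Finset.sum_congr rfl (g := fun _ => v), Finset.sum_const, Finset.card_univ,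
    ← Nat.card_eq_fintype_card, ← Nat.cast_smul_eq_nsmul ℂ, smul_smul,
    inv_mul_cancel₀ (natCard_ne_zero_subgroup H), one_smul]
  intro u _
  rw [h, smul_smul, ← map_mul, inv_mul_cancel, map_one, one_smul]

end Rep

section Whittaker

variable {F : Type*} [Field F] [Finite F] {n : ℕ}

omit [Finite F] in
lemma sum_rowTerm_eq (j : Fin n) (w : Fin n → F) (M : Matrix (Fin n) (Fin n) F) :
    ∑ i, rowTerm j w M i = ∑ i, w i * (if i < j then M i j else 0) + ∑ i, rowTerm j 0 M i := by
  rw [← Finset.sum_add_distrib]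
  refine Finset.sum_congr rfl fun i _ => ?_
  unfold rowTerm
  split_ifs <;> simp

lemma sum_rowTerm_of_mem {j : Fin n} (w : Fin n → F) {u : GL (Fin n) F}
    (hu : u ∈ colUni F n (j + 1)) : ∑ i, rowTerm j w u.val i = superSum u.val := by
  rw [mem_colUni] at hu
  refine Finset.sum_congr rfl fun i _ => ?_
  unfold rowTerm
  split_ifs with h
  · rw [hu i j (Or.inr (by omega)), one_apply_ne h.ne, mul_zero, Finset.sum_eq_zero]
    intro k _
    rw [Fin.lt_def] at h
    split_ifs with hk
    · rw [hu i k (Or.inr (by omega)), one_apply_ne]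
      rintro rfl; omega
    · rfl
  · rfl

lemma superSum_of_mem {j l : Fin n} (hl : (l : ℕ) + 1 = j) {u : GL (Fin n) F}
    (hu : u ∈ colUni F n j) : superSum u.val = u.val l j + ∑ i, rowTerm j 0 u.val i := by
  rw [mem_colUni] at hu
  have : u.val l j = ∑ i, if i = l then u.val l j else 0 := by simp
  rw [this, ← Finset.sum_add_distrib]
  refine Finset.sum_congr rfl fun i _ => ?_
  unfold rowTerm
  by_cases hi : i = l
  · subst hi
    rw [if_pos rfl, if_pos (Fin.lt_def.2 (by omega)), Finset.sum_eq_single j]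
    · simp [hl]
    · intro k _ hk
      rw [if_neg]
      intro h
      exact hk (Fin.ext (by omega))
    · simp
  rw [if_neg hi, zero_add]
  split_ifs with h
  · rw [Pi.zero_apply, zero_mul]
    refine Finset.sum_eq_zero fun k _ => ?_
    split_ifs with hk
    · rw [Fin.lt_def] at h
      have : (i : ℕ) ≠ l := fun h => hi (Fin.ext h)
      rw [hu i k (Or.inr (by omega)), one_apply_ne]
      rintro rfl; omega
    · rfl
  · rfl

lemma mem_colUni_succ {j : Fin n} {u : GL (Fin n) F} (hu : u ∈ colUni F n j) :
    u ∈ colUni F n (j + 1) ↔ ∀ i < j, u.val i j = 0 := by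
  rw [mem_colUni] at hu ⊢
  constructor
  · intro h i hi
    rw [h i j (Or.inr (by omega)), one_apply_ne hi.ne]
  · intro h i k hik
    by_cases hk : k ≤ i ∨ (k : ℕ) < j
    · exact hu i k hk
    · push Not at hk
      obtain rfl : k = j := Fin.ext (by omega)
      rw [h i hk.1, one_apply_ne hk.1.ne]

open Classical in
lemma sum_colChar [Fintype F] {ψ : AddChar F ℂ} (hψ : ψ ≠ 1) {j : Fin n}
    (u : colUni F n j) : ∑ w, colChar ψ j w u = if u.1 ∈ colUni F n (j + 1) then
      (Fintype.card (Fin n → F) : ℂ) * ψ (superSum u.1.val) else 0 := by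
  let f : (Fin n → F) →+ F :=
    { toFun := fun w => ∑ i, w i * (if i < j then u.1.val i j else 0)
      map_zero' := by simp
      map_add' := fun w w' => by simp only [Pi.add_apply, add_mul, Finset.sum_add_distrib] }
  have hf : ∀ w, f w = ∑ i, w i * (if i < j then u.1.val i j else 0) := fun _ => rfl
  have h1 : ∀ w, colChar ψ j w u = ψ.compAddMonoidHom f w * ψ (∑ i, rowTerm j 0 u.1.val i) := by
    intro w
    rw [colChar_apply, sum_rowTerm_eq, AddChar.map_add_eq_mul]
    rfl
  simp only [h1]
  rw [← Finset.sum_mul, AddChar.sum_eq_ite]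
  have h2 : ψ.compAddMonoidHom f = 0 ↔ u.1 ∈ colUni F n (j + 1) := by
    rw [mem_colUni_succ u.2]
    constructor
    · intro h i hi
      by_contra h0
      apply hψ
      ext a
      have := DFunLike.congr_fun h (Pi.single i (a / u.1.val i j))
      rw [AddChar.compAddMonoidHom_apply] at this
      have hf : f (Pi.single i (a / u.1.val i j)) = a := by
        rw [hf, Finset.sum_eq_single i (fun k _ hk => by rw [Pi.single_eq_of_ne hk, zero_mul])
          (by simp), Pi.single_eq_same, if_pos hi, div_mul_cancel₀ _ h0]
      rwa [hf] at this
    · intro h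
      ext w
      have : f w = 0 := by
        rw [hf]
        refine Finset.sum_eq_zero fun i _ => ?_
        split_ifs with hi
        · rw [h i hi, mul_zero]
        · rw [mul_zero]
      rw [AddChar.compAddMonoidHom_apply, this, AddChar.map_zero_eq_one, AddChar.zero_apply]
  by_cases h : u.1 ∈ colUni F n (j + 1)
  · rw [if_pos (h2.2 h), if_pos h, sum_rowTerm_of_mem _ h]
  · rw [if_neg (mt h2.1 h), if_neg h, zero_mul]

variable {V : Type*} [AddCommGroup V] [Module ℂ V] (ρ : Representation ℂ (GL (Fin n) F) V)

lemma exists_colChar_ne_zero {ψ : AddChar F ℂ} (hψ : ψ ≠ 1) {j : Fin n} {v : V} (hv : v ≠ 0)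
    (h : ∀ u ∈ colUni F n (j + 1), ρ u v = ψ (superSum u.val) • v) :
    ∃ w, ρ.asAlgebraHom (avg (colUni F n j) (colChar ψ j w)) v ≠ 0 := by
  classical
  have := Fintype.ofFinite F
  have := Fintype.ofFinite (colUni F n j)
  by_contra! h0
  have h1 : ∀ w, ∑ u : colUni F n j, colChar ψ j w u⁻¹ • ρ u v = 0 := by
    intro w
    have := h0 w
    rw [rep_avg_eq_sum, smul_eq_zero] at this
    exact this.resolve_left (inv_ne_zero (natCard_ne_zero_subgroup _))
  have h2 := Finset.sum_congr (rfl : (Finset.univ : Finset (Fin n → F)) = _) fun w _ => h1 w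
  rw [Finset.sum_comm, Finset.sum_const_zero] at h2
  simp only [← Finset.sum_smul] at h2
  have h3 : ∀ u : colUni F n j, (∑ w, colChar ψ j w u⁻¹) • ρ u v =
      (if u.1 ∈ colUni F n (j + 1) then (Fintype.card (Fin n → F) : ℂ) else 0) • v := by
    intro u
    have hiff : (u⁻¹).1 ∈ colUni F n (j + 1) ↔ u.1 ∈ colUni F n (j + 1) := by simp
    rw [sum_colChar hψ]
    by_cases hu : u.1 ∈ colUni F n (j + 1)
    · rw [if_pos hu, if_pos (hiff.2 hu), h _ hu, smul_smul, mul_assoc,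
        ← sum_rowTerm_of_mem 0 hu, ← sum_rowTerm_of_mem 0 (hiff.2 hu), ← colChar_apply,
        ← colChar_apply, ← map_mul, inv_mul_cancel, map_one, mul_one]
    · rw [if_neg hu, if_neg (mt hiff.1 hu), zero_smul, zero_smul]
  rw [Finset.sum_congr rfl fun u _ => h3 u, ← Finset.sum_smul, smul_eq_zero] at h2
  replace h2 := h2.resolve_right hv
  rw [← Finset.sum_filter, Finset.sum_const, smul_eq_zero] at h2
  rcases h2 with h2 | h2
  · rw [Finset.card_eq_zero] at h2
    exact Finset.notMem_empty (1 : colUni F n j)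
      (h2 ▸ Finset.mem_filter.2 ⟨Finset.mem_univ _, one_mem _⟩)
  · exact Nat.cast_ne_zero.2 Fintype.card_ne_zero h2

end Whittaker

end GelfandGraev

namespace GelfandGraev

open Matrix

section Whittaker

variable {F : Type*} [Field F] [Finite F] {n : ℕ}
  {V : Type*} [AddCommGroup V] [Module ℂ V] (ρ : Representation ℂ (GL (Fin n) F) V)

/-- The labelling of the two blocks of sizes `a` and `n - a`. -/
def up (n a : ℕ) : Fin n → ℕ := fun i => if (i : ℕ) < a then 0 else 1

lemma up_le_iff {a : ℕ} {i k : Fin n} : up n a k ≤ up n a i ↔ ((k : ℕ) < a ∨ a ≤ (i : ℕ)) := by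
  unfold up
  split_ifs <;> omega

lemma unip_up_le_colUni {j : ℕ} : unip F (up n j) ≤ colUni F n j := by
  refine unip_mono fun i k h => ?_
  rw [up_le_iff]
  omega

lemma superSum_row_of_mem_unip {j : Fin n} {w : Fin n → F} (hw : ∀ i < j, w i = 0)
    {u : GL (Fin n) F} (hu : u ∈ unip F (up n j)) : ∑ i, rowTerm j w u.val i = 0 := by
  refine Finset.sum_eq_zero fun i _ => ?_
  unfold rowTerm
  split_ifs with h
  · rw [hw i h, zero_mul]
  · refine Finset.sum_eq_zero fun k _ => ?_
    split_ifs with hk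
    · rw [hu i k (up_le_iff.2 (by rw [Fin.lt_def] at h; omega)), one_apply_ne]
      rintro rfl; omega
    · rfl

lemma conj_colUni {j l : Fin n} (hl : (l : ℕ) + 1 = j) {w : Fin n → F} {h u u' : GL (Fin n) F}
    (h1 : ∀ i k, j ≤ i ∨ j ≤ k → h.val i k = (1 : Matrix (Fin n) (Fin n) F) i k)
    (h2 : ∀ k < j, h.val l k = w k) (hu : u ∈ colUni F n j) (huu' : h * u' = u * h) :
    u' ∈ colUni F n j ∧ ∑ i, rowTerm j w u'.val i = superSum u.val := by
  have hlj : l < j := Fin.lt_def.2 (by omega)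
  have hlow : ∀ i k, j ≤ i → (h * u').val i k = u'.val i k := by
    intro i k hi
    rw [Units.val_mul, Matrix.mul_apply, Finset.sum_eq_single i]
    · rw [h1 i i (Or.inl hi), one_apply_eq, one_mul]
    · intro m _ hm
      rw [h1 i m (Or.inl hi), one_apply_ne hm.symm, zero_mul]
    · simp
  have hright : ∀ i k, j ≤ k → (u * h).val i k = u.val i k := by
    intro i k hk
    rw [Units.val_mul, Matrix.mul_apply, Finset.sum_eq_single k]
    · rw [h1 k k (Or.inl hk), one_apply_eq, mul_one]
    · intro m _ hm
      rw [h1 m k (Or.inr hk), one_apply_ne hm, mul_zero]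
    · simp
  have hbr : ∀ i k, j ≤ i → j ≤ k → u'.val i k = u.val i k := by
    intro i k hi hk
    rw [← hlow i k hi, huu', hright i k hk]
  have hleft : ∀ i k, k < j → (u * h).val i k = h.val i k := by
    intro i k hk
    rw [Units.val_mul, Matrix.mul_apply, Finset.sum_eq_single i]
    · rw [(mem_colUni.1 hu) i i (Or.inl le_rfl), one_apply_eq, one_mul]
    · intro m _ hm
      rcases lt_or_ge m j with hmj | hmj
      · rw [(mem_colUni.1 hu) i m (Or.inr hmj), one_apply_ne hm.symm, zero_mul]
      · rw [h1 m k (Or.inl hmj), one_apply_ne (hk.trans_le hmj).ne', mul_zero]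
    · simp
  have hcol : ∀ i k, k < j → u'.val i k = (1 : Matrix (Fin n) (Fin n) F) i k := by
    intro i k hk
    have e : u'.val = (h⁻¹).val * (u * h).val := by
      rw [← huu', Units.val_mul, ← Matrix.mul_assoc, val_inv_mul_val, Matrix.one_mul]
    rw [e, Matrix.mul_apply, Finset.sum_congr rfl fun m _ => by rw [hleft m k hk],
      ← Matrix.mul_apply, val_inv_mul_val]
  have hu' : u' ∈ colUni F n j := by
    rw [mem_colUni]
    rintro i k hik
    rcases lt_or_ge k j with hk | hk
    · exact hcol i k hk
    · have hki : k ≤ i := hik.resolve_right (by rw [Fin.le_def] at hk; omega)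
      rw [hbr i k (hk.trans hki) hk, mem_colUni.1 hu i k (Or.inl hki)]
  refine ⟨hu', ?_⟩
  rw [superSum_of_mem hl hu, sum_rowTerm_eq]
  congr 1
  · rw [← hright l j le_rfl, ← huu', Units.val_mul, Matrix.mul_apply]
    refine Finset.sum_congr rfl fun i _ => ?_
    split_ifs with hi
    · rw [h2 i hi]
    · rw [h1 l i (Or.inr (not_lt.1 hi)), one_apply_ne, mul_zero, zero_mul]
      rintro rfl
      exact hi hlj
  · refine Finset.sum_congr rfl fun i _ => ?_
    unfold rowTerm
    split_ifs with hi
    · simp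
    · refine Finset.sum_congr rfl fun k _ => ?_
      split_ifs with hk
      · rw [hbr i k (not_lt.1 hi)]
        rw [Fin.lt_def] at hi; rw [Fin.le_def]; omega
      · rfl

lemma whittaker_step {ψ : AddChar F ℂ} (hψ : ψ ≠ 1) {j : Fin n} (hj : 0 < (j : ℕ))
    (hc : ∀ v, (∀ u ∈ unip F (up n j), ρ u v = v) → v = 0)
    (h : ∃ v ≠ 0, ∀ u ∈ colUni F n (j + 1), ρ u v = ψ (superSum u.val) • v) :
    ∃ v ≠ 0, ∀ u ∈ colUni F n j, ρ u v = ψ (superSum u.val) • v := by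
  obtain ⟨v, hv, hu⟩ := h
  obtain ⟨w, hw⟩ := exists_colChar_ne_zero ρ hψ hv hu
  set v' := ρ.asAlgebraHom (avg (colUni F n j) (colChar ψ j w)) v with hv'
  have hv'u : ∀ u (hu : u ∈ colUni F n j), ρ u v' = ψ (∑ i, rowTerm j w u.val i) • v' :=
    fun u hu => rep_avg_apply ρ (⟨u, hu⟩ : colUni F n j) v
  by_cases h0 : ∀ i < j, w i = 0
  · refine absurd (hc v' fun u hu => ?_) hw
    rw [hv'u u (unip_up_le_colUni hu), superSum_row_of_mem_unip h0 hu, AddChar.map_zero_eq_one,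
      one_smul]
  push Not at h0
  obtain ⟨i₀, hi, hwi⟩ := h0
  let l : Fin n := ⟨j - 1, by omega⟩
  have hl : (l : ℕ) + 1 = j := Nat.sub_add_cancel hj
  obtain ⟨h, h1, h2⟩ := exists_row hi hwi (l := l) (Fin.lt_def.2 (by omega))
  refine ⟨ρ h v', fun h0 => hw ?_, fun u hu => ?_⟩
  · have := congrArg (ρ h⁻¹) h0
    rwa [← Module.End.mul_apply, ← map_mul, inv_mul_cancel, map_one, Module.End.one_apply,
      map_zero] at this
  · have huu' : h * (h⁻¹ * u * h) = u * h := by group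
    obtain ⟨h3, h4⟩ := conj_colUni hl h1 h2 hu huu'
    rw [← Module.End.mul_apply, ← map_mul, ← huu', map_mul, Module.End.mul_apply, hv'u _ h3, h4,
      map_smul]

/-- Cuspidal representations are generic. -/
lemma exists_gg_ne_zero {ψ : AddChar F ℂ} (hψ : ψ ≠ 1) (hn : 1 ≤ n)
    (hc : ∀ j, 0 < j → j < n → ∀ v, (∀ u ∈ unip F (up n j), ρ u v = v) → v = 0)
    (hV : ∃ v : V, v ≠ 0) : ∃ v, ρ.asAlgebraHom (gg ψ n) v ≠ 0 := by
  have key : ∀ k, k < n → ∃ v ≠ 0, ∀ u ∈ colUni F n (n - k), ρ u v = ψ (superSum u.val) • v := by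
    intro k
    induction k with
    | zero =>
      intro _
      obtain ⟨v, hv⟩ := hV
      refine ⟨v, hv, fun u hu => ?_⟩
      have hu1 : u = 1 := by
        ext i k
        rw [mem_colUni.1 hu i k (Or.inr k.2)]
        rfl
      have h0 : ψ (superSum u.val) = 1 := by
        rw [hu1]
        exact map_one (genChar ψ n)
      rw [h0, hu1, map_one, one_smul, Module.End.one_apply]
    | succ k ih =>
      intro hk
      have h := ih (by omega)
      have e : n - k = (⟨n - (k + 1), by omega⟩ : Fin n).val + 1 := by simp; omega
      rw [e] at h
      exact whittaker_step ρ hψ (j := ⟨n - (k + 1), by omega⟩) (by simp; omega)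
        (hc _ (by simp; omega) (by simp; omega)) h
  obtain ⟨v, hv, hu⟩ := key (n - 1) (by omega)
  refine ⟨v, fun h => hv ?_⟩
  rw [gg, rep_avg_eq_self] at h
  · exact h
  · intro u
    refine hu u (mem_colUni.2 fun i k hik => u.2 i k ?_)
    change (k : ℕ) ≤ i
    rw [Fin.le_def] at hik
    omega

end Whittaker

end GelfandGraev

namespace GelfandGraev

open Matrix

section Ideal

variable {G : Type*} [Group G]

/-- The left ideal generated by an element. -/
noncomputable def leftIdeal (z : GA G) : Submodule ℂ (GA G) :=
  LinearMap.range (LinearMap.mulRight ℂ z)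

lemma mem_leftIdeal {z x : GA G} : x ∈ leftIdeal z ↔ ∃ y, y * z = x := Iff.rfl

lemma mul_mem_leftIdeal {z x : GA G} (y : GA G) (hx : x ∈ leftIdeal z) : y * x ∈ leftIdeal z := by
  obtain ⟨w, rfl⟩ := mem_leftIdeal.1 hx
  exact mem_leftIdeal.2 ⟨y * w, mul_assoc _ _ _⟩

lemma mul_eq_of_mem_leftIdeal {z x : GA G} (hz : z * z = z) (hx : x ∈ leftIdeal z) :
    x * z = x := by
  obtain ⟨w, rfl⟩ := mem_leftIdeal.1 hx
  rw [mul_assoc, hz]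

lemma self_mem_leftIdeal (z : GA G) : z ∈ leftIdeal z := mem_leftIdeal.2 ⟨1, one_mul z⟩

/-- The representation of the group on a left ideal of the group algebra. -/
noncomputable def idealRep (z : GA G) : Representation ℂ G (leftIdeal z) where
  toFun g := (LinearMap.mulLeft ℂ (dl g)).restrict fun _ hx => mul_mem_leftIdeal _ hx
  map_one' := by
    ext x : 2
    simp only [LinearMap.coe_restrict_apply, LinearMap.mulLeft_apply, dl_one, one_mul]
    rfl
  map_mul' g h := by
    ext x : 2
    simp only [LinearMap.coe_restrict_apply, LinearMap.mulLeft_apply, dl_mul, mul_assoc,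
      Module.End.mul_apply]
    rfl

lemma idealRep_apply (z : GA G) (g : G) (x : leftIdeal z) :
    (idealRep z g x : GA G) = dl g * x := rfl

lemma idealRep_asAlgebraHom (z x : GA G) (v : leftIdeal z) :
    ((idealRep z).asAlgebraHom x v : GA G) = x * v := by
  refine lin_ext (f := (leftIdeal z).subtype ∘ₗ
    (LinearMap.applyₗ v ∘ₗ (idealRep z).asAlgebraHom.toLinearMap))
    (f' := LinearMap.mulRight ℂ v.1) (fun g => ?_) x
  simp only [LinearMap.comp_apply, AlgHom.toLinearMap_apply, LinearMap.applyₗ_apply_apply, rep_dl,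
    Submodule.subtype_apply, LinearMap.mulRight_apply, idealRep_apply]

variable [Finite G] {e z z' : GA G}

omit [Finite G] in
lemma isIrred_idealRep (he : IsGelfand e) (hz : IsMin e z) : IsIrred (idealRep z) := by
  refine ⟨⟨⟨z, self_mem_leftIdeal z⟩, fun h => hz.1 (congrArg Subtype.val h)⟩, fun W hW => ?_⟩
  have hW' : ∀ x : GA G, ∀ v ∈ W, (idealRep z).asAlgebraHom x v ∈ W := by
    intro x v hv
    refine lin_mem (LinearMap.applyₗ v ∘ₗ (idealRep z).asAlgebraHom.toLinearMap) W (fun g => ?_) x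
    simp only [LinearMap.comp_apply, AlgHom.toLinearMap_apply, LinearMap.applyₗ_apply_apply, rep_dl]
    exact hW g v hv
  refine or_iff_not_imp_left.2 fun h => ?_
  obtain ⟨w, hw, hw0⟩ := (Submodule.ne_bot_iff W).1 h
  have h1 : adj w.1 * w.1 ≠ 0 := adj_mul_self_ne_zero fun h => hw0 (Subtype.ext h)
  have hwz : w.1 * z = w.1 := mul_eq_of_mem_leftIdeal hz.2.1 w.2
  obtain ⟨c, hc⟩ := hz.mul_mul_self (adj w.1 * w.1)
  have h2 : z * (adj w.1 * w.1) * z = adj w.1 * w.1 := by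
    have h3 : z * adj w.1 = adj w.1 := by
      have := congrArg adj hwz
      rwa [adj_mul, IsMin.adj_eq he hz] at this
    rw [mul_assoc, mul_assoc, hwz, ← mul_assoc, h3]
  rw [h2] at hc
  have hc0 : c ≠ 0 := by rintro rfl; exact h1 (by rw [hc, zero_smul])
  rw [eq_top_iff]
  rintro ⟨x, hx⟩ -
  have h4 : x = (c⁻¹ • (x * adj w.1)) * w.1 := by
    rw [smul_mul_assoc, mul_assoc, hc, mul_smul_comm, smul_smul, inv_mul_cancel₀ hc0, one_smul,
      mul_eq_of_mem_leftIdeal hz.2.1 hx]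
  have h5 := hW' (c⁻¹ • (x * adj w.1)) w hw
  convert h5
  rw [idealRep_asAlgebraHom, ← h4]

omit [Finite G] in
lemma trace_asAlgebraHom_eq {V V' : Type*} [AddCommGroup V] [Module ℂ V] [AddCommGroup V']
    [Module ℂ V'] {ρ : Representation ℂ G V} {ρ' : Representation ℂ G V'}
    (h : ∀ g, LinearMap.trace ℂ V (ρ g) = LinearMap.trace ℂ V' (ρ' g)) (x : GA G) :
    LinearMap.trace ℂ V (ρ.asAlgebraHom x) = LinearMap.trace ℂ V' (ρ'.asAlgebraHom x) :=
  lin_ext (f := LinearMap.trace ℂ V ∘ₗ ρ.asAlgebraHom.toLinearMap)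
    (f' := LinearMap.trace ℂ V' ∘ₗ ρ'.asAlgebraHom.toLinearMap) (fun g => by
      simp only [LinearMap.comp_apply, AlgHom.toLinearMap_apply, rep_dl, h]) x

lemma eq_zero_of_trace_eq_zero {V : Type*} [AddCommGroup V] [Module ℂ V] [FiniteDimensional ℂ V]
    {f : Module.End ℂ V} (hf : IsIdempotentElem f) (h : LinearMap.trace ℂ V f = 0) : f = 0 :=
  (LinearMap.IsIdempotentElem.trace_eq_zero_iff hf).1 h

lemma eq_of_trace_idealRep_eq (he : IsGelfand e) (hz : IsMin e z) (hz' : IsMin e z')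
    (h : ∀ g, LinearMap.trace ℂ _ (idealRep z g) = LinearMap.trace ℂ _ (idealRep z' g)) :
    z = z' := by
  have h1 := trace_asAlgebraHom_eq h z
  have hid' : IsIdempotentElem ((idealRep z).asAlgebraHom z) := by
    rw [IsIdempotentElem, ← map_mul, hz.2.1]
  have h2 : (idealRep z').asAlgebraHom z ≠ 0 := by
    intro h0
    rw [h0, map_zero] at h1
    have := congrArg Subtype.val (LinearMap.congr_fun
      (eq_zero_of_trace_eq_zero hid' h1) ⟨z, self_mem_leftIdeal z⟩)
    rw [idealRep_asAlgebraHom] at this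
    exact hz.1 (hz.2.1 ▸ this)
  by_contra hne
  apply h2
  ext ⟨v, hv⟩ : 2
  rw [idealRep_asAlgebraHom]
  obtain ⟨y, rfl⟩ := mem_leftIdeal.1 hv
  by_contra h0
  refine hne (IsMin.eq_of_mul_mul_ne_zero he hz hz' (x := y) ?_)
  rw [mul_assoc]
  exact h0

variable {V : Type*} [AddCommGroup V] [Module ℂ V] {ρ : Representation ℂ G V}

lemma exists_equiv_idealRep (he : IsGelfand e) (hρ : IsIrred ρ) {v : V}
    (hv : ρ.asAlgebraHom e v ≠ 0) : ∃ z, IsMin e z ∧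
      ∃ φ : leftIdeal z ≃ₗ[ℂ] V, ∀ g x, φ (idealRep z g x) = ρ g (φ x) := by
  obtain ⟨s, hs, hsum⟩ := exists_corner_decomposition he
  obtain ⟨z, hzs, hzv⟩ : ∃ z ∈ s, ρ.asAlgebraHom z v ≠ 0 := by
    by_contra! h
    apply hv
    rw [← hsum, map_sum, LinearMap.sum_apply, Finset.sum_eq_zero h]
  have hz := (hs z).1 hzs
  let φ : leftIdeal z →ₗ[ℂ] V :=
    (LinearMap.applyₗ v ∘ₗ ρ.asAlgebraHom.toLinearMap) ∘ₗ (leftIdeal z).subtype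
  have hφ : ∀ g x, φ (idealRep z g x) = ρ g (φ x) := fun g x => rep_dl_mul ρ g x v
  refine ⟨z, hz, LinearEquiv.ofBijective φ ⟨?_, ?_⟩, hφ⟩
  · rw [← LinearMap.ker_eq_bot]
    refine ((isIrred_idealRep he hz).2 (LinearMap.ker φ) fun g x hx => ?_).resolve_right fun h => ?_
    · rw [LinearMap.mem_ker] at hx ⊢
      rw [hφ, hx, map_zero]
    · have : (⟨z, self_mem_leftIdeal z⟩ : leftIdeal z) ∈ LinearMap.ker φ := h ▸ Submodule.mem_top
      exact hzv this
  · rw [← LinearMap.range_eq_top]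
    refine (hρ.2 (LinearMap.range φ) ?_).resolve_left fun h => ?_
    · rintro g _ ⟨x, rfl⟩
      exact ⟨_, hφ g x⟩
    · have : φ ⟨z, self_mem_leftIdeal z⟩ ∈ LinearMap.range φ := ⟨_, rfl⟩
      rw [h, Submodule.mem_bot] at this
      exact hzv this

omit [Finite G] in
lemma trace_eq_of_equiv {V' : Type*} [AddCommGroup V'] [Module ℂ V'] {ρ' : Representation ℂ G V'}
    (φ : V' ≃ₗ[ℂ] V) (h : ∀ g x, φ (ρ' g x) = ρ g (φ x)) (g : G) :
    LinearMap.trace ℂ V (ρ g) = LinearMap.trace ℂ V' (ρ' g) := by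
  rw [← LinearMap.trace_conj' (ρ' g) φ]
  congr 1
  ext x
  rw [LinearEquiv.conj_apply_apply, h, LinearEquiv.apply_symm_apply]

end Ideal

end GelfandGraev

namespace GelfandGraev

open Matrix

section Cuspidal

variable {F : Type*} [Field F] [Fintype F] {n : ℕ} {V : Type*} [AddCommGroup V] [Module ℂ V]
  {ρ : Representation ℂ (GL (Fin n) F) V}

lemma eq_zero_of_isCuspidal (hρ : IsCuspidal ρ) {j : ℕ} (hj : 0 < j) (hjn : j < n) {v : V}
    (hv : ∀ u ∈ unip F (up n j), ρ u v = v) : v = 0 := by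
  refine hρ 2 le_rfl (fun i => if (i : ℕ) < j then 0 else 1) ?_ ?_ v fun u hu => hv u ?_
  · intro i k hik
    rw [Fin.le_def] at hik
    dsimp only
    split_ifs with h1 h2
    · exact le_rfl
    · exact Fin.zero_le _
    · omega
    · exact le_rfl
  · intro c
    match c with
    | 0 => exact ⟨⟨0, by omega⟩, if_pos hj⟩
    | 1 => exact ⟨⟨j, hjn⟩, if_neg (lt_irrefl _)⟩
  · intro i k hik
    rw [hu i k, one_apply]
    rw [up_le_iff] at hik
    dsimp only
    split_ifs with h1 h2
    · exact le_rfl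
    · exact Fin.zero_le _
    · omega
    · exact le_rfl

lemma IsCuspidal.of_equiv {V' : Type*} [AddCommGroup V'] [Module ℂ V']
    {ρ' : Representation ℂ (GL (Fin n) F) V'} (φ : V' ≃ₗ[ℂ] V)
    (h : ∀ g x, φ (ρ' g x) = ρ g (φ x)) (hρ : IsCuspidal ρ) : IsCuspidal ρ' := by
  intro m hm b hb hb' v hv
  rw [← LinearEquiv.map_eq_zero_iff φ]
  exact hρ m hm b hb hb' _ fun u hu => by rw [← h, hv u hu]

lemma up_comp_rev {a : ℕ} : up n (n - a) ∘ Fin.revPerm = bl n a := by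
  funext i
  simp only [Function.comp, up, bl, Fin.revPerm_apply, Fin.val_rev]
  split_ifs <;> omega

variable {ψ : AddChar F ℂ}

lemma isCusp_of_isCuspidal (hn : 1 ≤ n) {z : GA (GL (Fin n) F)} (hz : IsMin (gg ψ n) z)
    (h : IsCuspidal (idealRep z)) : Gen.IsCusp (⟨n, z, hz⟩ : Gen ψ) := by
  refine ⟨hn, fun β hβ x => ?_⟩
  by_contra h0
  obtain ⟨a, ha, han, x', h0⟩ := Gen.exists_rad_bl_ne_zero hβ h0
  replace han : a < n := han
  apply h0
  have h1 := dl_mono_mul_rad (β := up n (n - a)) Fin.revPerm (1 : Fin n → Fˣ)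
  rw [up_comp_rev] at h1
  set g : GL (Fin n) F := mono Fin.revPerm 1
  have h2 : rad F (up n (n - a)) * (dl g * (x' * z)) = dl g * (rad F (bl n a) * x' * z) := by
    rw [← mul_assoc, ← h1, mul_assoc, mul_assoc (rad F _)]
  have h3 : rad F (up n (n - a)) * (dl g * (x' * z)) ∈ leftIdeal z :=
    mul_mem_leftIdeal _ (mul_mem_leftIdeal _ (mul_mem_leftIdeal _ (self_mem_leftIdeal z)))
  have h4 := eq_zero_of_isCuspidal h (j := n - a) (by omega) (by omega) (v := ⟨_, h3⟩)
    fun u hu => by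
      apply Subtype.ext
      rw [idealRep_apply, ← mul_assoc, dl_mul_rad hu]
  have h5 : dl g * (rad F (bl n a) * x' * z) = 0 := h2 ▸ congrArg Subtype.val h4
  have h6 := congrArg (dl g⁻¹ * ·) h5
  simpa only [← mul_assoc, dl_inv_mul_self, one_mul, mul_zero] using h6

lemma isCuspidal_of_isCusp {z : GA (GL (Fin n) F)} (hz : IsMin (gg ψ n) z)
    (h : Gen.IsCusp (⟨n, z, hz⟩ : Gen ψ)) : IsCuspidal (idealRep z) := by
  intro m hm b _ hb v hv
  have h1 : rad F (fun i => (b i : ℕ)) * v.1 = v.1 := by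
    refine rad_mul_eq fun u hu => ?_
    have := hv u fun i k hik => by rw [hu i k (Fin.le_def.1 hik), one_apply]
    exact congrArg Subtype.val this
  obtain ⟨x, hx⟩ := mem_leftIdeal.1 v.2
  apply Subtype.ext
  obtain ⟨i, hi⟩ := hb ⟨0, by omega⟩
  obtain ⟨j, hj⟩ := hb ⟨1, by omega⟩
  rw [← h1, ← hx, ← mul_assoc]
  refine h.2 (fun i => (b i : ℕ)) ⟨i, j, ?_⟩ x
  simp [hi, hj]

end Cuspidal

lemma card_cuspidal_characters {F : Type} [Field F] [Fintype F] {n : ℕ} {ψ : AddChar F ℂ}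
    (hψ : ψ ≠ 1) (hn : 1 ≤ n) :
    Nat.card {χ : GL (Fin n) F → ℂ //
        ∃ (V : Type) (_ : AddCommGroup V) (_ : Module ℂ V) (_ : FiniteDimensional ℂ V)
          (ρ : Representation ℂ (GL (Fin n) F) V),
          IsIrred ρ ∧ IsCuspidal ρ ∧ χ = fun g => LinearMap.trace ℂ V (ρ g)} =
      Nat.card {z : Gen ψ // Gen.IsCusp z ∧ Gen.deg z = n} := by
  have he := isGelfand_gg (n := n) hψ
  symm
  have hmem : ∀ z : {z : GA (GL (Fin n) F) // ∃ h : IsMin (gg ψ n) z, Gen.IsCusp ⟨n, z, h⟩},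
      ∃ (V : Type) (_ : AddCommGroup V) (_ : Module ℂ V) (_ : FiniteDimensional ℂ V)
          (ρ : Representation ℂ (GL (Fin n) F) V), IsIrred ρ ∧ IsCuspidal ρ ∧
          (fun g => LinearMap.trace ℂ _ (idealRep z.1 g)) = fun g => LinearMap.trace ℂ V (ρ g) := by
    rintro ⟨z, hz, hc⟩
    exact ⟨leftIdeal z, inferInstance, inferInstance, inferInstance, idealRep z,
      isIrred_idealRep he hz, isCuspidal_of_isCusp hz hc, rfl⟩
  have e1 : Nat.card {z : Gen ψ // Gen.IsCusp z ∧ Gen.deg z = n} =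
      Nat.card {z : GA (GL (Fin n) F) // ∃ h : IsMin (gg ψ n) z, Gen.IsCusp ⟨n, z, h⟩} := by
    refine Nat.card_congr (Equiv.ofBijective (fun z => ?_) ⟨?_, ?_⟩).symm
    · exact ⟨⟨n, z.1, z.2.choose⟩, z.2.choose_spec, rfl⟩
    · rintro ⟨z, hz⟩ ⟨z', hz'⟩ h
      have h1 := (Sigma.mk.inj (congrArg Subtype.val h)).2
      exact Subtype.ext (Subtype.mk.inj (eq_of_heq h1))
    · rintro ⟨⟨m, z, hz⟩, hc, rfl⟩
      exact ⟨⟨z, hz, hc⟩, rfl⟩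
  rw [e1]
  refine Nat.card_congr (Equiv.ofBijective (fun z => ⟨_, hmem z⟩) ⟨?_, ?_⟩)
  · rintro ⟨z, hz, hc⟩ ⟨z', hz', hc'⟩ h
    have := congrArg Subtype.val h
    exact Subtype.ext (eq_of_trace_idealRep_eq he hz hz' fun g => congrFun this g)
  · rintro ⟨χ, V, _, _, _, ρ, hi, hc, rfl⟩
    obtain ⟨v, hv⟩ := exists_gg_ne_zero ρ hψ hn
      (fun j hj hjn v hv => eq_zero_of_isCuspidal hc hj hjn hv) hi.1
    obtain ⟨z, hz, φ, hφ⟩ := exists_equiv_idealRep he hi hv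
    refine ⟨⟨z, hz, isCusp_of_isCuspidal hn hz (IsCuspidal.of_equiv φ hφ hc)⟩, ?_⟩
    apply Subtype.ext
    funext g
    exact (trace_eq_of_equiv φ hφ g).symm

end GelfandGraev

namespace GelfandGraev

section GradedCounting

variable {ι κ : Type*}

/-- The multisets of total weight `n`. -/
def WeightMultiset (w : ι → ℕ) (n : ℕ) : Type _ := {s : Multiset ι // (s.map w).sum = n}

lemma finite_fiber_of_weightMultiset {w : ι → ℕ} {n : ℕ} [Finite (WeightMultiset w n)] :
    Finite {i // w i = n} :=
  Finite.of_injective (β := WeightMultiset w n) (fun i => ⟨{i.1}, by simp [i.2]⟩) fun i j h =>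
    Subtype.ext (Multiset.singleton_inj.1 (congrArg Subtype.val h))

lemma card_weightMultiset {w : ι → ℕ} (hw : ∀ i, 0 < w i) {n : ℕ}
    [Finite (WeightMultiset w n)] :
    Nat.card (WeightMultiset w n) = Nat.card {i // w i = n} +
      Nat.card (WeightMultiset (fun i : {i // w i < n} => w i) n) := by
  let f : {i // w i = n} ⊕ WeightMultiset (fun i : {i // w i < n} => w i) n → WeightMultiset w n :=
    Sum.elim (fun i => ⟨{i.1}, by simp [i.2]⟩)
      fun s => ⟨s.1.map Subtype.val, by rw [Multiset.map_map]; exact s.2⟩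
  have hinj : Function.Injective f := by
    rintro (i | s) (j | t) h
    · exact congrArg Sum.inl (Subtype.ext (Multiset.singleton_inj.1 (congrArg Subtype.val h)))
    · have h1 : {i.1} = t.1.map Subtype.val := congrArg Subtype.val h
      obtain ⟨x, -, hx⟩ := Multiset.mem_map.1 (h1 ▸ Multiset.mem_singleton_self i.1)
      have := x.2
      rw [hx, i.2] at this
      exact absurd this (lt_irrefl _)
    · have h1 : s.1.map Subtype.val = {j.1} := congrArg Subtype.val h
      obtain ⟨x, -, hx⟩ := Multiset.mem_map.1 (h1 ▸ Multiset.mem_singleton_self j.1)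
      have := x.2
      rw [hx, j.2] at this
      exact absurd this (lt_irrefl _)
    · exact congrArg Sum.inr (Subtype.ext
        (Multiset.map_injective Subtype.val_injective (congrArg Subtype.val h)))
  have hsurj : Function.Surjective f := by
    rintro ⟨s, hs⟩
    by_cases h : ∀ x ∈ s, w x < n
    · lift s to Multiset {i // w i < n} using h
      exact ⟨Sum.inr ⟨s, by rw [Multiset.map_map] at hs; exact hs⟩, rfl⟩
    · push Not at h
      obtain ⟨x, hx, hxn⟩ := h
      obtain ⟨t, rfl⟩ := Multiset.exists_cons_of_mem hx
      rw [Multiset.map_cons, Multiset.sum_cons] at hs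
      have ht : t = 0 := by
        by_contra h0
        obtain ⟨y, hy⟩ := Multiset.exists_mem_of_ne_zero h0
        have := Multiset.single_le_sum (fun _ _ => Nat.zero_le _) _ (Multiset.mem_map_of_mem w hy)
        have := hw y
        omega
      subst ht
      exact ⟨Sum.inl ⟨x, by simpa using hs⟩, rfl⟩
  have := Finite.of_injective f hinj
  have := Finite.sum_left (α := {i // w i = n})
    (WeightMultiset (fun i : {i // w i < n} => w i) n)
  have := Finite.sum_right {i // w i = n}
    (β := WeightMultiset (fun i : {i // w i < n} => w i) n)
  rw [← Nat.card_sum]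
  exact (Nat.card_congr (Equiv.ofBijective f ⟨hinj, hsurj⟩)).symm

/-- Two free graded commutative monoids with the same finite number of elements in each degree
have the same number of generators in each degree. -/
theorem card_fiber_eq_of_card_weightMultiset_eq {w : ι → ℕ} {v : κ → ℕ} (hw : ∀ i, 0 < w i)
    (hv : ∀ k, 0 < v k) [∀ n, Finite (WeightMultiset w n)] [∀ n, Finite (WeightMultiset v n)]
    (h : ∀ n, Nat.card (WeightMultiset w n) = Nat.card (WeightMultiset v n)) (n : ℕ)
    (hn : 0 < n) : Nat.card {i // w i = n} = Nat.card {k // v k = n} := by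
  induction n using Nat.strong_induction_on with
  | _ n ih =>
  have hfib : ∀ m,
      Nonempty ({i : {i // w i < n} // w i = m} ≃ {k : {k // v k < n} // v k = m}) := by
    intro m
    rcases lt_or_ge m n with hm | hm
    · have e1 : {i : {i // w i < n} // w i = m} ≃ {i // w i = m} :=
        Equiv.subtypeSubtypeEquivSubtype (p := fun i => w i < n) (q := fun i => w i = m)
          fun h => h.trans_lt hm
      have e2 : {k : {k // v k < n} // v k = m} ≃ {k // v k = m} :=
        Equiv.subtypeSubtypeEquivSubtype (p := fun k => v k < n) (q := fun k => v k = m)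
          fun h => h.trans_lt hm
      have := finite_fiber_of_weightMultiset (w := w) (n := m)
      have := finite_fiber_of_weightMultiset (w := v) (n := m)
      have h1 : Nat.card {i // w i = m} = Nat.card {k // v k = m} := by
        rcases Nat.eq_zero_or_pos m with rfl | hm0
        · have : IsEmpty {i // w i = 0} := ⟨fun i => (hw i.1).ne' i.2⟩
          have : IsEmpty {k // v k = 0} := ⟨fun k => (hv k.1).ne' k.2⟩
          simp
        · exact ih m hm hm0
      exact ⟨(e1.trans (Finite.card_eq.1 h1).some).trans e2.symm⟩
    · have : IsEmpty {i : {i // w i < n} // w i = m} :=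
        ⟨fun i => by have := i.1.2; have := i.2; omega⟩
      have : IsEmpty {k : {k // v k < n} // v k = m} :=
        ⟨fun k => by have := k.1.2; have := k.2; omega⟩
      exact ⟨Equiv.equivOfIsEmpty _ _⟩
  let e : {i // w i < n} ≃ {k // v k < n} := Equiv.ofFiberEquiv fun m => (hfib m).some
  have he : ∀ i, v (e i) = w i := fun i =>
    Equiv.ofFiberEquiv_map (f := fun i : {i // w i < n} => w i)
      (g := fun k : {k // v k < n} => v k) (fun m => (hfib m).some) i
  have h2 : Nat.card (WeightMultiset (fun i : {i // w i < n} => w i) n) =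
      Nat.card (WeightMultiset (fun i : {i // v i < n} => v i) n) := by
    let E : Multiset {i // w i < n} ≃ Multiset {k // v k < n} :=
      ⟨Multiset.map e, Multiset.map e.symm, fun s => by simp [Multiset.map_map],
        fun s => by simp [Multiset.map_map]⟩
    refine Nat.card_congr (Equiv.subtypeEquiv E fun s => ?_)
    simp only [E, Equiv.coe_fn_mk, Multiset.map_map, Function.comp_def, he]
  have h3 := h n
  rw [card_weightMultiset hw, card_weightMultiset hv, h2] at h3
  exact Nat.add_right_cancel h3

end GradedCounting

end GelfandGraev

namespace GelfandGraev

open Polynomial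

section FreeMonoid

variable {F : Type*} [Field F] [Finite F] {ψ : AddChar F ℂ} [hψ : Fact (ψ ≠ 1)]

lemma Gen.deg_multiset_prod (s : Multiset (Gen ψ)) : Gen.deg s.prod = (s.map Gen.deg).sum := by
  induction s using Multiset.induction_on with
  | empty => simp only [Multiset.prod_zero, Multiset.map_zero, Multiset.sum_zero]; exact Gen.deg_one
  | cons x s ih => rw [Multiset.prod_cons, Gen.deg_mul, ih, Multiset.map_cons, Multiset.sum_cons]

/-- Elements of degree `n` are the same as multisets of cuspidal elements of total degree `n`. -/
noncomputable def genEquiv (n : ℕ) :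
    WeightMultiset (fun z : {z : Gen ψ // Gen.IsCusp z} => Gen.deg z.1) n ≃
      {z : GA (GL (Fin n) F) // IsMin (gg ψ n) z} := by
  refine (Equiv.ofBijective (β := {z : Gen ψ // Gen.deg z = n}) (fun s =>
    ⟨(s.1.map Subtype.val).prod, ?_⟩) ⟨?_, ?_⟩).trans ?_
  · rw [Gen.deg_multiset_prod, Multiset.map_map]
    exact s.2
  · intro s t h
    refine Subtype.ext (Multiset.map_injective Subtype.val_injective
      (Gen.multiset_prod_injective ?_ ?_ (Subtype.mk.inj h)))
    all_goals
      intro x hx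
      obtain ⟨y, -, rfl⟩ := Multiset.mem_map.1 hx
      exact y.2
  · rintro ⟨z, hz⟩
    obtain ⟨s, hs, rfl⟩ := Gen.exists_multiset_prod z
    lift s to Multiset {z : Gen ψ // Gen.IsCusp z} using hs
    rw [Gen.deg_multiset_prod, Multiset.map_map] at hz
    exact ⟨⟨s, hz⟩, rfl⟩
  · refine (Equiv.ofBijective (fun z => ⟨⟨n, z⟩, rfl⟩) ⟨fun z z' h => ?_, ?_⟩).symm
    · exact eq_of_heq (Sigma.mk.inj (congrArg Subtype.val h)).2
    · rintro ⟨⟨m, z⟩, rfl⟩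
      exact ⟨z, rfl⟩

end FreeMonoid

section Poly

variable {F : Type*} [Field F]

/-- Monic irreducible polynomials other than `X`. -/
abbrev IrredPoly (F : Type*) [Field F] : Type _ :=
  {p : F[X] // (p.Monic ∧ Irreducible p) ∧ p.coeff 0 ≠ 0}

lemma eq_of_multiset_prod_eq {s t : Multiset F[X]} (hs : ∀ p ∈ s, p.Monic ∧ Irreducible p)
    (ht : ∀ p ∈ t, p.Monic ∧ Irreducible p) (h : s.prod = t.prod) : s = t := by
  have h1 := UniqueFactorizationMonoid.factors_unique (fun p hp => (hs p hp).2)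
    (fun p hp => (ht p hp).2) (h ▸ Associated.refl _)
  rw [← Multiset.rel_eq]
  exact h1.mono fun p hp q hq hpq =>
    eq_of_monic_of_associated (hs p hp).1 (ht q hq).1 hpq

lemma exists_multiset_prod_of_monic {p : F[X]} (hp : p.Monic) :
    ∃ s : Multiset F[X], (∀ q ∈ s, q.Monic ∧ Irreducible q) ∧ s.prod = p := by
  classical
  refine ⟨UniqueFactorizationMonoid.normalizedFactors p, fun q hq => ?_, ?_⟩
  · have hi := UniqueFactorizationMonoid.irreducible_of_normalized_factor q hq
    refine ⟨?_, hi⟩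
    rw [← UniqueFactorizationMonoid.normalize_normalized_factor q hq]
    exact monic_normalize hi.ne_zero
  · rw [UniqueFactorizationMonoid.prod_normalizedFactors_eq hp.ne_zero]
    exact hp.normalize_eq_self

/-- Unique factorization of monic polynomials with nonzero constant coefficient. -/
noncomputable def polyEquiv (n : ℕ) :
    WeightMultiset (fun p : IrredPoly F => p.1.natDegree) n ≃
      {p : F[X] // (p.Monic ∧ p.natDegree = n) ∧ p.coeff 0 ≠ 0} := by
  have hmem (s : Multiset (IrredPoly F)) : ∀ p ∈ s.map Subtype.val,
      (p.Monic ∧ Irreducible p) ∧ p.coeff 0 ≠ 0 := by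
    intro p hp
    obtain ⟨y, -, rfl⟩ := Multiset.mem_map.1 hp
    exact y.2
  refine Equiv.ofBijective (fun s => ⟨(s.1.map Subtype.val).prod, ⟨?_, ?_⟩, ?_⟩) ⟨?_, ?_⟩
  · simpa using monic_multiset_prod_of_monic (s.1.map Subtype.val) id
      fun p hp => (hmem _ p hp).1.1
  · rw [natDegree_multiset_prod_of_monic _ fun p hp => (hmem _ p hp).1.1, Multiset.map_map]
    exact s.2
  · rw [coeff_zero_multiset_prod]
    intro h0
    obtain ⟨p, hp, h0⟩ := Multiset.mem_map.1 (Multiset.prod_eq_zero_iff.1 h0)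
    exact (hmem _ p hp).2 h0
  · intro s t h
    exact Subtype.ext (Multiset.map_injective Subtype.val_injective
      (eq_of_multiset_prod_eq (fun p hp => (hmem _ p hp).1) (fun p hp => (hmem _ p hp).1)
        (Subtype.mk.inj h)))
  · rintro ⟨p, ⟨hp, hn⟩, h0⟩
    obtain ⟨s, hs, rfl⟩ := exists_multiset_prod_of_monic hp
    have hs' : ∀ q ∈ s, (q.Monic ∧ Irreducible q) ∧ q.coeff 0 ≠ 0 := by
      refine fun q hq => ⟨hs q hq, fun hq0 => h0 ?_⟩
      rw [coeff_zero_multiset_prod]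
      exact Multiset.prod_eq_zero (Multiset.mem_map.2 ⟨q, hq, hq0⟩)
    lift s to Multiset (IrredPoly F) using hs'
    rw [natDegree_multiset_prod_of_monic _ fun p hp => (hmem _ p hp).1.1, Multiset.map_map] at hn
    exact ⟨⟨s, hn⟩, rfl⟩

lemma card_monic_succ [Finite F] (m : ℕ) :
    Nat.card {p : F[X] // (p.Monic ∧ p.natDegree = m + 1) ∧ p.coeff 0 ≠ 0} =
      (Nat.card F - 1) * Nat.card F ^ m := by
  have e1 : {p : F[X] // (p.Monic ∧ p.natDegree = m + 1) ∧ p.coeff 0 ≠ 0} ≃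
      {f : Fin (m + 1) → F // f 0 ≠ 0} := by
    refine (Equiv.subtypeSubtypeEquivSubtypeInter (fun p : F[X] => p.Monic ∧ p.natDegree = m + 1)
      fun p => p.coeff 0 ≠ 0).symm.trans (Equiv.subtypeEquiv
        ((monicEquivDegreeLT (m + 1)).trans (degreeLTEquiv F (m + 1)).toEquiv) fun p => ?_)
    have : p.1.eraseLead.coeff 0 = p.1.coeff 0 :=
      eraseLead_coeff_of_ne _ (by rw [p.2.2]; omega)
    change _ ↔ p.1.eraseLead.coeff 0 ≠ 0
    rw [this]
  have e2 : {f : Fin (m + 1) → F // f 0 ≠ 0} ≃ {a : F // a ≠ 0} × (Fin m → F) :=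
    ((Fin.consEquiv fun _ : Fin (m + 1) => F).symm.subtypeEquiv
      (q := fun x => x.1 ≠ 0) fun f => Iff.rfl).trans
      (Equiv.prodSubtypeFstEquivSubtypeProd (p := fun a : F => a ≠ 0))
  rw [Nat.card_congr (e1.trans e2), Nat.card_prod, Nat.card_fun, Nat.card_fin]
  congr 1
  classical
  have := Fintype.ofFinite F
  rw [Nat.card_eq_fintype_card, Nat.card_eq_fintype_card, Fintype.card_subtype_compl]
  simp

lemma card_monic_zero :
    Nat.card {p : F[X] // (p.Monic ∧ p.natDegree = 0) ∧ p.coeff 0 ≠ 0} = 1 := by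
  rw [Nat.card_eq_one_iff_unique]
  refine ⟨⟨fun p q => Subtype.ext ?_⟩, ⟨1, ⟨monic_one, natDegree_one⟩, by simp⟩⟩
  rw [p.2.1.1.natDegree_eq_zero.1 p.2.1.2, q.2.1.1.natDegree_eq_zero.1 q.2.1.2]

end Poly

theorem card_isCusp_eq {F : Type*} [Field F] [Finite F] {ψ : AddChar F ℂ} (hψ : ψ ≠ 1) {n : ℕ}
    (hn : 0 < n) : Nat.card {z : Gen ψ // Gen.IsCusp z ∧ Gen.deg z = n} =
      Nat.card {p : IrredPoly F // p.1.natDegree = n} := by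
  have : Fact (ψ ≠ 1) := ⟨hψ⟩
  have h (n : ℕ) : Nat.card (WeightMultiset (fun z : {z : Gen ψ // Gen.IsCusp z} =>
      Gen.deg z.1) n) = Nat.card (WeightMultiset (fun p : IrredPoly F => p.1.natDegree) n) := by
    rw [Nat.card_congr (genEquiv n), Nat.card_congr (polyEquiv n)]
    cases n with
    | zero => rw [card_isMin_gg_zero hψ, card_monic_zero]
    | succ m => rw [card_isMin_gg hψ, card_monic_succ]
  have hpos (n : ℕ) : Nat.card (WeightMultiset (fun p : IrredPoly F => p.1.natDegree) n) ≠ 0 := by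
    rw [Nat.card_congr (polyEquiv n)]
    cases n with
    | zero => rw [card_monic_zero]; exact one_ne_zero
    | succ m =>
      rw [card_monic_succ]
      have : 1 < Nat.card F := Finite.one_lt_card
      exact Nat.mul_ne_zero (by omega) (pow_ne_zero _ (by omega))
  have i1 (n : ℕ) : Finite (WeightMultiset (fun p : IrredPoly F => p.1.natDegree) n) :=
    Nat.finite_of_card_ne_zero (hpos n)
  have i2 (n : ℕ) : Finite (WeightMultiset (fun z : {z : Gen ψ // Gen.IsCusp z} =>
      Gen.deg z.1) n) := Nat.finite_of_card_ne_zero (h n ▸ hpos n)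
  rw [← card_fiber_eq_of_card_weightMultiset_eq (fun z => z.2.1)
    (fun p => p.2.1.2.natDegree_pos) h n hn]
  exact Nat.card_congr (Equiv.subtypeSubtypeEquivSubtypeInter
    (fun z : Gen ψ => Gen.IsCusp z) fun z => Gen.deg z = n).symm

end GelfandGraev

namespace GelfandGraev

open Polynomial

lemma exists_algebra_of_card_eq (F K : Type*) [Field F] [Fintype F] [Field K] [Fintype K] {n : ℕ}
    (hn : n ≠ 0) (h : Fintype.card K = Fintype.card F ^ n) : Nonempty (F →+* K) := by
  obtain ⟨p, hp⟩ := CharP.exists F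
  have : Fact p.Prime := ⟨CharP.char_is_prime F p⟩
  have : NeZero n := ⟨hn⟩
  have := Fintype.ofFinite (FiniteField.Extension F p n)
  have hc : Fintype.card (FiniteField.Extension F p n) = Fintype.card K := by
    rw [h, ← Nat.card_eq_fintype_card, FiniteField.natCard_extension, Nat.card_eq_fintype_card]
  exact ⟨(FiniteField.ringEquivOfCardEq hc).toRingHom.comp
    (algebraMap F (FiniteField.Extension F p n))⟩

section

variable {F K : Type*} [Field F] [Finite F] [Field K] [Finite K] [Algebra F K]

lemma pow_card_pow_eq_iff {x : K} {d : ℕ} :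
    x ^ Nat.card F ^ d = x ↔ (minpoly F x).natDegree ∣ d := by
  have hx : IsIntegral F x := .of_finite F x
  rw [(minpoly.irreducible hx).natDegree_dvd_iff_dvd_X_pow_card_pow_sub_X, minpoly.dvd_iff]
  simp [sub_eq_zero]

lemma natDegree_minpoly_eq_iff {x : K} {n : ℕ} (hn : 0 < n) (h : Module.finrank F K = n) :
    (minpoly F x).natDegree = n ↔ ∀ d, 1 ≤ d → d < n → x ^ Nat.card F ^ d ≠ x := by
  have hx : IsIntegral F x := .of_finite F x
  simp only [ne_eq, pow_card_pow_eq_iff]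
  constructor
  · rintro h1 d hd hdn h2
    exact absurd (Nat.le_of_dvd hd h2) (by omega)
  · intro h1
    have h2 : (minpoly F x).natDegree ∣ n := h ▸ minpoly.degree_dvd hx
    exact (Nat.le_of_dvd hn h2).antisymm
      (not_lt.1 fun h3 => h1 _ (minpoly.natDegree_pos hx) h3 dvd_rfl)

theorem card_units_degree_eq {n : ℕ} (hn : 0 < n) (h : Module.finrank F K = n) :
    Nat.card {x : Kˣ // ∀ d : ℕ, 1 ≤ d → d < n → x ^ Nat.card F ^ d ≠ x} =
      Nat.card {p : IrredPoly F // p.1.natDegree = n} * n := by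
  have hintegral (x : K) : IsIntegral F x := .of_finite F x
  have hiff (x : Kˣ) : (∀ d : ℕ, 1 ≤ d → d < n → x ^ Nat.card F ^ d ≠ x) ↔
      (minpoly F (x : K)).natDegree = n := by
    rw [natDegree_minpoly_eq_iff hn h]
    simp [Units.ext_iff]
  let f : {x : Kˣ // ∀ d : ℕ, 1 ≤ d → d < n → x ^ Nat.card F ^ d ≠ x} →
      {p : IrredPoly F // p.1.natDegree = n} := fun x =>
    ⟨⟨minpoly F (x.1 : K), ⟨minpoly.monic (hintegral _), minpoly.irreducible (hintegral _)⟩,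
      minpoly.coeff_zero_ne_zero (hintegral _) x.1.ne_zero⟩, (hiff x.1).1 x.2⟩
  have hf (p : {p : IrredPoly F // p.1.natDegree = n}) : Nat.card {x // f x = p} = n := by
    obtain ⟨⟨p, ⟨hm, hi⟩, h0⟩, hp⟩ := p
    have e : {x // f x = ⟨⟨p, ⟨hm, hi⟩, h0⟩, hp⟩} ≃ p.rootSet K := by
      refine Equiv.ofBijective (fun x => ⟨(x.1.1 : K), ?_⟩) ⟨?_, ?_⟩
      · have h1 : minpoly F (x.1.1 : K) = p := congrArg (fun q => q.1.1) x.2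
        rw [mem_rootSet]
        have h2 : aeval (x.1.1 : K) (minpoly F (x.1.1 : K)) = 0 := minpoly.aeval F _
        rw [h1] at h2
        exact ⟨hm.ne_zero, h2⟩
      · intro x y hxy
        exact Subtype.ext (Subtype.ext (Units.ext (congrArg Subtype.val hxy)))
      · rintro ⟨x, hx⟩
        rw [mem_rootSet] at hx
        have h1 : minpoly F x = p := (minpoly.eq_of_irreducible_of_monic hi hx.2 hm).symm
        have hx0 : x ≠ 0 := by
          rintro rfl
          apply h0
          have := hx.2
          rw [← coeff_zero_eq_aeval_zero'] at this
          simpa using this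
        exact ⟨⟨⟨Units.mk0 x hx0, (hiff _).2 (by rw [Units.val_mk0, h1]; exact hp)⟩,
          Subtype.ext (Subtype.ext h1)⟩, rfl⟩
    rw [Nat.card_congr e]
    have := Fintype.ofFinite K
    have hsplit : (p.map (algebraMap F K)).Splits := by
      have hdvd := hi.natDegree_dvd_iff_dvd_X_pow_card_pow_sub_X.1 hp.dvd
      rw [← h, ← Module.natCard_eq_pow_finrank, Nat.card_eq_fintype_card] at hdvd
      exact (FiniteField.isSplittingField_sub K F).splits.of_dvd
        (map_ne_zero (FiniteField.X_pow_card_sub_X_ne_zero F Fintype.one_lt_card))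
        (Polynomial.map_dvd _ hdvd)
    classical
    rw [Nat.card_eq_fintype_card,
      card_rootSet_eq_natDegree (PerfectField.separable_of_irreducible hi) hsplit]
    exact hp
  have : Finite {p : IrredPoly F // p.1.natDegree = n} := by
    refine Finite.of_surjective f fun p => ?_
    have := (Nat.card_pos_iff.1 (by rw [hf p]; exact hn)).1
    exact ⟨this.some.1, this.some.2⟩
  have := Fintype.ofFinite {p : IrredPoly F // p.1.natDegree = n}
  rw [Nat.card_congr (Equiv.sigmaFiberEquiv f).symm, Nat.card_sigma]
  simp [hf, Nat.card_eq_fintype_card]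

end

end GelfandGraev

/-- The number of isomorphism classes of irreducible cuspidal complex
representations of `GL_n(𝔽_q)` (counted via their characters) is `(1/n)` times the
number of elements of `𝔽_{q^n}^×` of degree exactly `n` over `𝔽_q`, i.e. those `x`
with `x^{q^d} ≠ x` for all `1 ≤ d < n`. -/
theorem stmt7 (q n : ℕ) (hq : IsPrimePow q) (hn : 1 ≤ n)
    (F K : Type) [Field F] [Fintype F] [Field K] [Fintype K]
    (hF : Fintype.card F = q) (hK : Fintype.card K = q ^ n) :
    Nat.card {χ : GL (Fin n) F → ℂ //
        ∃ (V : Type) (_ : AddCommGroup V) (_ : Module ℂ V) (_ : FiniteDimensional ℂ V)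
          (ρ : Representation ℂ (GL (Fin n) F) V),
          IsIrred ρ ∧ IsCuspidal ρ ∧ χ = fun g => LinearMap.trace ℂ V (ρ g)} * n =
      Nat.card {x : Kˣ // ∀ d : ℕ, 1 ≤ d → d < n → x ^ q ^ d ≠ x} := by
  subst hF
  obtain ⟨ψ, hψ⟩ := AddChar.exists_apply_ne_zero.2 (one_ne_zero (α := F))
  obtain ⟨φ⟩ := GelfandGraev.exists_algebra_of_card_eq F K (by omega) hK
  let := φ.toAlgebra
  have hfin : Module.finrank F K = n := by
    have := Module.card_eq_pow_finrank (K := F) (V := K)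
    rw [hK] at this
    exact (Nat.pow_right_injective Fintype.one_lt_card this).symm
  have hψ1 : ψ ≠ 1 := by
    rintro rfl
    exact hψ rfl
  rw [GelfandGraev.card_cuspidal_characters hψ1 hn, GelfandGraev.card_isCusp_eq hψ1 hn,
    ← Nat.card_eq_fintype_card, GelfandGraev.card_units_degree_eq hn hfin]
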